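/- Given any η > 0 there exists n₀ ∈ ℕ such that: if G is a graph on n ≥ n₀ vertices whose degree sequence d₁ ≤ … ≤ dₙ satisfies dᵢ ≥ n/3 + i + ηn for all i ≤ n/3, then G contains the square of a Hamilton cycle. -/

import Mathlib

noncomputable section
open Finset
open scoped Classical

/-- The neighbourhood of a vertex as a finset. -/
def nb {V : Type} [Fintype V] (G : SimpleGraph V) (v : V) : Finset V :=
  Finset.univ.filter (fun w => G.Adj v w)

/-- The degree sequence condition, in a form indexed by real thresholds. -/
def PosaDegree {V : Type} [Fintype V] (G : SimpleGraph V) (γ : ℝ) : Prop :=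
  ∀ s : ℝ, 0 ≤ s → s ≤ (Fintype.card V : ℝ) / 3 →
    ((Finset.univ.filter (fun v => ((nb G v).card : ℝ) <
      (Fintype.card V : ℝ) / 3 + s + γ * Fintype.card V)).card : ℝ) ≤ s

/-- A list in which elements at distance one or two are related. -/
def SqChain {V : Type} (r : V → V → Prop) : List V → Prop
  | [] => True
  | a :: l => (∀ x ∈ l.take 2, r a x) ∧ SqChain r l

section Basic

variable {V : Type} [Fintype V] {G : SimpleGraph V}

@[simp] lemma mem_nb {v w : V} : w ∈ nb G v ↔ G.Adj v w := by simp [nb]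

lemma PosaDegree.exists_mem {γ : ℝ} (h : PosaDegree G γ) {S : Finset V} {s : ℝ} (h0 : 0 ≤ s)
    (h1 : s ≤ (Fintype.card V : ℝ) / 3) (hS : s < S.card) :
    ∃ v ∈ S, (Fintype.card V : ℝ) / 3 + s + γ * Fintype.card V ≤ (nb G v).card := by
  by_contra! hc
  have := h s h0 h1
  have h2 : S.card ≤ (Finset.univ.filter (fun v => ((nb G v).card : ℝ) <
      (Fintype.card V : ℝ) / 3 + s + γ * Fintype.card V)).card :=
    Finset.card_le_card (fun v hv => by simpa using hc v hv)
  have h3 : (S.card : ℝ) ≤ (Finset.univ.filter (fun v => ((nb G v).card : ℝ) <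
      (Fintype.card V : ℝ) / 3 + s + γ * Fintype.card V)).card := by exact_mod_cast h2
  linarith

lemma PosaDegree.min_degree {γ : ℝ} (h : PosaDegree G γ) (v : V) :
    (Fintype.card V : ℝ) / 3 + γ * Fintype.card V ≤ (nb G v).card := by
  obtain ⟨w, hw, h2⟩ := h.exists_mem (S := {v}) (s := 0) le_rfl (by positivity) (by simp)
  rw [Finset.mem_singleton] at hw
  subst hw
  linarith

lemma card_inter_ge (S T : Finset V) :
    (S.card : ℝ) + T.card - Fintype.card V ≤ (S ∩ T).card := by
  have h1 := Finset.card_union_add_card_inter S T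
  have h2 := Finset.card_le_univ (S ∪ T)
  have : ((S ∪ T).card : ℝ) + (S ∩ T).card = S.card + T.card := by exact_mod_cast h1
  have : ((S ∪ T).card : ℝ) ≤ Fintype.card V := by exact_mod_cast h2
  linarith

end Basic

section SqChain

variable {V : Type}

lemma SqChain.append {r : V → V → Prop} {a b : V} {l₁ l₂ : List V}
    (h1 : SqChain r (l₁ ++ [a, b])) (h2 : SqChain r (a :: b :: l₂)) :
    SqChain r (l₁ ++ a :: b :: l₂) := by
  induction l₁ with
  | nil => simpa using h2
  | cons x l ih =>
    simp only [List.cons_append, SqChain] at h1 ⊢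
    refine ⟨?_, ih h1.2⟩
    have : (l ++ a :: b :: l₂).take 2 = (l ++ [a, b]).take 2 := by
      rcases l with _ | ⟨y, _ | ⟨z, l⟩⟩ <;> simp
    rw [this]
    exact h1.1

lemma SqChain.of_append_right {r : V → V → Prop} {l₁ l₂ : List V} (h : SqChain r (l₁ ++ l₂)) :
    SqChain r l₂ := by
  induction l₁ with
  | nil => exact h
  | cons a l ih => exact ih h.2

end SqChain

/-- One step of a square walk: `(p, q)` is followed by `(q, s)` for a triangle `pqs`. -/
def DartStep {V : Type} (R : SimpleGraph V) (e f : V × V) : Prop :=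
  e.2 = f.1 ∧ R.Adj e.1 e.2 ∧ R.Adj f.1 f.2 ∧ R.Adj e.1 f.2

/-- The graph on ordered pairs whose edges are the steps of square walks. -/
def dartGraph {V : Type} (R : SimpleGraph V) : SimpleGraph (V × V) :=
  SimpleGraph.fromRel (DartStep R)

section Dart

variable {V : Type} {R : SimpleGraph V}

lemma dart_step {p q s : V} (h1 : R.Adj p q) (h2 : R.Adj q s) (h3 : R.Adj p s) :
    (dartGraph R).Reachable (p, q) (q, s) := by
  apply SimpleGraph.Adj.reachable
  rw [dartGraph, SimpleGraph.fromRel_adj]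
  refine ⟨?_, Or.inl ⟨rfl, h1, h2, h3⟩⟩
  intro h
  have : p = q := congrArg Prod.fst h
  exact h1.ne this

lemma dart_rev {e f : V × V} (h : (dartGraph R).Reachable e f) :
    (dartGraph R).Reachable e.swap f.swap := by
  let φ : dartGraph R →g dartGraph R := ⟨Prod.swap, by
    intro a b hab
    rw [dartGraph, SimpleGraph.fromRel_adj] at hab ⊢
    refine ⟨fun h => hab.1 (Prod.swap_injective h), ?_⟩
    rcases hab.2 with h | h
    · exact Or.inr ⟨h.1.symm, h.2.2.1.symm, h.2.1.symm, h.2.2.2.symm⟩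
    · exact Or.inl ⟨h.1.symm, h.2.2.1.symm, h.2.1.symm, h.2.2.2.symm⟩⟩
  exact h.map φ

lemma dart_rev' {p q r s : V} (h : (dartGraph R).Reachable (p, q) (r, s)) :
    (dartGraph R).Reachable (q, p) (s, r) := dart_rev h

lemma dart_link {x b c : V} (h1 : R.Adj x b) (h2 : R.Adj x c) (h3 : R.Adj b c) :
    (dartGraph R).Reachable (x, b) (c, x) :=
  (dart_step h1 h3 h2).trans (dart_step h3 h2.symm h1.symm)

lemma dart_adj {e f : V × V} (h : (dartGraph R).Reachable e f) (he : R.Adj e.1 e.2) :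
    R.Adj f.1 f.2 := by
  obtain ⟨w⟩ := h
  induction w with
  | nil => exact he
  | cons hadj _ ih =>
    apply ih
    rw [dartGraph, SimpleGraph.fromRel_adj] at hadj
    rcases hadj.2 with h | h
    · exact h.2.2.1
    · exact h.2.1

lemma dart_triangle {e f : V × V} (h : (dartGraph R).Reachable e f)
    (he : R.Adj e.1 e.2) (ht : ∃ s, R.Adj e.1 s ∧ R.Adj e.2 s) :
    ∃ s, R.Adj f.1 s ∧ R.Adj f.2 s := by
  obtain ⟨w⟩ := h
  induction w with
  | nil => exact ht
  | @cons u v w hadj _ ih =>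
    rw [dartGraph, SimpleGraph.fromRel_adj] at hadj
    rcases hadj.2 with h | h
    · exact ih h.2.2.1 ⟨u.1, by rw [← h.1]; exact h.2.1.symm, h.2.2.2.symm⟩
    · exact ih h.2.1 ⟨u.2, h.2.2.2, by rw [h.1]; exact h.2.2.1⟩

lemma exists_sqChain_of_walk {e f : V × V} (w : (dartGraph R).Walk e f)
    (hf : R.Adj f.1 f.2) (ht : ∃ s, R.Adj f.1 s ∧ R.Adj f.2 s) :
    ∃ l : List V, l.length ≤ 4 * w.length + 1 ∧
      SqChain R.Adj (e.1 :: e.2 :: (l ++ [f.1, f.2])) := by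
  induction w with
  | nil =>
    obtain ⟨s, h1, h2⟩ := ht
    exact ⟨[s], by simp, by simp [SqChain, h1, h2, hf, hf.symm, h1.symm, h2.symm]⟩
  | @cons u v w hadj p ih =>
    obtain ⟨l, hl, hc⟩ := ih hf ht
    rw [dartGraph, SimpleGraph.fromRel_adj] at hadj
    obtain ⟨u1, u2⟩ := u
    obtain ⟨v1, v2⟩ := v
    rcases hadj.2 with h | h
    · obtain ⟨h0, ha, hb, hd⟩ := h
      dsimp only at h0 ha hb hd hc ⊢
      subst h0
      refine ⟨[v2, u1] ++ (u2 :: v2 :: l), by simp; omega, ?_⟩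
      have := SqChain.append (l₁ := [u1, u2, v2, u1]) (a := u2) (b := v2)
        (l₂ := l ++ [w.1, w.2]) (r := R.Adj)
        (by simp [SqChain, ha, hb, hd, hb.symm, ha.symm, hd.symm]) hc
      simpa using this
    · obtain ⟨h0, ha, hb, hd⟩ := h
      dsimp only at h0 ha hb hd hc ⊢
      subst h0
      refine ⟨v1 :: v2 :: l, by simp; omega, ?_⟩
      have := SqChain.append (l₁ := [v2, u2]) (a := v1) (b := v2)
        (l₂ := l ++ [w.1, w.2]) (r := R.Adj)
        (by simp [SqChain, ha, hb, hb.symm, ha.symm, hd.symm]) hc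
      simpa using this

end Dart

section Main

variable {V : Type} [Fintype V] {R : SimpleGraph V} {γ : ℝ}

/-- Vertices of degree at least `(2/3 + γ)n`. -/
def High (R : SimpleGraph V) (γ : ℝ) (x : V) : Prop :=
  2 * (Fintype.card V : ℝ) / 3 + γ * Fintype.card V ≤ (nb R x).card

lemma PosaDegree.exists_high (h : PosaDegree R γ) {S : Finset V}
    (hS : (Fintype.card V : ℝ) / 3 < S.card) : ∃ v ∈ S, High R γ v := by
  obtain ⟨v, hv, h2⟩ := h.exists_mem (by positivity) le_rfl hS
  exact ⟨v, hv, by unfold High; linarith⟩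

lemma card_pos_real (x : V) : (0 : ℝ) < Fintype.card V := by
  have : 0 < Fintype.card V := Fintype.card_pos_iff.mpr ⟨x⟩
  exact_mod_cast this

lemma card_inter_pos {S T : Finset V} (h : (Fintype.card V : ℝ) < S.card + T.card) :
    (S ∩ T).Nonempty := by
  rw [← Finset.card_pos]
  have := card_inter_ge S T
  have : (0 : ℝ) < (S ∩ T).card := by linarith
  exact_mod_cast this

lemma dart_high_high (hγ : 0 < γ) {x b b' : V} (hx : High R γ x)
    (hb : R.Adj x b) (hb' : R.Adj x b') (h1 : High R γ b) (h2 : High R γ b') :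
    (dartGraph R).Reachable (x, b) (x, b') := by
  have hp := card_pos_real x
  have hγp := mul_pos hγ hp
  unfold High at *
  obtain ⟨c, hc⟩ : (nb R x ∩ (nb R b ∩ nb R b')).Nonempty := by
    apply card_inter_pos
    have := card_inter_ge (nb R b) (nb R b')
    linarith
  simp only [Finset.mem_inter, mem_nb] at hc
  exact (dart_link hb hc.1 hc.2.1).trans (dart_link hb' hc.1 hc.2.2).symm

lemma dart_high_flip (hR : PosaDegree R γ) (hγ : 0 < γ) {x b : V} (hx : High R γ x)
    (hb : R.Adj x b) (h1 : High R γ b) :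
    (dartGraph R).Reachable (x, b) (b, x) := by
  have hp := card_pos_real x
  have hγp := mul_pos hγ hp
  obtain ⟨c, hc, hch⟩ := hR.exists_high (S := nb R x ∩ nb R b) (by
    have := card_inter_ge (nb R x) (nb R b)
    unfold High at hx h1
    linarith)
  simp only [Finset.mem_inter, mem_nb] at hc
  exact (dart_link hb hc.1 hc.2).trans (dart_rev' (dart_high_high hγ hx hc.1 hb hch h1))

lemma dart_high_all (hR : PosaDegree R γ) (hγ : 0 < γ) {x h : V} (hx : High R γ x)
    (hxh : R.Adj x h) (hh : High R γ h) {b : V} (hb : R.Adj x b) :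
    (dartGraph R).Reachable (x, b) (x, h) := by
  have hp := card_pos_real x
  have hγp := mul_pos hγ hp
  induction hk : Fintype.card V - (nb R b).card using Nat.strong_induction_on generalizing b with
  | _ k ih =>
    by_cases hbh : High R γ b
    · exact dart_high_high hγ hx hb hxh hbh hh
    have hbmin := hR.min_degree b
    have hI := card_inter_ge (nb R x) (nb R b)
    have hx' := hx
    unfold High at hx' hbh
    push Not at hbh
    have key : ∃ c ∈ nb R x ∩ nb R b, (nb R b).card < (nb R c).card := by
      by_cases hs : ((nb R b).card : ℝ) - Fintype.card V / 3 ≤ Fintype.card V / 3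
      · obtain ⟨c, hc, h2⟩ := hR.exists_mem (S := nb R x ∩ nb R b)
          (s := (nb R b).card - Fintype.card V / 3) (by linarith) hs (by linarith)
        refine ⟨c, hc, ?_⟩
        have : ((nb R b).card : ℝ) < (nb R c).card := by linarith
        exact_mod_cast this
      · obtain ⟨c, hc, h2⟩ := hR.exists_high (S := nb R x ∩ nb R b) (by linarith)
        refine ⟨c, hc, ?_⟩
        unfold High at h2
        have : ((nb R b).card : ℝ) < (nb R c).card := by linarith
        exact_mod_cast this
    obtain ⟨c, hc, hlt⟩ := key
    simp only [Finset.mem_inter, mem_nb] at hc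
    have hle : (nb R c).card ≤ Fintype.card V := Finset.card_le_univ _
    have := ih (Fintype.card V - (nb R c).card) (by omega) hc.1 rfl
    exact ((dart_link hb hc.1 hc.2).trans (dart_rev' this)).trans
      (dart_high_flip hR hγ hx hxh hh).symm

/-- The ordered edges in the same class as the edges at vertices of high degree. -/
def MainDart (R : SimpleGraph V) (γ : ℝ) (e : V × V) : Prop :=
  ∃ x b, High R γ x ∧ R.Adj x b ∧ (dartGraph R).Reachable (x, b) e

lemma dart_high_any (hR : PosaDegree R γ) (hγ : 0 < γ) {x b x' b' : V} (hx : High R γ x)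
    (hx' : High R γ x') (hb : R.Adj x b) (hb' : R.Adj x' b') :
    (dartGraph R).Reachable (x, b) (x', b') := by
  have hp := card_pos_real x
  have hγp := mul_pos hγ hp
  obtain ⟨z, hz, hzh⟩ := hR.exists_high (S := nb R x ∩ nb R x') (by
    have := card_inter_ge (nb R x) (nb R x')
    unfold High at hx hx'
    linarith)
  simp only [Finset.mem_inter, mem_nb] at hz
  refine (dart_high_all hR hγ hx hz.1 hzh hb).trans ?_
  refine (dart_high_flip hR hγ hx hz.1 hzh).trans ?_
  have h1 : (dartGraph R).Reachable (z, x) (x', z) :=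
    (dart_high_all hR hγ hzh hz.2.symm hx' hz.1.symm).trans
      (dart_high_flip hR hγ hzh hz.2.symm hx')
  exact h1.trans (dart_high_all hR hγ hx' hz.2 hzh hb').symm

lemma mainDart_of_high {x b : V} (hx : High R γ x) (hb : R.Adj x b) : MainDart R γ (x, b) :=
  ⟨x, b, hx, hb, SimpleGraph.Reachable.refl _⟩

lemma MainDart.reachable (hR : PosaDegree R γ) (hγ : 0 < γ) {e f : V × V} (he : MainDart R γ e)
    (hf : MainDart R γ f) : (dartGraph R).Reachable e f := by
  obtain ⟨x, b, hx, hb, h1⟩ := he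
  obtain ⟨x', b', hx', hb', h2⟩ := hf
  exact h1.symm.trans ((dart_high_any hR hγ hx hx' hb hb').trans h2)

lemma MainDart.trans {e f : V × V} (he : MainDart R γ e)
    (hf : (dartGraph R).Reachable e f) : MainDart R γ f := by
  obtain ⟨x, b, hx, hb, h1⟩ := he
  exact ⟨x, b, hx, hb, h1.trans hf⟩

lemma MainDart.swap (hR : PosaDegree R γ) (hγ : 0 < γ) {p q : V} (he : MainDart R γ (p, q)) :
    MainDart R γ (q, p) := by
  obtain ⟨x, b, hx, hb, h1⟩ := he
  have hp := card_pos_real x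
  have hγp := mul_pos hγ hp
  obtain ⟨z, hz, hzh⟩ := hR.exists_high (S := nb R x) (by
    unfold High at hx
    linarith)
  rw [mem_nb] at hz
  refine ⟨x, b, hx, hb, ?_⟩
  have h2 := dart_rev' h1
  have h3 := dart_high_all hR hγ hx hz hzh hb
  have h4 := dart_rev' h3
  exact h3.trans ((dart_high_flip hR hγ hx hz hzh).trans (h4.symm.trans h2))

lemma MainDart.adj {e : V × V} (he : MainDart R γ e) : R.Adj e.1 e.2 := by
  obtain ⟨x, b, hx, hb, h1⟩ := he
  exact dart_adj h1 hb

lemma MainDart.step {p q s : V} (he : MainDart R γ (p, q)) (h2 : R.Adj q s) (h3 : R.Adj p s) :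
    MainDart R γ (q, s) :=
  he.trans (dart_step he.adj h2 h3)

lemma MainDart.triangle (hR : PosaDegree R γ) (hγ : 0 < γ) {p q : V} (he : MainDart R γ (p, q)) :
    ∃ s, R.Adj p s ∧ R.Adj q s := by
  obtain ⟨x, b, hx, hb, h1⟩ := he
  have hp := card_pos_real x
  have hγp := mul_pos hγ hp
  refine dart_triangle h1 hb ?_
  obtain ⟨c, hc⟩ : (nb R x ∩ nb R b).Nonempty := by
    apply card_inter_pos
    have := hR.min_degree b
    unfold High at hx
    linarith
  simp only [Finset.mem_inter, mem_nb] at hc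
  exact ⟨c, hc.1, hc.2⟩

/-- Any two ordered edges of the main class are joined by a short square walk. -/
lemma MainDart.exists_walk (hR : PosaDegree R γ) (hγ : 0 < γ) {p q r s : V}
    (he : MainDart R γ (p, q)) (hf : MainDart R γ (r, s)) :
    ∃ l : List V, l.length ≤ 4 * Fintype.card V ^ 2 + 1 ∧
      SqChain R.Adj (p :: q :: (l ++ [r, s])) := by
  obtain ⟨w⟩ := he.reachable hR hγ hf
  have hw := w.toPath.2.length_lt
  obtain ⟨l, hl, hc⟩ := exists_sqChain_of_walk w.toPath.1 hf.adj (hf.triangle hR hγ)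
  refine ⟨l, hl.trans ?_, hc⟩
  rw [Fintype.card_prod] at hw
  nlinarith

end Main

section LinearProgram

variable {V τ : Type} [Fintype τ]

lemma exists_max_packing (T : τ → Finset V) (hT : ∀ t, (T t).Nonempty) :
    ∃ w : τ → ℝ, (∀ t, 0 ≤ w t) ∧ (∀ v, ∑ t with v ∈ T t, w t ≤ 1) ∧
      ∀ w' : τ → ℝ, (∀ t, 0 ≤ w' t) → (∀ v, ∑ t with v ∈ T t, w' t ≤ 1) →
        ∑ t, w' t ≤ ∑ t, w t := by
  have hc : IsCompact {w : τ → ℝ | (∀ t, 0 ≤ w t) ∧ ∀ v, ∑ t with v ∈ T t, w t ≤ 1} := by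
    refine (isCompact_Icc (a := (0 : τ → ℝ)) (b := 1)).of_isClosed_subset ?_ ?_
    · simp only [Set.ofPred_and, Set.ofPred_forall]
      refine IsClosed.inter (isClosed_iInter fun t => isClosed_le (by fun_prop) (by fun_prop))
        (isClosed_iInter fun t => isClosed_le (by fun_prop) (by fun_prop))
    · rintro w ⟨h0, h1⟩
      refine ⟨h0, fun t => ?_⟩
      obtain ⟨v, hv⟩ := hT t
      refine le_trans ?_ (h1 v)
      exact Finset.single_le_sum (f := w) (fun i _ => h0 i) (by simp [hv])
  obtain ⟨w, hw, hmax⟩ := hc.exists_isMaxOn (f := fun w => ∑ t, w t)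
    ⟨0, by simp⟩ (by fun_prop)
  exact ⟨w, hw.1, hw.2, fun w' h0 h1 => hmax ⟨h0, h1⟩⟩

variable [Fintype V]

lemma exists_dual_bound (T : τ → Finset V) {W : ℝ} (hW : 0 ≤ W)
    (hmax : ∀ w' : τ → ℝ, (∀ t, 0 ≤ w' t) → (∀ v, ∑ t with v ∈ T t, w' t ≤ 1) →
        ∑ t, w' t ≤ W) :
    ∃ y : V → ℝ, (∀ v, 0 ≤ y v) ∧ (∀ t, 1 ≤ ∑ v ∈ T t, y v) ∧ ∑ v, y v ≤ W := by
  set D : Set ((V → ℝ) × ℝ) := {p | ∃ w : τ → ℝ, (∀ t, 0 ≤ w t) ∧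
    (∀ v, ∑ t with v ∈ T t, w t < p.1 v) ∧ p.2 < ∑ t, w t} with hD
  have hDc : Convex ℝ D := by
    rintro p ⟨w, h0, h1, h2⟩ p' ⟨w', h0', h1', h2'⟩ a b ha hb hab
    refine ⟨fun t => a * w t + b * w' t, fun t => ?_, fun v => ?_, ?_⟩
    · have := h0 t; have := h0' t; positivity
    · simp only [Finset.sum_add_distrib, ← Finset.mul_sum, Prod.fst_add, Prod.smul_fst,
        Pi.add_apply, Pi.smul_apply, smul_eq_mul]
      rcases ha.eq_or_lt with rfl | ha
      · have : b = 1 := by linarith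
        subst this; simpa using h1' v
      · exact add_lt_add_of_lt_of_le (mul_lt_mul_of_pos_left (h1 v) ha)
          (mul_le_mul_of_nonneg_left (h1' v).le hb)
    · simp only [Finset.sum_add_distrib, ← Finset.mul_sum, Prod.snd_add, Prod.smul_snd,
        smul_eq_mul]
      rcases ha.eq_or_lt with rfl | ha
      · have : b = 1 := by linarith
        subst this; simpa using h2'
      · exact add_lt_add_of_lt_of_le (mul_lt_mul_of_pos_left h2 ha)
          (mul_le_mul_of_nonneg_left h2'.le hb)
  have hDo : IsOpen D := by
    have : D = ⋃ w : {w : τ → ℝ // ∀ t, 0 ≤ w t},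
        {p : (V → ℝ) × ℝ | (∀ v, ∑ t with v ∈ T t, w.1 t < p.1 v) ∧ p.2 < ∑ t, w.1 t} := by
      ext p
      simp [hD, and_left_comm]
    rw [this]
    refine isOpen_iUnion fun w => ?_
    simp only [Set.ofPred_and, Set.ofPred_forall]
    exact (isOpen_iInter_of_finite fun v => isOpen_lt (by fun_prop) (by fun_prop)).inter
      (isOpen_lt (by fun_prop) (by fun_prop))
  have hnot : ((fun _ => 1, W) : (V → ℝ) × ℝ) ∉ D := by
    rintro ⟨w, h0, h1, h2⟩
    exact absurd (hmax w h0 fun v => (h1 v).le) (not_le.mpr h2)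
  obtain ⟨f, hf⟩ := geometric_hahn_banach_open_point hDc hDo hnot
  set lam : ℝ := f (0, 1) with hlam
  set y' : V → ℝ := fun v => - f (Pi.single v 1, 0) with hy'
  have hfe : ∀ (p : V → ℝ) (q : ℝ), f (p, q) = - ∑ v, p v * y' v + lam * q := by
    intro p q
    have h1 : ((p, q) : (V → ℝ) × ℝ) = ∑ v, p v • ((Pi.single v 1, 0) : (V → ℝ) × ℝ) +
        q • ((0, 1) : (V → ℝ) × ℝ) := by
      refine Prod.ext ?_ ?_
      · ext u
        simp [Prod.fst_sum, Pi.single_apply]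
      · simp [Prod.snd_sum]
    rw [h1, map_add, map_sum, map_smul]
    simp only [map_smul, smul_eq_mul, hy', hlam, mul_neg, Finset.sum_neg_distrib, neg_neg]
    ring
  have key : ∀ (w : τ → ℝ), (∀ t, 0 ≤ w t) → ∀ p : V → ℝ, (∀ v, ∑ t with v ∈ T t, w t < p v) →
      ∀ q : ℝ, q < ∑ t, w t → - ∑ v, p v * y' v + lam * q < - ∑ v, y' v + lam * W := by
    intro w h0 p h1 q h2
    have := hf (p, q) ⟨w, h0, h1, h2⟩
    rw [hfe, hfe] at this
    simpa using this
  have hlam0 : 0 < lam := by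
    have := key 0 (by simp) (fun _ => 1) (by simp) (-1) (by simp)
    simp only [one_mul] at this
    nlinarith
  have hy0 : ∀ v, 0 ≤ y' v := by
    intro v
    by_contra! hneg
    set N : ℝ := (lam * (W + 1)) / (- y' v) with hN
    have hNp : 0 ≤ N := div_nonneg (by positivity) (by linarith)
    have := key 0 (by simp) (fun u => 1 + (if u = v then N else 0))
      (by intro u; simp; split_ifs <;> linarith) (-1) (by simp)
    simp only [add_mul, one_mul, Finset.sum_add_distrib, ite_mul, zero_mul, Finset.sum_ite_eq',
      Finset.mem_univ, if_true] at this
    have h3 : N * (- y' v) = lam * (W + 1) := div_mul_cancel₀ _ (by linarith)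
    linarith
  have hyT : ∀ t, lam ≤ ∑ v ∈ T t, y' v := by
    intro t
    by_contra! hneg
    set c : ℝ := lam * W + lam with hc
    have hcp : 0 ≤ c := by positivity
    set d : ℝ := lam - ∑ v ∈ T t, y' v with hd
    have hdp : 0 < d := by linarith
    have := key (Pi.single t (c / d))
      (fun u => by
        by_cases h : u = t
        · subst h; simp; positivity
        · simp [h])
      (fun v => 1 + if v ∈ T t then c / d else 0)
      (by
        intro v
        rw [Finset.sum_filter]
        have : ∀ a : τ, (if v ∈ T a then (Pi.single t (c / d) : τ → ℝ) a else 0) =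
            if a = t then (if v ∈ T t then c / d else 0) else 0 := by
          intro a
          by_cases h : a = t
          · subst h; simp
          · simp [h]
        simp only [this]
        simp)
      (c / d - 1) (by simp)
    simp only [add_mul, one_mul, Finset.sum_add_distrib, ite_mul, zero_mul] at this
    rw [Finset.sum_ite_mem, Finset.univ_inter, ← Finset.mul_sum] at this
    have h3 : c / d * d = c := div_mul_cancel₀ _ hdp.ne'
    have h4 : c / d * d = c / d * lam - c / d * ∑ v ∈ T t, y' v := by rw [hd]; ring
    have h5 : 0 ≤ ∑ v, y' v := Finset.sum_nonneg fun v _ => hy0 v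
    nlinarith
  have hyS : ∑ v, y' v ≤ lam * W := by
    have h5 : 0 ≤ ∑ v, y' v := Finset.sum_nonneg fun v _ => hy0 v
    refine le_of_forall_pos_le_add fun ε hε => ?_
    set e : ℝ := ε / (∑ v, y' v + lam) with he
    have hpos : 0 < ∑ v, y' v + lam := by linarith
    have hep : 0 < e := by positivity
    have := key 0 (by simp) (fun _ => e) (fun _ => by simpa using hep) (-e) (by simpa using hep)
    rw [← Finset.mul_sum] at this
    have h3 : e * (∑ v, y' v + lam) = ε := div_mul_cancel₀ _ hpos.ne'
    linarith
  refine ⟨fun v => y' v / lam, fun v => div_nonneg (hy0 v) hlam0.le, fun t => ?_, ?_⟩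
  · rw [← Finset.sum_div, le_div_iff₀ hlam0]
    linarith [hyT t]
  · rw [← Finset.sum_div, div_le_iff₀ hlam0]
    linarith

lemma exists_packing_cover (T : τ → Finset V) (hT : ∀ t, (T t).Nonempty) :
    ∃ (w : τ → ℝ) (y : V → ℝ), (∀ t, 0 ≤ w t) ∧ (∀ v, ∑ t with v ∈ T t, w t ≤ 1) ∧
      (∀ v, 0 ≤ y v) ∧ (∀ t, 1 ≤ ∑ v ∈ T t, y v) ∧ ∑ v, y v = ∑ t, w t ∧
      (∀ t, 0 < w t → ∑ v ∈ T t, y v = 1) ∧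
      (∀ v, 0 < y v → ∑ t with v ∈ T t, w t = 1) := by
  obtain ⟨w, hw0, hw1, hmax⟩ := exists_max_packing T hT
  obtain ⟨y, hy0, hyT, hyS⟩ := exists_dual_bound T (Finset.sum_nonneg fun t _ => hw0 t) hmax
  have h1 : ∑ t, w t * (∑ v ∈ T t, y v) = ∑ v, y v * ∑ t with v ∈ T t, w t := by
    simp only [Finset.mul_sum, Finset.sum_filter]
    rw [Finset.sum_comm' (s' := fun v => Finset.univ.filter fun t => v ∈ T t)
      (t' := Finset.univ) (by simp)]
    refine Finset.sum_congr rfl fun v _ => ?_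
    rw [Finset.sum_filter]
    refine Finset.sum_congr rfl fun t _ => ?_
    split_ifs <;> ring
  have h2 : ∑ t, w t * (∑ v ∈ T t, y v - 1) + ∑ v, y v * (1 - ∑ t with v ∈ T t, w t) =
      ∑ v, y v - ∑ t, w t := by
    simp only [mul_sub, mul_one, Finset.sum_sub_distrib, h1]
    ring
  have h3 : ∀ t, 0 ≤ w t * (∑ v ∈ T t, y v - 1) := fun t =>
    mul_nonneg (hw0 t) (by linarith [hyT t])
  have h4 : ∀ v, 0 ≤ y v * (1 - ∑ t with v ∈ T t, w t) := fun v =>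
    mul_nonneg (hy0 v) (by linarith [hw1 v])
  have h5 := Finset.sum_nonneg fun t (_ : t ∈ Finset.univ) => h3 t
  have h6 := Finset.sum_nonneg fun v (_ : v ∈ Finset.univ) => h4 v
  have h7 := (Finset.sum_eq_zero_iff_of_nonneg fun t (_ : t ∈ Finset.univ) => h3 t).mp
    (by linarith)
  have h8 := (Finset.sum_eq_zero_iff_of_nonneg fun v (_ : v ∈ Finset.univ) => h4 v).mp
    (by linarith)
  refine ⟨w, y, hw0, hw1, hy0, hyT, by linarith, fun t ht => ?_, fun v hv => ?_⟩
  · rcases mul_eq_zero.mp (h7 t (Finset.mem_univ _)) with h | h <;> linarith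
  · rcases mul_eq_zero.mp (h8 v (Finset.mem_univ _)) with h | h <;> linarith

end LinearProgram

section FractionalTiling

variable {V : Type} [Fintype V] {R : SimpleGraph V} {γ : ℝ}

/-- Triangles all of whose ordered edges belong to the main class. -/
def IsMainTri (R : SimpleGraph V) (γ : ℝ) (T : Finset V) : Prop :=
  ∃ p q s, T = {p, q, s} ∧ R.Adj q s ∧ R.Adj p s ∧ MainDart R γ (p, q)

lemma IsMainTri.card_eq {T : Finset V} (h : IsMainTri R γ T) : T.card = 3 := by
  obtain ⟨p, q, s, rfl, h1, h2, h3⟩ := h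
  have : p ≠ q := h3.adj.ne
  rw [Finset.card_eq_three]
  exact ⟨p, q, s, this, h2.ne, h1.ne, rfl⟩

lemma IsMainTri.mainDart (hR : PosaDegree R γ) (hγ : 0 < γ) {T : Finset V} (h : IsMainTri R γ T)
    {b c : V} (hb : b ∈ T) (hc : c ∈ T) (hbc : b ≠ c) : MainDart R γ (b, c) := by
  obtain ⟨p, q, s, rfl, h1, h2, h3⟩ := h
  have h4 := h3.step h1 h2
  have h5 := h4.step h2.symm h3.adj.symm
  have h3' := h3.swap hR hγ
  have h4' := h4.swap hR hγ
  have h5' := h5.swap hR hγ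
  simp only [Finset.mem_insert, Finset.mem_singleton] at hb hc
  rcases hb with rfl | rfl | rfl <;> rcases hc with rfl | rfl | rfl <;>
    first | exact absurd rfl hbc | assumption

lemma IsMainTri.replace (hR : PosaDegree R γ) (hγ : 0 < γ) {T : Finset V} (h : IsMainTri R γ T)
    {x b c : V} (hb : b ∈ T) (hc : c ∈ T) (hbc : b ≠ c) (h1 : R.Adj x b) (h2 : R.Adj x c) :
    IsMainTri R γ {x, b, c} := by
  have h3 := h.mainDart hR hγ hb hc hbc
  refine ⟨b, c, x, ?_, h2.symm, h1.symm, h3⟩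
  ext z
  simp only [Finset.mem_insert, Finset.mem_singleton]
  tauto

lemma isMainTri_of_high {x b c : V} (hx : High R γ x) (h1 : R.Adj x b) (h2 : R.Adj x c)
    (h3 : R.Adj b c) : IsMainTri R γ {x, b, c} :=
  ⟨x, b, c, rfl, h3, h2, mainDart_of_high hx h1⟩

end FractionalTiling

section Counting

variable {V : Type}

lemma sum_mul_card_inter {τ : Type} [Fintype τ] (T : τ → Finset V) (w : τ → ℝ) (S : Finset V) :
    ∑ t, w t * ((T t ∩ S).card : ℝ) = ∑ v ∈ S, ∑ t with v ∈ T t, w t := by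
  simp only [Finset.sum_filter]
  rw [Finset.sum_comm]
  refine Finset.sum_congr rfl fun t _ => ?_
  rw [← Finset.sum_filter, Finset.sum_const, nsmul_eq_mul, mul_comm]
  congr 3
  ext v
  simp [and_comm]

lemma exists_pairwise_contra {T N : Finset V} {y : V → ℝ} (hT : T.card = 3)
    (h1 : ∑ v ∈ T, y v = 1)
    (h2 : ∀ b ∈ T ∩ N, ∀ c ∈ T ∩ N, b ≠ c → 1 ≤ y b + y c) : ¬ T ⊆ N := by
  intro hs
  rw [Finset.inter_eq_left.mpr hs] at h2
  obtain ⟨p, q, s, hpq, hps, hqs, rfl⟩ := Finset.card_eq_three.mp hT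
  have := h2 p (by simp) q (by simp) hpq
  have := h2 p (by simp) s (by simp) hps
  have := h2 q (by simp) s (by simp) hqs
  rw [Finset.sum_insert (by simp [hpq, hps]), Finset.sum_pair hqs] at h1
  linarith

/-- Every triple which carries weight meets a neighbourhood in a controlled number of points. -/
lemma card_inter_le_of_pair {T N Z : Finset V} {y : V → ℝ} (hT : T.card = 3)
    (h0 : ∀ v, 0 ≤ y v) (hZ : ∀ v, v ∈ Z ↔ y v = 0) (h1 : ∑ v ∈ T, y v = 1)
    (h2 : ∀ b ∈ T ∩ N, ∀ c ∈ T ∩ N, b ≠ c → 1 ≤ y b + y c) :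
    (T ∩ N).card ≤ 1 + (T ∩ (Z \ N)).card := by
  have h3 := exists_pairwise_contra hT h1 h2
  by_cases h4 : (T ∩ N).card ≤ 1
  · omega
  push Not at h4
  have h5 : (T ∩ N).card < T.card :=
    Finset.card_lt_card (Finset.ssubset_iff_subset_ne.mpr ⟨Finset.inter_subset_left,
      fun h => h3 (Finset.inter_eq_left.mp h)⟩)
  have h6 : (T ∩ N).card = 2 := by omega
  obtain ⟨s, hsT, hsN⟩ := Finset.not_subset.mp h3
  obtain ⟨b, c, hbc, hbcN⟩ := Finset.card_eq_two.mp h6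
  have h7 := h2 b (by simp [hbcN]) c (by simp [hbcN]) hbc
  have h8 : ∑ v ∈ T ∩ N, y v + y s ≤ ∑ v ∈ T, y v := by
    rw [add_comm, ← Finset.sum_insert (by simp [hsN])]
    refine Finset.sum_le_sum_of_subset_of_nonneg ?_ fun v _ _ => h0 v
    intro v hv
    rcases Finset.mem_insert.mp hv with rfl | hv
    · exact hsT
    · exact Finset.mem_of_mem_inter_left hv
  rw [hbcN, Finset.sum_pair hbc] at h8
  have h9 : y s = 0 := le_antisymm (by linarith) (h0 s)
  have : 0 < (T ∩ (Z \ N)).card := Finset.card_pos.mpr ⟨s, by simp [hsT, hsN, hZ, h9]⟩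
  omega

lemma card_inter_le_of_large {T N Z A : Finset V} {y : V → ℝ} (hT : T.card = 3)
    (h0 : ∀ v, 0 ≤ y v) (hZ : ∀ v, v ∈ Z ↔ y v = 0) (hA : ∀ v, v ∈ A ↔ 1 ≤ y v)
    (h1 : ∑ v ∈ T, y v = 1)
    (h2 : ∀ b ∈ T ∩ N, ∀ c ∈ T ∩ N, b ≠ c → 1 ≤ y b + y c) :
    (T ∩ N).card + (T ∩ A).card ≤ 2 + (T ∩ (Z ∩ N)).card := by
  have h3 := exists_pairwise_contra hT h1 h2
  have h5 : (T ∩ N).card < T.card :=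
    Finset.card_lt_card (Finset.ssubset_iff_subset_ne.mpr ⟨Finset.inter_subset_left,
      fun h => h3 (Finset.inter_eq_left.mp h)⟩)
  by_cases h4 : (T ∩ A) = ∅
  · rw [h4]; simp; omega
  obtain ⟨a, ha⟩ := Finset.nonempty_iff_ne_empty.mpr h4
  rw [Finset.mem_inter, hA] at ha
  have h6 : ∀ v ∈ T, v ≠ a → y v = 0 := by
    intro v hv hva
    have h7 : ∑ u ∈ ({a, v} : Finset V), y u ≤ ∑ u ∈ T, y u := by
      refine Finset.sum_le_sum_of_subset_of_nonneg ?_ fun v _ _ => h0 v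
      intro u hu
      simp only [Finset.mem_insert, Finset.mem_singleton] at hu
      rcases hu with rfl | rfl
      · exact ha.1
      · exact hv
    rw [Finset.sum_pair hva.symm] at h7
    exact le_antisymm (by linarith [ha.2]) (h0 v)
  have h8 : T ∩ A ⊆ {a} := by
    intro v hv
    rw [Finset.mem_inter, hA] at hv
    by_contra h
    have := h6 v hv.1 (by simpa using h)
    linarith [hv.2]
  have h9 : T ∩ N ⊆ insert a (T ∩ (Z ∩ N)) := by
    intro v hv
    rw [Finset.mem_inter] at hv
    by_cases h : v = a
    · simp [h]
    · simp [hv.1, hv.2, hZ, h6 v hv.1 h]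
  have h10 := (Finset.card_le_card h9).trans (Finset.card_insert_le _ _)
  have h11 := Finset.card_le_card h8
  rw [Finset.card_singleton] at h11
  omega

end Counting

section FractionalTiling

variable {V : Type} [Fintype V] {R : SimpleGraph V} {γ : ℝ}

lemma posaDegree_exists_near (hR : PosaDegree R γ) {S : Finset V} (hS : S.Nonempty) (hγ : 0 < γ) :
    (∃ x ∈ S, (Fintype.card V : ℝ) / 3 + S.card + γ / 2 * Fintype.card V ≤ (nb R x).card) ∨
      (Fintype.card V : ℝ) / 3 < S.card := by
  by_cases h : (Fintype.card V : ℝ) / 3 < S.card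
  · exact Or.inr h
  push Not at h
  obtain ⟨x0, hx0⟩ := hS
  have hp := mul_pos hγ (card_pos_real x0)
  have hS1 : (0 : ℝ) < S.card := by exact_mod_cast Finset.card_pos.mpr ⟨x0, hx0⟩
  obtain ⟨x, hx, hd⟩ := hR.exists_mem (S := S)
    (s := max 0 (S.card - γ / 2 * Fintype.card V)) (le_max_left _ _)
    (max_le (by positivity) (by linarith)) (max_lt hS1 (by linarith))
  refine Or.inl ⟨x, hx, ?_⟩
  have := le_max_right 0 ((S.card : ℝ) - γ / 2 * Fintype.card V)
  linarith

/-- Graphs satisfying the degree condition have a perfect fractional tiling by triangles of the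
main class. -/
lemma exists_fractional_tiling (hR : PosaDegree R γ) (hγ : 0 < γ) :
    ∃ w : {T : Finset V // IsMainTri R γ T} → ℝ, (∀ t, 0 ≤ w t) ∧
      ∀ v, ∑ t with v ∈ t.1, w t = 1 := by
  obtain ⟨w, y, hw0, hw1, hy0, hyT, hsum, hsw, hsy⟩ := exists_packing_cover
    (fun t : {T : Finset V // IsMainTri R γ T} => t.1)
    (fun t => Finset.card_pos.mp (by rw [t.2.card_eq]; norm_num))
  refine ⟨w, hw0, ?_⟩
  by_contra! hex
  obtain ⟨v0, hv0⟩ := hex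
  have hcov0 : ∑ t with v0 ∈ t.1, w t < 1 := lt_of_le_of_ne (hw1 v0) hv0
  set K : ℝ := (Fintype.card V : ℝ) with hK
  set W : ℝ := ∑ t, w t with hW
  have hKp : 0 < K := card_pos_real v0
  have hγK := mul_pos hγ hKp
  set cov : V → ℝ := fun v => ∑ t with v ∈ t.1, w t with hcov
  have hcovnn : ∀ v, 0 ≤ cov v := fun v => Finset.sum_nonneg fun t _ => hw0 t
  have hW3 : 3 * W < K := by
    have h1 := sum_mul_card_inter
      (fun t : {T : Finset V // IsMainTri R γ T} => t.1) w Finset.univ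
    simp only [Finset.inter_univ, fun t : {T : Finset V // IsMainTri R γ T} => t.2.card_eq,
      ← Finset.sum_mul] at h1
    have h2 : ∑ v, cov v < ∑ v : V, (1 : ℝ) :=
      Finset.sum_lt_sum (fun v _ => hw1 v) ⟨v0, Finset.mem_univ _, hcov0⟩
    simp only [Finset.sum_const, Finset.card_univ, nsmul_eq_mul, mul_one] at h2
    push_cast at h1
    linarith
  set Z : Finset V := Finset.univ.filter fun v => y v = 0 with hZ
  have hZm : ∀ v, v ∈ Z ↔ y v = 0 := by simp [hZ]
  have hZne : Z.Nonempty := ⟨v0, by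
    rw [hZm]
    by_contra h
    have := hsy v0 (lt_of_le_of_ne (hy0 v0) (Ne.symm h))
    linarith⟩
  have hpair : ∀ x ∈ Z, ∀ t : {T : Finset V // IsMainTri R γ T}, ∀ b ∈ t.1 ∩ nb R x,
      ∀ c ∈ t.1 ∩ nb R x, b ≠ c → 1 ≤ y b + y c := by
    intro x hx t b hb c hc hbc
    rw [Finset.mem_inter, mem_nb] at hb hc
    have := hyT ⟨{x, b, c}, t.2.replace hR hγ hb.1 hc.1 hbc hb.2 hc.2⟩
    rw [Finset.sum_insert (by simp [hb.2.ne, hc.2.ne]), Finset.sum_pair hbc,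
      (hZm x).mp hx] at this
    linarith
  have hcovN : ∀ x, ∑ t, w t * ((t.1 ∩ nb R x).card : ℝ) =
      ((nb R x \ Z).card : ℝ) + ∑ v ∈ Z ∩ nb R x, cov v := by
    intro x
    rw [sum_mul_card_inter, ← Finset.sum_sdiff (Finset.inter_subset_right (s₁ := Z))]
    congr 1
    have h1 : nb R x \ (Z ∩ nb R x) = nb R x \ Z := by ext; simp
    rw [h1, Finset.sum_congr rfl (g := fun _ => (1 : ℝ))]
    · simp
    · intro v hv
      rw [Finset.mem_sdiff, hZm] at hv
      exact hsy v (lt_of_le_of_ne (hy0 v) (Ne.symm hv.2))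
  have hdeg : ∀ x, ((nb R x).card : ℝ) = (nb R x \ Z).card + (Z ∩ nb R x).card := by
    intro x
    rw [Finset.inter_comm]
    exact_mod_cast (Finset.card_sdiff_add_card_inter (nb R x) Z).symm
  have step1 : ∀ x ∈ Z, ((nb R x).card : ℝ) ≤ W + Z.card := by
    intro x hx
    have h1 : ∑ t, w t * ((t.1 ∩ nb R x).card : ℝ) ≤
        ∑ t, w t * (1 + ((t.1 ∩ (Z \ nb R x)).card : ℝ)) := by
      refine Finset.sum_le_sum fun t _ => ?_
      rcases (hw0 t).eq_or_lt with h | h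
      · simp [← h]
      · have h2 := card_inter_le_of_pair t.2.card_eq hy0 hZm (hsw t h) (hpair x hx t)
        refine mul_le_mul_of_nonneg_left ?_ h.le
        exact_mod_cast h2
    simp only [mul_add, mul_one, Finset.sum_add_distrib] at h1
    rw [hcovN, sum_mul_card_inter] at h1
    have h2 : ∑ v ∈ Z \ nb R x, ∑ t with v ∈ t.1, w t ≤ (Z \ nb R x).card := by
      have := Finset.sum_le_card_nsmul (Z \ nb R x) cov 1 (fun v _ => hw1 v)
      simpa using this
    have h3 : (Z.card : ℝ) = (Z \ nb R x).card + (Z ∩ nb R x).card := by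
      exact_mod_cast (Finset.card_sdiff_add_card_inter Z (nb R x)).symm
    have h4 : 0 ≤ ∑ v ∈ Z ∩ nb R x, cov v := Finset.sum_nonneg fun v _ => hcovnn v
    have h5 := hdeg x
    linarith
  obtain ⟨x, hxZ, hx⟩ : ∃ x ∈ Z, High R γ x := by
    rcases posaDegree_exists_near hR hZne hγ with ⟨x, hx, hd⟩ | h
    · have := step1 x hx
      linarith
    · exact hR.exists_high h
  have hZ3 : K / 3 < Z.card := by
    rcases posaDegree_exists_near hR hZne hγ with ⟨x, hx, hd⟩ | h
    · have := step1 x hx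
      linarith
    · exact h
  set B := Z ∩ nb R x with hB
  set A : Finset V := Finset.univ.filter fun v => 1 ≤ y v with hA
  have hAm : ∀ v, v ∈ A ↔ 1 ≤ y v := by simp [hA]
  have hx' := hx
  unfold High at hx'
  have hBne : B.Nonempty := card_inter_pos (by linarith)
  have hAW : (A.card : ℝ) ≤ W := by
    rw [← hsum]
    have h1 := Finset.card_nsmul_le_sum A y 1 (fun v hv => (hAm v).mp hv)
    have h2 : ∑ v ∈ A, y v ≤ ∑ v, y v :=
      Finset.sum_le_sum_of_subset_of_nonneg (Finset.subset_univ _) fun v _ _ => hy0 v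
    simp only [nsmul_eq_mul, mul_one] at h1
    linarith
  have hbA : ∀ b ∈ B, ((nb R b).card : ℝ) ≤ A.card + K / 3 - γ * K := by
    intro b hb
    rw [hB, Finset.mem_inter, mem_nb] at hb
    have h1 : nb R x ∩ nb R b ⊆ A := by
      intro c hc
      simp only [Finset.mem_inter, mem_nb] at hc
      have := hyT ⟨{x, b, c}, isMainTri_of_high hx hb.2 hc.1 hc.2⟩
      rw [Finset.sum_insert (by simp [hb.2.ne, hc.1.ne]), Finset.sum_pair hc.2.ne,
        (hZm x).mp hxZ, (hZm b).mp hb.1] at this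
      rw [hAm]
      linarith
    have h2 := card_inter_ge (nb R x) (nb R b)
    have h3 : ((nb R x ∩ nb R b).card : ℝ) ≤ A.card := by exact_mod_cast Finset.card_le_card h1
    linarith
  have hBA : (B.card : ℝ) ≤ A.card - 3 / 2 * (γ * K) := by
    rcases posaDegree_exists_near hR hBne hγ with ⟨b, hb, hd⟩ | h
    · have := hbA b hb
      linarith
    · obtain ⟨b, hb, hbh⟩ := hR.exists_high h
      have := hbA b hb
      unfold High at hbh
      linarith
  have h1 : ∑ t, w t * (((t.1 ∩ nb R x).card : ℝ) + (t.1 ∩ A).card) ≤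
      ∑ t, w t * (2 + ((t.1 ∩ B).card : ℝ)) := by
    refine Finset.sum_le_sum fun t _ => ?_
    rcases (hw0 t).eq_or_lt with h | h
    · simp [← h]
    · have h2 := card_inter_le_of_large t.2.card_eq hy0 hZm hAm (hsw t h) (hpair x hxZ t)
      refine mul_le_mul_of_nonneg_left ?_ h.le
      exact_mod_cast h2
  simp only [mul_add, Finset.sum_add_distrib] at h1
  rw [hcovN, sum_mul_card_inter, sum_mul_card_inter, ← Finset.sum_mul,
    Finset.sum_congr rfl (s₁ := A) (g := fun _ => (1 : ℝ))
      (fun v hv => hsy v (by linarith [(hAm v).mp hv]))] at h1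
  simp only [Finset.sum_const, nsmul_eq_mul, mul_one] at h1
  have h5 := hdeg x
  linarith

end FractionalTiling

section Many

variable {V : Type}

/-- There are at least `T` choices for each of the `N` successive entries of a list with
property `Q`. -/
def Many (T : ℝ) : ℕ → (List V → Prop) → Prop
  | 0, Q => Q []
  | N + 1, Q => ∃ S : Finset V, T ≤ S.card ∧ ∀ p ∈ S, Many T N fun l => Q (p :: l)

lemma Many.mono {T : ℝ} {N : ℕ} {Q Q' : List V → Prop} (hQ : ∀ l, Q l → Q' l)
    (h : Many T N Q) : Many T N Q' := by
  induction N generalizing Q Q' with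
  | zero => exact hQ _ h
  | succ N ih =>
    obtain ⟨S, hS, h⟩ := h
    exact ⟨S, hS, fun p hp => ih (fun l => hQ (p :: l)) (h p hp)⟩

lemma Many.exists {T : ℝ} (hT : 0 < T) {N : ℕ} {Q : List V → Prop} (h : Many T N Q) :
    ∃ l, l.length = N ∧ Q l := by
  induction N generalizing Q with
  | zero => exact ⟨[], rfl, h⟩
  | succ N ih =>
    obtain ⟨S, hS, h⟩ := h
    have : 0 < S.card := by exact_mod_cast hT.trans_le hS
    obtain ⟨p, hp⟩ := Finset.card_pos.mp this
    obtain ⟨l, hl, hq⟩ := ih (h p hp)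
    exact ⟨p :: l, by simp [hl], hq⟩

lemma Many.card [Fintype V] {T : ℝ} (hT : 0 ≤ T) {N : ℕ} {Q : List V → Prop} (h : Many T N Q) :
    T ^ N ≤ (Finset.univ.filter fun f : Fin N → V => Q (List.ofFn f)).card := by
  induction N generalizing Q with
  | zero =>
    have : Q [] := h
    simp [this]
  | succ N ih =>
    obtain ⟨S, hS, h⟩ := h
    have h1 : (Finset.univ.filter fun f : Fin (N + 1) → V => Q (List.ofFn f)).card =
        ∑ p : V, (Finset.univ.filter fun f : Fin N → V => Q (p :: List.ofFn f)).card := by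
      rw [← Finset.card_sigma]
      refine Finset.card_bij' (fun f _ => ⟨f 0, Fin.tail f⟩) (fun x _ => Fin.cons x.1 x.2)
        ?_ ?_ ?_ ?_
      · intro f hf
        rw [Finset.mem_filter, List.ofFn_succ] at hf
        exact Finset.mem_sigma.mpr
          ⟨Finset.mem_univ _, Finset.mem_filter.mpr ⟨Finset.mem_univ _, hf.2⟩⟩
      · rintro ⟨p, f⟩ hf
        simpa [List.ofFn_succ] using hf
      · intro f _
        simp
      · rintro ⟨p, f⟩ _
        simp
    rw [h1]
    push_cast
    calc T ^ (N + 1) ≤ S.card * T ^ N := by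
          rw [pow_succ, mul_comm]; exact mul_le_mul_of_nonneg_right hS (by positivity)
      _ = ∑ p ∈ S, T ^ N := by simp
      _ ≤ ∑ p ∈ S, ((Finset.univ.filter fun f : Fin N → V => Q (p :: List.ofFn f)).card : ℝ) :=
          Finset.sum_le_sum fun p hp => ih (h p hp)
      _ ≤ _ := Finset.sum_le_sum_of_subset_of_nonneg (Finset.subset_univ _)
          fun _ _ _ => by positivity

end Many

section Embedding

variable {V : Type} [Fintype V]

/-- A pair of sets such that large subsets of the first contain vertices with many neighbours in
large subsets of the second. -/
def RegPair (G : SimpleGraph V) (ε δ m : ℝ) (A B : Finset V) : Prop :=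
  ∀ X ⊆ A, ∀ Y ⊆ B, ε * m ≤ X.card → ε * m ≤ Y.card →
    ∃ x ∈ X, δ * Y.card ≤ (nb G x ∩ Y).card

/-- Partial embeddings of a square path into a list of target sets, such that the next two
updated target sets have size at least `β`. -/
def Good (G : SimpleGraph V) (β : ℝ) : List V → List (Finset V) → Prop
  | [], [X₁, X₂] => β ≤ X₁.card ∧ β ≤ X₂.card
  | p :: P, X₁ :: X₂ :: X₃ :: L => β ≤ X₁.card ∧ p ∈ X₁ ∧
      Good G β P ((nb G p ∩ X₂) :: (nb G p ∩ X₃) :: L.map fun X => X.erase p)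
  | _, _ => False

lemma RegPair.card_bad {G : SimpleGraph V} {ε δ m : ℝ} {A B X Y : Finset V}
    (h : RegPair G ε δ m A B) (hX : X ⊆ A) (hY : Y ⊆ B) (hYc : ε * m ≤ Y.card) :
    ((X.filter fun p => ((nb G p ∩ Y).card : ℝ) < δ * Y.card).card : ℝ) ≤ ε * m := by
  by_contra! hlt
  obtain ⟨x, hx, h2⟩ := h _ ((Finset.filter_subset _ _).trans hX) Y hY hlt.le hYc
  rw [Finset.mem_filter] at hx
  linarith [hx.2]

lemma RegPair.card_good {G : SimpleGraph V} {ε δ m : ℝ} {A B C X Y Z : Finset V}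
    (h : RegPair G ε δ m A B) (h' : RegPair G ε δ m A C) (hX : X ⊆ A) (hY : Y ⊆ B)
    (hYc : ε * m ≤ Y.card) (hZ : Z ⊆ C) (hZc : ε * m ≤ Z.card) :
    (X.card : ℝ) - 2 * ε * m ≤ (X.filter fun p => δ * Y.card ≤ ((nb G p ∩ Y).card : ℝ) ∧
      δ * Z.card ≤ ((nb G p ∩ Z).card : ℝ)).card := by
  have h1 := h.card_bad hX hY hYc
  have h2 := h'.card_bad hX hZ hZc
  have h3 : X ⊆ (X.filter fun p => δ * Y.card ≤ ((nb G p ∩ Y).card : ℝ) ∧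
      δ * Z.card ≤ ((nb G p ∩ Z).card : ℝ)) ∪
      ((X.filter fun p => ((nb G p ∩ Y).card : ℝ) < δ * Y.card) ∪
        (X.filter fun p => ((nb G p ∩ Z).card : ℝ) < δ * Z.card)) := by
    intro p hp
    simp only [Finset.mem_union, Finset.mem_filter, hp, true_and]
    by_cases ha : δ * Y.card ≤ ((nb G p ∩ Y).card : ℝ)
    · by_cases hb : δ * Z.card ≤ ((nb G p ∩ Z).card : ℝ)
      · exact Or.inl ⟨ha, hb⟩
      · exact Or.inr (Or.inr (not_le.mp hb))
    · exact Or.inr (Or.inl (not_le.mp ha))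
  have h4 := ((Finset.card_le_card h3).trans (Finset.card_union_le _ _)).trans
    (Nat.add_le_add_left (Finset.card_union_le _ _) _)
  have h5 := (Nat.cast_le (α := ℝ)).mpr h4
  push_cast at h5
  linarith

variable {ι : Type} {R : SimpleGraph ι} {A : ι → Finset V} {G : SimpleGraph V} {ε δ θ m T : ℝ}

/-- Square walks in the reduced graph embed greedily. -/
lemma many_good (hreg : ∀ i j, R.Adj i j → RegPair G ε δ m (A i) (A j))
    (hδ0 : 0 < δ) (hδ1 : δ ≤ 1) (hθ : 0 ≤ θ) (hm : 0 ≤ m)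
    (hT : T ≤ (δ ^ 2 * θ - 2 * ε) * m) (hε : ε ≤ δ ^ 2 * θ)
    (N : ℕ) (x₁ x₂ : ι × Finset V) (L : List (ι × Finset V)) (hL : L.length = N)
    (hch : SqChain R.Adj ((x₁ :: x₂ :: L).map Prod.fst))
    (hsub : ∀ q ∈ x₁ :: x₂ :: L, q.2 ⊆ A q.1)
    (h1 : δ ^ 2 * θ * m ≤ x₁.2.card) (h2 : δ * θ * m ≤ x₂.2.card)
    (h3 : ∀ q ∈ L, θ * m + (x₁ :: x₂ :: L).countP (fun x => ¬ Disjoint x.2 q.2) ≤ q.2.card) :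
    Many T N fun P => Good G (δ ^ 2 * θ * m) P ((x₁ :: x₂ :: L).map Prod.snd) := by
  have hθm : 0 ≤ θ * m := mul_nonneg hθ hm
  have hd1 : δ * (θ * m) ≤ θ * m := by nlinarith
  have hd2 : δ * (δ * (θ * m)) ≤ δ * (θ * m) := mul_le_mul_of_nonneg_left hd1 hδ0.le
  have hεm : ε * m ≤ δ ^ 2 * θ * m := mul_le_mul_of_nonneg_right hε hm
  induction N generalizing x₁ x₂ L with
  | zero =>
    rw [List.length_eq_zero_iff] at hL
    subst hL
    exact ⟨h1, by linarith⟩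
  | succ N ih =>
    obtain ⟨x₃, L, rfl⟩ : ∃ x₃ L', L = x₃ :: L' := by
      cases L with
      | nil => simp at hL
      | cons a l => exact ⟨a, l, rfl⟩
    have h3' : θ * m ≤ x₃.2.card := by
      have h4 := h3 x₃ (by simp)
      have h5 : (0 : ℝ) ≤ ((x₁ :: x₂ :: x₃ :: L).countP (fun x => ¬ Disjoint x.2 x₃.2) : ℕ) :=
        by positivity
      linarith
    simp only [List.map_cons, SqChain, List.take_succ_cons, List.take_zero, List.mem_cons,
      List.not_mem_nil, or_false, forall_eq_or_imp, forall_eq] at hch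
    have hg := RegPair.card_good (hreg _ _ hch.1.1) (hreg _ _ hch.1.2) (X := x₁.2)
      (hsub x₁ (by simp)) (hsub x₂ (by simp)) (by linarith) (hsub x₃ (by simp)) (by linarith)
    refine ⟨x₁.2.filter fun p => δ * x₂.2.card ≤ ((nb G p ∩ x₂.2).card : ℝ) ∧
      δ * x₃.2.card ≤ ((nb G p ∩ x₃.2).card : ℝ), ?_, fun p hp => ?_⟩
    rotate_left
    · rw [Finset.mem_filter] at hp
      have := ih (x₂.1, nb G p ∩ x₂.2) (x₃.1, nb G p ∩ x₃.2)
        (L.map fun q => (q.1, q.2.erase p)) (by simpa using hL) ?_ ?_ ?_ ?_ ?_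
      · refine this.mono fun P hP => ?_
        refine ⟨h1, hp.1, ?_⟩
        simpa [Function.comp_def] using hP
      · simpa [SqChain, Function.comp_def] using hch.2
      · simp only [List.mem_cons, List.mem_map]
        rintro q (rfl | rfl | ⟨q, hq, rfl⟩)
        · exact Finset.inter_subset_right.trans (hsub x₂ (by simp))
        · exact Finset.inter_subset_right.trans (hsub x₃ (by simp))
        · exact (Finset.erase_subset _ _).trans (hsub q (by simp [hq]))
      · have := mul_le_mul_of_nonneg_left h2 hδ0.le
        have := hp.2.1
        dsimp only
        linarith
      · have := mul_le_mul_of_nonneg_left h3' hδ0.le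
        have := hp.2.2
        dsimp only
        linarith
      · intro q' hq'
        rw [List.mem_map] at hq'
        obtain ⟨q, hq, rfl⟩ := hq'
        have h4 := h3 q (by simp [hq])
        dsimp only
        have h5 : List.countP (fun x => decide (¬ Disjoint x.2 (q.2.erase p)))
            ((x₂.1, nb G p ∩ x₂.2) :: (x₃.1, nb G p ∩ x₃.2) ::
              L.map fun q => (q.1, q.2.erase p)) ≤
            List.countP (fun x => decide (¬ Disjoint x.2 q.2)) (x₂ :: x₃ :: L) := by
          simp only [List.countP_cons, List.countP_map]
          have aux : ∀ {s t s' t' : Finset V}, s' ⊆ s → t' ⊆ t →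
              (if decide (¬ Disjoint s' t') = true then 1 else 0) ≤
              (if decide (¬ Disjoint s t) = true then 1 else 0 : ℕ) := by
            intro s t s' t' hs ht
            by_cases h : Disjoint s t
            · simp [h, Finset.disjoint_of_subset_left hs (Finset.disjoint_of_subset_right ht h)]
            · simp [h]; split_ifs <;> simp
          refine Nat.add_le_add (Nat.add_le_add ?_ ?_) ?_
          · refine List.countP_mono_left fun x _ hx => ?_
            simp only [Function.comp_apply, decide_eq_true_eq] at hx ⊢
            exact fun h => hx (Finset.disjoint_of_subset_left (Finset.erase_subset _ _)
              (Finset.disjoint_of_subset_right (Finset.erase_subset _ _) h))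
          · exact aux Finset.inter_subset_right (Finset.erase_subset _ _)
          · exact aux Finset.inter_subset_right (Finset.erase_subset _ _)
        have h6 : ((q.2.card : ℝ)) ≤ (q.2.erase p).card +
            (if decide (¬ Disjoint x₁.2 q.2) = true then 1 else 0 : ℕ) := by
          by_cases hpq : p ∈ q.2
          · have hnd : ¬ Disjoint x₁.2 q.2 := fun h =>
              Finset.disjoint_left.mp h hp.1 hpq
            have := Finset.card_erase_add_one hpq
            simp only [hnd]
            simp
            exact_mod_cast this.ge
          · rw [Finset.erase_eq_of_notMem hpq]
            exact le_add_of_nonneg_right (Nat.cast_nonneg _)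
        rw [List.countP_cons] at h4
        push_cast at h4 h6
        have h5' : (List.countP (fun x => decide (¬ Disjoint x.2 (q.2.erase p)))
            ((x₂.1, nb G p ∩ x₂.2) :: (x₃.1, nb G p ∩ x₃.2) ::
              L.map fun q => (q.1, q.2.erase p)) : ℝ) ≤
            List.countP (fun x => decide (¬ Disjoint x.2 q.2)) (x₂ :: x₃ :: L) := by
          exact_mod_cast h5
        linarith
    · refine le_trans ?_ hg
      linarith

lemma Good.final {β : ℝ} {P : List V} {L : List (Finset V)} (h : Good G β P L) :
    ∃ (L₀ : List (Finset V)) (Z₁ Z₂ Y₁ Y₂ : Finset V), L = L₀ ++ [Z₁, Z₂] ∧ Y₁ ⊆ Z₁ ∧ Y₂ ⊆ Z₂ ∧ β ≤ Y₁.card ∧ β ≤ Y₂.card ∧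
      ∀ y₁ ∈ Y₁, ∀ y₂ ∈ Y₂, G.Adj y₁ y₂ → SqChain G.Adj (P ++ [y₁, y₂]) ∧
        (P ++ [y₁, y₂]).Nodup ∧ List.Forall₂ (· ∈ ·) (P ++ [y₁, y₂]) L := by
  induction P generalizing L with
  | nil =>
    match L, h with
    | [X₁, X₂], h =>
      refine ⟨[], X₁, X₂, X₁, X₂, rfl, subset_rfl, subset_rfl, h.1, h.2, ?_⟩
      intro y₁ h1 y₂ h2 h3
      simp [SqChain, h1, h2, h3, h3.ne]
  | cons p P ih =>
    match L, h with
    | X₁ :: X₂ :: X₃ :: L, h =>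
      obtain ⟨_, hp, hg⟩ := h
      obtain ⟨L₀, Z₁, Z₂, Y₁, Y₂, hL, hY1, hY2, hb1, hb2, hall⟩ := ih hg
      have hmem : ∀ y₁ ∈ Y₁, ∀ y₂ ∈ Y₂, G.Adj y₁ y₂ → SqChain G.Adj (p :: P ++ [y₁, y₂]) ∧
        (p :: P ++ [y₁, y₂]).Nodup ∧
          List.Forall₂ (· ∈ ·) (p :: P ++ [y₁, y₂]) (X₁ :: X₂ :: X₃ :: L) := by
        intro y₁ h1 y₂ h2 h3
        obtain ⟨c1, c2, c3⟩ := hall y₁ h1 y₂ h2 h3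
        rw [List.cons_append]
        generalize P ++ [y₁, y₂] = P' at c1 c2 c3 ⊢
        match P', c3 with
        | a :: b :: P', c3 =>
          simp only [List.forall₂_cons, List.forall₂_map_right_iff, Finset.mem_inter, mem_nb,
            Finset.mem_erase] at c3
          obtain ⟨ha, hb, hr⟩ := c3
          refine ⟨⟨by simp [ha.1, hb.1], c1⟩, List.nodup_cons.mpr ⟨?_, c2⟩, ?_⟩
          · simp only [List.mem_cons, not_or]
            refine ⟨ha.1.ne, hb.1.ne, fun hpP => ?_⟩
            obtain ⟨i, hi, rfl⟩ := List.mem_iff_getElem.mp hpP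
            have hlen := hr.length_eq
            have := (List.forall₂_iff_get.mp hr).2 i hi (hlen ▸ hi)
            exact this.1 rfl
          · refine .cons hp (.cons ha.2 (.cons hb.2 (hr.imp fun _ _ h => h.2)))
      rcases L₀ with _ | ⟨a, _ | ⟨b, L₀⟩⟩
      · simp only [List.nil_append, List.cons.injEq, List.map_eq_nil_iff] at hL
        obtain ⟨rfl, rfl, rfl⟩ := hL
        exact ⟨[X₁], X₂, X₃, Y₁, Y₂, rfl, hY1.trans Finset.inter_subset_right,
          hY2.trans Finset.inter_subset_right, hb1, hb2, hmem⟩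
      · simp only [List.cons_append, List.nil_append, List.cons.injEq] at hL
        obtain ⟨rfl, rfl, hL⟩ := hL
        obtain ⟨X, rfl, rfl⟩ : ∃ X, L = [X] ∧ Z₂ = X.erase p := by
          match L, hL with
          | [X], hL => exact ⟨X, rfl, by simpa using hL.symm⟩
        exact ⟨[X₁, X₂], X₃, X, Y₁, Y₂, rfl, hY1.trans Finset.inter_subset_right,
          hY2.trans (Finset.erase_subset _ _), hb1, hb2, hmem⟩
      · simp only [List.cons_append, List.cons.injEq] at hL
        obtain ⟨rfl, rfl, hL⟩ := hL
        rw [List.map_eq_append_iff] at hL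
        obtain ⟨l₁, l₂, rfl, rfl, hL⟩ := hL
        match l₂, hL with
        | [X, X'], hL =>
          simp only [List.map_cons, List.map_nil, List.cons.injEq, and_true] at hL
          obtain ⟨rfl, rfl⟩ := hL
          exact ⟨X₁ :: X₂ :: X₃ :: l₁, X, X', Y₁, Y₂, rfl,
            hY1.trans (Finset.erase_subset _ _), hY2.trans (Finset.erase_subset _ _),
            hb1, hb2, hmem⟩

/-- Square walks in the reduced graph give square paths with prescribed target sets. -/
lemma exists_sqPath (hreg : ∀ i j, R.Adj i j → RegPair G ε δ m (A i) (A j))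
    (hδ0 : 0 < δ) (hδ1 : δ ≤ 1) (hθ : 0 < θ) (hm : 0 < m) (hε0 : 0 ≤ ε)
    (hε : 2 * ε < δ ^ 2 * θ) (x₁ x₂ : ι × Finset V) (L : List (ι × Finset V))
    (hch : SqChain R.Adj ((x₁ :: x₂ :: L).map Prod.fst))
    (hsub : ∀ q ∈ x₁ :: x₂ :: L, q.2 ⊆ A q.1)
    (h1 : δ ^ 2 * θ * m ≤ x₁.2.card) (h2 : δ * θ * m ≤ x₂.2.card)
    (h3 : ∀ q ∈ L, θ * m + (x₁ :: x₂ :: L).countP (fun x => ¬ Disjoint x.2 q.2) ≤ q.2.card) :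
    ∃ P : List V, SqChain G.Adj P ∧ P.Nodup ∧
      List.Forall₂ (fun p q => p ∈ q.2) P (x₁ :: x₂ :: L) := by
  have hT : 0 < (δ ^ 2 * θ - 2 * ε) * m := mul_pos (by linarith) hm
  obtain ⟨P, hP, hg⟩ := (many_good hreg hδ0 hδ1 hθ.le hm.le le_rfl (by linarith) L.length x₁ x₂ L
    rfl hch hsub h1 h2 h3).exists hT
  obtain ⟨L₀, Z₁, Z₂, Y₁, Y₂, hL, hY1, hY2, hb1, hb2, hall⟩ := hg.final
  have hβ : ε * m ≤ δ ^ 2 * θ * m := mul_le_mul_of_nonneg_right (by linarith) hm.le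
  rw [List.map_eq_append_iff] at hL
  obtain ⟨l₁, l₂, hl, rfl, hL⟩ := hL
  match l₂, hL with
  | [z₁, z₂], hL =>
    simp only [List.map_cons, List.map_nil, List.cons.injEq, and_true] at hL
    obtain ⟨rfl, rfl⟩ := hL
    rw [hl] at hch hsub
    rw [List.map_append] at hch
    have hadj := hch.of_append_right
    simp [SqChain] at hadj
    obtain ⟨y₁, hy₁, hd⟩ := hreg _ _ hadj Y₁ (hY1.trans (hsub z₁ (by simp))) Y₂
      (hY2.trans (hsub z₂ (by simp))) (by linarith) (by linarith)
    have : (0 : ℝ) < (nb G y₁ ∩ Y₂).card := by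
      refine lt_of_lt_of_le (mul_pos hδ0 (lt_of_lt_of_le ?_ hb2)) hd
      positivity
    obtain ⟨y₂, hy₂⟩ := Finset.card_pos.mp (by exact_mod_cast this : 0 < (nb G y₁ ∩ Y₂).card)
    rw [Finset.mem_inter, mem_nb] at hy₂
    obtain ⟨c1, c2, c3⟩ := hall y₁ hy₁ y₂ hy₂.2 hy₂.1
    refine ⟨_, c1, c2, ?_⟩
    rwa [List.forall₂_map_right_iff] at c3

end Embedding

section RegularityParts

variable {V : Type} [Fintype V] {G : SimpleGraph V}

lemma card_interedges_eq_sum (s t : Finset V) :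
    (G.interedges s t).card = ∑ v ∈ s, (nb G v ∩ t).card := by
  rw [SimpleGraph.interedges_def, Finset.card_filter, Finset.sum_product]
  refine Finset.sum_congr rfl fun v _ => ?_
  rw [← Finset.card_filter]
  congr 1
  ext w
  simp [and_comm]

lemma edgeDensity_mul (s t : Finset V) :
    (G.edgeDensity s t : ℝ) * (s.card * t.card) = ∑ v ∈ s, ((nb G v ∩ t).card : ℝ) := by
  rw [SimpleGraph.edgeDensity_def]
  push_cast
  rw [card_interedges_eq_sum]
  push_cast
  refine div_mul_cancel_of_imp fun h => ?_
  rcases mul_eq_zero.mp h with h | h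
  · rw [Nat.cast_eq_zero, Finset.card_eq_zero] at h
    simp [h]
  · rw [Nat.cast_eq_zero, Finset.card_eq_zero] at h
    simp [h]

lemma regPair_of_isUniform {ε ε₀ d m : ℝ} {p q A B : Finset V} (hA : A ⊆ p) (hB : B ⊆ q)
    (hu : G.IsUniform ε₀ p q) (hd : 2 * d ≤ G.edgeDensity p q) (hε₀ : ε₀ ≤ d)
    (hε : 0 < ε * m) (hp : p.card * ε₀ ≤ ε * m) (hq : q.card * ε₀ ≤ ε * m) :
    RegPair G ε d m A B := by
  intro X hX Y hY hXc hYc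
  have h1 := hu (hX.trans hA) (hY.trans hB) (hp.trans hXc) (hq.trans hYc)
  have h2 := (abs_lt.mp h1).1
  have h3 : d ≤ G.edgeDensity X Y := by linarith
  by_contra! hcon
  have h4 : ∑ v ∈ X, ((nb G v ∩ Y).card : ℝ) < ∑ v ∈ X, d * Y.card := by
    refine Finset.sum_lt_sum_of_nonempty ?_ hcon
    rw [← Finset.card_pos]
    have : (0 : ℝ) < X.card := hε.trans_le hXc
    exact_mod_cast this
  rw [← edgeDensity_mul, Finset.sum_const, nsmul_eq_mul] at h4
  have h5 : d * (X.card * Y.card) ≤ (G.edgeDensity X Y : ℝ) * (X.card * Y.card) :=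
    mul_le_mul_of_nonneg_right h3 (by positivity)
  linarith

/-- A part of a partition forming uniform pairs with all but few of the other parts. -/
def GoodPart (G : SimpleGraph V) (P : Finpartition (Finset.univ : Finset V)) (e : ℝ)
    (p : Finset V) : Prop :=
  p ∈ P.parts ∧
    ((P.parts.filter fun q => p ≠ q ∧ ¬ G.IsUniform (e ^ 2) p q).card : ℝ) ≤ e * P.parts.card

/-- Adjacency of parts in the reduced graph. -/
def RegAdj (G : SimpleGraph V) (P : Finpartition (Finset.univ : Finset V)) (e d : ℝ)
    (p q : Finset V) : Prop :=
  GoodPart G P e p ∧ GoodPart G P e q ∧ p ≠ q ∧ G.IsUniform (e ^ 2) p q ∧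
    d ≤ G.edgeDensity p q

/-- The reduced graph on the good parts of a partition. -/
def regGraph (G : SimpleGraph V) (P : Finpartition (Finset.univ : Finset V)) (e d : ℝ) :
    SimpleGraph {p : Finset V // GoodPart G P e p} where
  Adj p q := RegAdj G P e d p.1 q.1
  symm := ⟨fun _ _ h => ⟨h.2.1, h.1, h.2.2.1.symm, h.2.2.2.1.symm, by
    rw [SimpleGraph.edgeDensity_comm]; exact h.2.2.2.2⟩⟩
  loopless := ⟨fun _ h => h.2.2.1 rfl⟩

lemma card_nb_regGraph {P : Finpartition (Finset.univ : Finset V)} {e d : ℝ}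
    (p : {p : Finset V // GoodPart G P e p}) :
    (nb (regGraph G P e d) p).card = (P.parts.filter fun q => RegAdj G P e d p.1 q).card := by
  rw [← Finset.card_map ⟨Subtype.val, Subtype.val_injective⟩]
  congr 1
  ext q
  simp only [Finset.mem_map, mem_nb, Function.Embedding.coeFn_mk, Finset.mem_filter]
  constructor
  · rintro ⟨q, hq, rfl⟩
    exact ⟨q.2.1, hq⟩
  · rintro ⟨_, hq⟩
    exact ⟨⟨q, hq.2.1⟩, hq, rfl⟩

lemma card_not_goodPart {P : Finpartition (Finset.univ : Finset V)} {e : ℝ} (he : 0 < e)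
    (hP : P.IsUniform G (e ^ 2)) :
    ((P.parts.filter fun p => ¬ GoodPart G P e p).card : ℝ) ≤ e * P.parts.card := by
  set k : ℝ := (P.parts.card : ℝ) with hk
  have h1 : ((P.nonUniforms G (e ^ 2)).card : ℝ) =
      ∑ p ∈ P.parts, ((P.parts.filter fun q => p ≠ q ∧ ¬ G.IsUniform (e ^ 2) p q).card : ℝ) := by
    rw [← Nat.cast_sum]
    congr 1
    rw [← Finset.card_sigma]
    refine Finset.card_bij' (fun x _ => ⟨x.1, x.2⟩) (fun x _ => (x.1, x.2)) ?_ ?_ ?_ ?_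
    · rintro ⟨p, q⟩ h
      rw [Finpartition.mk_mem_nonUniforms] at h
      simp [h]
    · rintro ⟨p, q⟩ h
      simp only [Finset.mem_sigma, Finset.mem_filter] at h
      rw [Finpartition.mk_mem_nonUniforms]
      exact ⟨h.1, h.2.1, h.2.2⟩
    · simp
    · simp
  have h2 : ((P.nonUniforms G (e ^ 2)).card : ℝ) ≤ k * k * e ^ 2 := by
    refine hP.trans ?_
    refine mul_le_mul_of_nonneg_right ?_ (by positivity)
    have : P.parts.card * (P.parts.card - 1) ≤ P.parts.card * P.parts.card :=
      Nat.mul_le_mul_left _ (Nat.sub_le _ _)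
    rw [hk]
    exact_mod_cast this
  have h3 : ((P.parts.filter fun p => ¬ GoodPart G P e p).card : ℝ) * (e * k) ≤
      k * k * e ^ 2 := by
    rw [← nsmul_eq_mul]
    refine le_trans ?_ h2
    rw [h1]
    refine (Finset.card_nsmul_le_sum _ _ _ fun p hp => ?_).trans
      (Finset.sum_le_sum_of_subset_of_nonneg (Finset.filter_subset _ _)
        fun _ _ _ => by positivity)
    rw [Finset.mem_filter] at hp
    unfold GoodPart at hp
    have := hp.2
    push Not at this
    exact (this hp.1).le
  rcases (Nat.cast_nonneg (α := ℝ) P.parts.card).eq_or_lt with h | h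
  · have h4 : P.parts.card = 0 := by exact_mod_cast h.symm
    rw [Finset.card_eq_zero] at h4
    simp [h4, hk]
  · have h5 : 0 < e * k := mul_pos he h
    have : ((P.parts.filter fun p => ¬ GoodPart G P e p).card : ℝ) * (e * k) ≤
      (e * k) * (e * k) := h3.trans (le_of_eq (by ring))
    exact le_of_mul_le_mul_right this h5

lemma sum_card_inter_parts (P : Finpartition (Finset.univ : Finset V)) (S : Finset V) :
    ∑ q ∈ P.parts, (S ∩ q).card = S.card := by
  rw [← Finset.card_biUnion]
  · congr 1
    ext v
    simp only [Finset.mem_biUnion, Finset.mem_inter]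
    constructor
    · rintro ⟨q, _, h, _⟩
      exact h
    · intro h
      obtain ⟨q, hq, hv⟩ := P.exists_mem (Finset.mem_univ v)
      exact ⟨q, hq, h, hv⟩
  · intro p hp q hq hpq
    exact Finset.disjoint_of_subset_left Finset.inter_subset_right
      (Finset.disjoint_of_subset_right Finset.inter_subset_right (P.disjoint hp hq hpq))

/-- The number of edges from a good part to parts which are not adjacent to it is small. -/
lemma sum_bad_edges_le {P : Finpartition (Finset.univ : Finset V)} {e d m : ℝ} (he : 0 < e)
    (hd : 0 ≤ d) (hP : P.IsUniform G (e ^ 2)) (hm : ∀ q ∈ P.parts, (q.card : ℝ) ≤ m)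
    {p : Finset V} (hp : GoodPart G P e p) :
    ∑ v ∈ p, ∑ q ∈ P.parts with ¬ RegAdj G P e d p q, ((nb G v ∩ q).card : ℝ) ≤
      p.card * m * (1 + 2 * e * P.parts.card + d * P.parts.card) := by
  rw [Finset.sum_comm]
  simp only [← edgeDensity_mul]
  have hm0 : 0 ≤ m := (Nat.cast_nonneg _).trans (hm p hp.1)
  have h1 : ∀ q ∈ P.parts.filter fun q => ¬ RegAdj G P e d p q,
      (G.edgeDensity p q : ℝ) * (p.card * q.card) ≤ p.card * m * ((if p = q then 1 else 0) +
        (if ¬ GoodPart G P e q then 1 else 0) +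
        (if p ≠ q ∧ ¬ G.IsUniform (e ^ 2) p q then 1 else 0) + d) := by
    intro q hq
    rw [Finset.mem_filter] at hq
    have h2 : (G.edgeDensity p q : ℝ) ≤ (if p = q then 1 else 0) +
        (if ¬ GoodPart G P e q then 1 else 0) +
        (if p ≠ q ∧ ¬ G.IsUniform (e ^ 2) p q then 1 else 0) + d := by
      have h3 : (G.edgeDensity p q : ℝ) ≤ 1 := by exact_mod_cast G.edgeDensity_le_one p q
      have a1 : (0 : ℝ) ≤ if p = q then 1 else 0 := by split_ifs <;> norm_num
      have a2 : (0 : ℝ) ≤ if ¬ GoodPart G P e q then 1 else 0 := by split_ifs <;> norm_num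
      have a3 : (0 : ℝ) ≤ if p ≠ q ∧ ¬ G.IsUniform (e ^ 2) p q then 1 else 0 := by
        split_ifs <;> norm_num
      by_cases c1 : p = q
      · rw [if_pos c1]; linarith
      by_cases c2 : GoodPart G P e q
      · by_cases c3 : G.IsUniform (e ^ 2) p q
        · have : ¬ d ≤ G.edgeDensity p q := fun h => hq.2 ⟨hp, c2, c1, c3, h⟩
          linarith
        · rw [if_pos (show p ≠ q ∧ ¬ G.IsUniform (e ^ 2) p q from ⟨c1, c3⟩)]; linarith
      · rw [if_pos c2]; linarith
    have h4 : (0 : ℝ) ≤ G.edgeDensity p q := by exact_mod_cast G.edgeDensity_nonneg p q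
    calc (G.edgeDensity p q : ℝ) * (p.card * q.card)
        ≤ (G.edgeDensity p q : ℝ) * (p.card * m) :=
          mul_le_mul_of_nonneg_left (mul_le_mul_of_nonneg_left (hm q hq.1) (by positivity)) h4
      _ ≤ _ := by
          rw [mul_comm]
          exact mul_le_mul_of_nonneg_left h2 (by positivity)
  refine (Finset.sum_le_sum h1).trans ?_
  refine (Finset.sum_le_sum_of_subset_of_nonneg (Finset.filter_subset _ P.parts)
    fun q _ _ => ?_).trans ?_
  · have a1 : (0 : ℝ) ≤ if p = q then 1 else 0 := by split_ifs <;> norm_num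
    have a2 : (0 : ℝ) ≤ if ¬ GoodPart G P e q then 1 else 0 := by split_ifs <;> norm_num
    have a3 : (0 : ℝ) ≤ if p ≠ q ∧ ¬ G.IsUniform (e ^ 2) p q then 1 else 0 := by
      split_ifs <;> norm_num
    positivity
  rw [← Finset.mul_sum]
  refine mul_le_mul_of_nonneg_left ?_ (by positivity)
  simp only [Finset.sum_add_distrib, Finset.sum_ite_eq, hp.1, if_true, Finset.sum_const,
    nsmul_eq_mul, ← Finset.sum_filter, mul_one]
  have h5 := card_not_goodPart he hP
  have h6 := hp.2
  linarith

lemma card_low_degree {P : Finpartition (Finset.univ : Finset V)} {e d m t : ℝ} (he : 0 < e)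
    (hd : 0 ≤ d) (hP : P.IsUniform G (e ^ 2)) (hm : ∀ q ∈ P.parts, (q.card : ℝ) ≤ m)
    (ht : 0 < t) {p : Finset V} (hp : GoodPart G P e p) :
    (p.card : ℝ) * (1 - m * (1 + 2 * e * P.parts.card + d * P.parts.card) / t) ≤
      (p.filter fun v => ((nb G v).card : ℝ) ≤
        (P.parts.filter fun q => RegAdj G P e d p q).card * m + t).card := by
  set f : V → ℝ := fun v => ∑ q ∈ P.parts with ¬ RegAdj G P e d p q, ((nb G v ∩ q).card : ℝ)
    with hf
  have h1 : ∀ v, ((nb G v).card : ℝ) ≤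
      (P.parts.filter fun q => RegAdj G P e d p q).card * m + f v := by
    intro v
    rw [← sum_card_inter_parts P (nb G v), Nat.cast_sum,
      ← Finset.sum_filter_add_sum_filter_not P.parts (fun q => RegAdj G P e d p q)]
    refine add_le_add ?_ le_rfl
    rw [← nsmul_eq_mul]
    refine Finset.sum_le_card_nsmul _ _ _ fun q hq => ?_
    refine le_trans ?_ (hm q (Finset.mem_filter.mp hq).1)
    exact_mod_cast Finset.card_le_card Finset.inter_subset_right
  have h2 := sum_bad_edges_le he hd hP hm hp
  have h3 : ((p.filter fun v => t < f v).card : ℝ) * t ≤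
      p.card * m * (1 + 2 * e * P.parts.card + d * P.parts.card) := by
    refine le_trans ?_ h2
    rw [← nsmul_eq_mul]
    refine (Finset.card_nsmul_le_sum _ f t fun v hv => (Finset.mem_filter.mp hv).2.le).trans
      (Finset.sum_le_sum_of_subset_of_nonneg (Finset.filter_subset _ _)
        fun _ _ _ => Finset.sum_nonneg fun _ _ => by positivity)
  have h4 : ((p.filter fun v => t < f v).card : ℝ) ≤
      p.card * (m * (1 + 2 * e * P.parts.card + d * P.parts.card) / t) := by
    rw [← mul_div_assoc, le_div_iff₀ ht]
    linarith
  have h5 : p.card ≤ (p.filter fun v => t < f v).card + (p.filter fun v => ((nb G v).card : ℝ) ≤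
        (P.parts.filter fun q => RegAdj G P e d p q).card * m + t).card := by
    refine le_trans (Finset.card_le_card ?_) (Finset.card_union_le _ _)
    intro v hv
    rw [Finset.mem_union, Finset.mem_filter, Finset.mem_filter]
    by_cases h : t < f v
    · exact Or.inl ⟨hv, h⟩
    · exact Or.inr ⟨hv, by linarith [h1 v]⟩
  have h6 : (p.card : ℝ) ≤ (p.filter fun v => t < f v).card +
      (p.filter fun v => ((nb G v).card : ℝ) ≤
        (P.parts.filter fun q => RegAdj G P e d p q).card * m + t).card := by exact_mod_cast h5
  linarith

set_option maxHeartbeats 1000000 in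
lemma posaDegree_regGraph {γ e : ℝ} (hγ : 0 < γ) (hγ1 : γ ≤ 1) (he : 0 < e)
    (heγ : e ≤ γ ^ 2 / 200) (hG : PosaDegree G γ) {P : Finpartition (Finset.univ : Finset V)}
    (hP : P.IsUniform G (e ^ 2)) {m : ℕ} (hm : 0 < m) (hmP : ∀ q ∈ P.parts, m ≤ q.card)
    (hmP' : ∀ q ∈ P.parts, q.card ≤ m + 1) (hk : 200 ≤ γ ^ 2 * P.parts.card)
    (hn : (P.parts.card : ℝ) ≤ γ * Fintype.card V / 100) :
    PosaDegree (regGraph G P e (γ ^ 2 / 100)) (γ / 2) := by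
  set n : ℝ := (Fintype.card V : ℝ) with hndef
  set k : ℝ := (P.parts.card : ℝ) with hkdef
  set R := regGraph G P e (γ ^ 2 / 100) with hR
  set K : ℝ := (Fintype.card {p : Finset V // GoodPart G P e p} : ℝ) with hK
  have hk0 : 0 < k := by
    by_contra! h
    nlinarith [sq_nonneg γ]
  have hn0 : 0 < n := by
    by_contra! h
    nlinarith
  have hKk : K ≤ k := by
    rw [hK, hkdef, Nat.cast_le, Fintype.card_subtype]
    refine Finset.card_le_card fun p hp => ?_
    exact (Finset.mem_filter.mp hp).2.1
  have hsum := P.sum_card_parts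
  rw [Finset.card_univ] at hsum
  have hkm : k * m ≤ n := by
    have := Finset.card_nsmul_le_sum P.parts (fun q => q.card) m hmP
    rw [hsum, nsmul_eq_mul] at this
    rw [hkdef, hndef]
    exact_mod_cast this
  have hkm' : k * (m + 1) ≤ n + k := by linarith
  intro s hs0 hs1
  rw [← hK] at hs1 ⊢
  set B := Finset.univ.filter (fun p => ((nb R p).card : ℝ) < K / 3 + s + γ / 2 * K) with hB
  by_contra! hlt
  set t : ℝ := γ * n / 8 with ht
  have ht0 : 0 < t := by positivity
  set low : {p : Finset V // GoodPart G P e p} → Finset V := fun p => p.1.filter fun v =>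
    ((nb G v).card : ℝ) ≤ (P.parts.filter fun q => RegAdj G P e (γ ^ 2 / 100) p.1 q).card *
      ((m : ℝ) + 1) + t with hlow
  have hfrac : ((m : ℝ) + 1) * (1 + 2 * e * k + γ ^ 2 / 100 * k) / t ≤ 2 / 5 * γ := by
    rw [div_le_iff₀ ht0]
    have h1 : 1 + 2 * e * k + γ ^ 2 / 100 * k ≤ γ ^ 2 / 40 * k := by nlinarith
    have h2 : ((m : ℝ) + 1) * (1 + 2 * e * k + γ ^ 2 / 100 * k) ≤ (m + 1) * (γ ^ 2 / 40 * k) :=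
      mul_le_mul_of_nonneg_left h1 (by positivity)
    have h3 : k ≤ n := by nlinarith
    have h4 : ((m : ℝ) + 1) * (γ ^ 2 / 40 * k) = γ ^ 2 / 40 * (k * (m + 1)) := by ring
    have h5 : γ ^ 2 / 40 * (k * (m + 1)) ≤ γ ^ 2 / 40 * (2 * n) :=
      mul_le_mul_of_nonneg_left (by linarith) (by positivity)
    rw [ht]
    nlinarith
  have hlowc : ∀ p, (m : ℝ) * (1 - 2 / 5 * γ) ≤ (low p).card := by
    intro p
    have h1 := card_low_degree (d := γ ^ 2 / 100) (m := (m : ℝ) + 1) he (by positivity) hP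
      (fun q hq => by exact_mod_cast hmP' q hq) ht0 p.2
    have h2 : (m : ℝ) ≤ p.1.card := by exact_mod_cast hmP _ p.2.1
    refine le_trans ?_ h1
    refine mul_le_mul h2 (by linarith) (by linarith) (by positivity)
  have hdis : ∀ p ∈ B, ∀ q ∈ B, p ≠ q → Disjoint (low p) (low q) := by
    intro p _ q _ hpq
    refine Finset.disjoint_of_subset_left (Finset.filter_subset _ _)
      (Finset.disjoint_of_subset_right (Finset.filter_subset _ _) ?_)
    exact P.disjoint p.2.1 q.2.1 fun h => hpq (Subtype.ext h)
  have hcount : (B.card : ℝ) * (m * (1 - 2 / 5 * γ)) ≤ (B.biUnion low).card := by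
    rw [Finset.card_biUnion hdis, Nat.cast_sum, ← nsmul_eq_mul]
    exact Finset.card_nsmul_le_sum _ _ _ fun p _ => hlowc p
  have hdeg : ∀ v ∈ B.biUnion low,
      ((nb G v).card : ℝ) < n / 3 + s * (m + 1) + 3 / 4 * γ * n := by
    intro v hv
    rw [Finset.mem_biUnion] at hv
    obtain ⟨p, hp, hv⟩ := hv
    have h1 := (Finset.mem_filter.mp hv).2
    have h2 := (Finset.mem_filter.mp hp).2
    rw [hR, card_nb_regGraph] at h2
    have h3 := mul_le_mul_of_nonneg_right h2.le (by positivity : (0 : ℝ) ≤ m + 1)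
    have h4 : K * (m + 1) ≤ k * (m + 1) := mul_le_mul_of_nonneg_right hKk (by positivity)
    have h5 : γ * (K * (m + 1)) ≤ γ * (n + k) := mul_le_mul_of_nonneg_left (by linarith) hγ.le
    have h6 : γ * k ≤ γ * n / 100 := by nlinarith
    have h7 : 0 < γ * n := by positivity
    rw [ht] at h1
    nlinarith
  have hBpos : (0 : ℝ) < B.card := lt_of_le_of_lt hs0 hlt
  have hm0 : (0 : ℝ) < m := by exact_mod_cast hm
  have hγn : 0 < γ * n := by positivity
  have hle : ∀ s', 0 ≤ s' → s' ≤ n / 3 → s * (m + 1) + 3 / 4 * γ * n ≤ s' + γ * n →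
      ((B.biUnion low).card : ℝ) ≤ s' := by
    intro s' h0 h1 h2
    refine le_trans ?_ (hG s' h0 h1)
    rw [Nat.cast_le]
    refine Finset.card_le_card fun v hv => ?_
    have := hdeg v hv
    simp only [Finset.mem_filter, Finset.mem_univ, true_and]
    linarith
  have h1g : 0 < 1 - 2 / 5 * γ := by linarith
  have hsk : s ≤ k / 3 := by linarith
  have hsm : s * m ≤ n / 3 := by
    have := mul_le_mul_of_nonneg_right hsk hm0.le
    linarith
  by_cases hc : γ * n / 4 ≤ s * (m + 1)
  · have h1 := hle (s * (m + 1) - γ * n / 4) (by linarith) (by linarith) (by linarith)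
    have h2 : s * (m * (1 - 2 / 5 * γ)) ≤ B.card * (m * (1 - 2 / 5 * γ)) :=
      mul_le_mul_of_nonneg_right hlt.le (by positivity)
    have h4 : γ * (s * m) ≤ γ * (n / 3) := mul_le_mul_of_nonneg_left hsm hγ.le
    linarith
  · have h1 := hle 0 le_rfl (by positivity) (by linarith)
    have h2 : 0 < (B.card : ℝ) * (m * (1 - 2 / 5 * γ)) := by positivity
    linarith

end RegularityParts

/-- Equal disjoint clusters `A` with a reduced graph `R` of regular pairs. -/
structure IsReducedGraph {V ι : Type} [Fintype V] [Fintype ι] (G : SimpleGraph V) (R : SimpleGraph ι)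
    (A : ι → Finset V) (γ ε δ : ℝ) (m : ℕ) : Prop where
  card_index_pos : 0 < Fintype.card ι
  size_pos : 0 < m
  card_eq : ∀ i, (A i).card = m
  disjoint : ∀ i j, i ≠ j → Disjoint (A i) (A j)
  cover : (1 - ε) * Fintype.card V ≤ Fintype.card ι * m
  posaDegree : PosaDegree R γ
  regPair : ∀ i j, R.Adj i j → RegPair G ε δ m (A i) (A j)

theorem exists_isReducedGraph {γ ε : ℝ} (hγ : 0 < γ) (hγ1 : γ ≤ 1) (hε : 0 < ε) :
    ∃ M n₀ : ℕ, ∀ (V : Type) [Fintype V] (G : SimpleGraph V), PosaDegree G γ →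
      n₀ ≤ Fintype.card V → ∃ (ι : Type) (_ : Fintype ι) (R : SimpleGraph ι) (A : ι → Finset V)
        (m : ℕ), Fintype.card ι ≤ M ∧ IsReducedGraph G R A (γ / 2) ε (γ ^ 2 / 200) m := by
  set e : ℝ := min (γ ^ 2 / 200) (ε / 2) with he_def
  have he : 0 < e := by positivity
  have heγ : e ≤ γ ^ 2 / 200 := min_le_left _ _
  have heε : e ≤ ε / 2 := min_le_right _ _
  have hγ2 : γ ^ 2 ≤ 1 := pow_le_one₀ hγ.le hγ1
  have he1 : e ≤ 1 / 200 := by linarith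
  have hee : e ^ 2 ≤ e / 2 := by nlinarith
  set l : ℕ := ⌈200 / γ ^ 2⌉₊ with hl
  set M : ℕ := SzemerediRegularity.bound (e ^ 2) l with hM
  refine ⟨M, max (max l M) ⌈max (100 * M / γ) (2 * M / ε)⌉₊, ?_⟩
  intro V _ G hG hn
  have hn1 : l ≤ Fintype.card V := (le_max_left _ _).trans ((le_max_left _ _).trans hn)
  have hn2 : M ≤ Fintype.card V := (le_max_right _ _).trans ((le_max_left _ _).trans hn)
  have hn3 : max (100 * M / γ) (2 * M / ε) ≤ (Fintype.card V : ℝ) :=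
    Nat.ceil_le.mp ((le_max_right _ _).trans hn)
  have hn4 := (le_max_left _ _).trans hn3
  have hn5 := (le_max_right _ _).trans hn3
  rw [div_le_iff₀ hγ] at hn4
  rw [div_le_iff₀ hε] at hn5
  obtain ⟨P, hPe, hPl, hPM, hPu⟩ := szemeredi_regularity G (ε := e ^ 2) (by positivity) hn1
  have hkM : (P.parts.card : ℝ) ≤ M := by exact_mod_cast hPM
  have hlk : 200 / γ ^ 2 ≤ (P.parts.card : ℝ) := (Nat.ceil_le.mp hPl)
  have hk0 : (0 : ℝ) < P.parts.card := lt_of_lt_of_le (by positivity) hlk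
  have hk0' : 0 < P.parts.card := by exact_mod_cast hk0
  rw [div_le_iff₀ (by positivity)] at hlk
  set m : ℕ := Fintype.card V / P.parts.card with hm
  have hm0 : 0 < m := Nat.div_pos (hPM.trans hn2) hk0'
  have hmP : ∀ q ∈ P.parts, m ≤ q.card := fun q hq => by
    simpa using hPe.average_le_card_part hq
  have hmP' : ∀ q ∈ P.parts, q.card ≤ m + 1 := fun q hq => by
    simpa using hPe.card_part_le_average_add_one hq
  have hposa := posaDegree_regGraph hγ hγ1 he heγ hG hPu hm0 hmP hmP' (by linarith)
    (by linarith)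
  have hsub : ∀ p : {p : Finset V // GoodPart G P e p}, ∃ B ⊆ p.1, B.card = m := fun p =>
    Finset.exists_subset_card_eq (hmP _ p.2.1)
  choose A hA hAm using hsub
  have hK : (1 - e) * P.parts.card ≤ Fintype.card {p : Finset V // GoodPart G P e p} := by
    have h1 := card_not_goodPart he hPu
    have h2 := Finset.card_filter_add_card_filter_not (s := P.parts) (fun p => GoodPart G P e p)
    have h3 : (P.parts.filter fun p => GoodPart G P e p).card =
        Fintype.card {p : Finset V // GoodPart G P e p} := by
      rw [Fintype.card_subtype]
      congr 1
      ext p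
      simp only [Finset.mem_filter, Finset.mem_univ, true_and, and_iff_right_iff_imp]
      exact fun h => h.1
    rw [h3] at h2
    have h4 : (Fintype.card {p : Finset V // GoodPart G P e p} : ℝ) +
      (P.parts.filter fun p => ¬ GoodPart G P e p).card = P.parts.card := by exact_mod_cast h2
    linarith
  have hm0' : (0 : ℝ) < m := by exact_mod_cast hm0
  have hm1 : (1 : ℝ) ≤ m := by exact_mod_cast hm0
  have hkm : (Fintype.card V : ℝ) - P.parts.card ≤ P.parts.card * m := by
    have h1 := Nat.div_add_mod (Fintype.card V) P.parts.card
    have h2 := Nat.mod_lt (Fintype.card V) hk0'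
    have h3 : Fintype.card V ≤ P.parts.card * m + P.parts.card := by rw [hm]; omega
    have : (Fintype.card V : ℝ) ≤ P.parts.card * m + P.parts.card := by exact_mod_cast h3
    linarith
  have hKpos : (0 : ℝ) < Fintype.card {p : Finset V // GoodPart G P e p} :=
    lt_of_lt_of_le (mul_pos (by linarith) hk0) hK
  have hpart : ∀ p ∈ P.parts, (p.card : ℝ) * e ^ 2 ≤ ε * m := by
    intro p hp
    have h1 : (p.card : ℝ) ≤ m + 1 := by exact_mod_cast hmP' p hp
    calc (p.card : ℝ) * e ^ 2 ≤ (2 * m) * (e / 2) := by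
          refine mul_le_mul (by linarith) hee (by positivity) (by positivity)
      _ = m * e := by ring
      _ ≤ m * ε := mul_le_mul_of_nonneg_left (by linarith) hm0'.le
      _ = ε * m := mul_comm _ _
  refine ⟨{p : Finset V // GoodPart G P e p}, inferInstance, regGraph G P e (γ ^ 2 / 100), A, m,
    ?_, ?_, hm0, hAm, ?_, ?_, ?_, ?_⟩
  · rw [Fintype.card_subtype]
    exact (Finset.card_le_card fun p hp => (Finset.mem_filter.mp hp).2.1).trans hPM
  · exact_mod_cast hKpos
  · intro p q hpq
    exact Finset.disjoint_of_subset_left (hA p) (Finset.disjoint_of_subset_right (hA q)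
      (P.disjoint p.2.1 q.2.1 fun h => hpq (Subtype.ext h)))
  · have h1 := mul_le_mul_of_nonneg_right hK hm0'.le
    have h2 := mul_le_mul_of_nonneg_left hkm (by linarith : 0 ≤ 1 - e)
    have h3 : (P.parts.card : ℝ) ≤ ε / 2 * Fintype.card V := by linarith
    have h4 : (0 : ℝ) ≤ Fintype.card V := by positivity
    have h5 : (1 - e) * (P.parts.card : ℝ) ≤ P.parts.card := by nlinarith
    have h6 : e * (Fintype.card V : ℝ) ≤ ε / 2 * Fintype.card V :=
      mul_le_mul_of_nonneg_right heε h4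
    linarith
  · exact hposa
  · intro p q hpq
    exact regPair_of_isUniform (ε₀ := e ^ 2) (hA p) (hA q) hpq.2.2.2.1
      (by linarith [hpq.2.2.2.2]) (by nlinarith) (by positivity) (hpart _ p.2.1) (hpart _ q.2.1)

/-- The clusters which meet `S` in at least `t` vertices. -/
def richIndex {V ι : Type} [Fintype ι] (A : ι → Finset V) (S : Finset V) (t : ℝ) : Finset ι :=
  Finset.univ.filter fun i => t ≤ (S ∩ A i).card

@[simp] lemma mem_richIndex {V ι : Type} [Fintype ι] {A : ι → Finset V} {S : Finset V} {t : ℝ}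
    {i : ι} : i ∈ richIndex A S t ↔ t ≤ (S ∩ A i).card := by
  simp [richIndex]

section Reduced

variable {V ι : Type} [Fintype V] [Fintype ι] {G : SimpleGraph V} {R : SimpleGraph ι}
  {A : ι → Finset V} {γ ε δ : ℝ} {m : ℕ}

lemma IsReducedGraph.card_biUnion (h : IsReducedGraph G R A γ ε δ m) :
    (Finset.univ.biUnion A).card = Fintype.card ι * m := by
  rw [Finset.card_biUnion fun i _ j _ hij => h.disjoint i j hij]
  simp [h.card_eq]

lemma IsReducedGraph.card_mul_le (h : IsReducedGraph G R A γ ε δ m) :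
    (Fintype.card ι : ℝ) * m ≤ Fintype.card V := by
  have := Finset.card_le_univ (Finset.univ.biUnion A)
  rw [h.card_biUnion] at this
  exact_mod_cast this

lemma IsReducedGraph.le_size (h : IsReducedGraph G R A γ ε δ m) (hε : ε ≤ 1 / 2) {M : ℕ} {C : ℝ}
    (hC : 0 ≤ C) (hM : Fintype.card ι ≤ M) (hn : 2 * M * C ≤ Fintype.card V) : C ≤ m := by
  have h1 := h.cover
  have hK : (0 : ℝ) < Fintype.card ι := by exact_mod_cast h.card_index_pos
  have hKM : (Fintype.card ι : ℝ) ≤ M := by exact_mod_cast hM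
  have h2 : (Fintype.card ι : ℝ) * C ≤ M * C := mul_le_mul_of_nonneg_right hKM hC
  have h3 : (1 / 2 : ℝ) * Fintype.card V ≤ (1 - ε) * Fintype.card V :=
    mul_le_mul_of_nonneg_right (by linarith) (by positivity)
  exact le_of_mul_le_mul_left (by linarith) hK

lemma IsReducedGraph.card_richIndex (h : IsReducedGraph G R A γ ε δ m) {S : Finset V}
    {c θ : ℝ} (hθ : 0 ≤ θ) (hS : c * Fintype.card V ≤ S.card) :
    (c - θ - ε) * Fintype.card ι ≤ (richIndex A S (θ * m)).card := by
  have hm : (0 : ℝ) < m := by exact_mod_cast h.size_pos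
  have h1 : S.card ≤ ∑ i, (S ∩ A i).card + (Fintype.card V - Fintype.card ι * m) := by
    rw [← h.card_biUnion, ← Finset.card_compl, ← Finset.card_biUnion]
    · refine (Finset.card_le_card fun v hv => ?_).trans (Finset.card_union_le _ _)
      simp only [Finset.mem_union, Finset.mem_biUnion, Finset.mem_univ, true_and,
        Finset.mem_inter, Finset.mem_compl]
      by_cases hx : ∃ i, v ∈ A i
      · obtain ⟨i, hi⟩ := hx
        exact Or.inl ⟨i, hv, hi⟩
      · exact Or.inr hx
    · intro i _ j _ hij
      exact Finset.disjoint_of_subset_left Finset.inter_subset_right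
        (Finset.disjoint_of_subset_right Finset.inter_subset_right (h.disjoint i j hij))
  have h2 : ((Fintype.card V - Fintype.card ι * m : ℕ) : ℝ) ≤ ε * Fintype.card V := by
    rw [Nat.cast_sub (by exact_mod_cast h.card_mul_le)]
    push_cast
    linarith [h.cover]
  have h3 : ∑ i, ((S ∩ A i).card : ℝ) ≤
      (richIndex A S (θ * m)).card * m + Fintype.card ι * (θ * m) := by
    rw [← Finset.sum_filter_add_sum_filter_not Finset.univ (fun i => θ * m ≤ (S ∩ A i).card)]
    refine add_le_add ?_ ?_
    · rw [← nsmul_eq_mul]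
      refine Finset.sum_le_card_nsmul _ _ _ fun i _ => ?_
      rw [← h.card_eq i]
      exact_mod_cast Finset.card_le_card Finset.inter_subset_right
    · rw [← Finset.card_univ, ← nsmul_eq_mul]
      refine (Finset.sum_le_card_nsmul _ _ (θ * m) fun i hi => ?_).trans ?_
      · exact (not_le.mp (Finset.mem_filter.mp hi).2).le
      · exact nsmul_le_nsmul_left (by positivity) (Finset.card_filter_le _ _)
  have h4 : (S.card : ℝ) ≤ ∑ i, ((S ∩ A i).card : ℝ) +
      ((Fintype.card V - Fintype.card ι * m : ℕ) : ℝ) := by exact_mod_cast h1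
  by_cases hc : c - θ - ε ≤ 0
  · exact (mul_nonpos_of_nonpos_of_nonneg hc (by positivity)).trans (by positivity)
  push Not at hc
  have h5 := mul_le_mul_of_nonneg_left h.card_mul_le hc.le
  have h6 := mul_le_mul_of_nonneg_left h.card_mul_le hθ
  refine le_of_mul_le_mul_right ?_ hm
  linarith

/-- Sets which are not too small meet both ends of some main dart. -/
lemma IsReducedGraph.exists_mainDart (h : IsReducedGraph G R A γ ε δ m) (hγ : 0 < γ)
    {S : Finset V} {c θ : ℝ} (hθ : 0 ≤ θ) (hS : c * Fintype.card V ≤ S.card)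
    (hc : 1 / 3 < c - θ - ε) :
    ∃ p q, MainDart R γ (p, q) ∧ θ * m ≤ (S ∩ A p).card ∧ θ * m ≤ (S ∩ A q).card := by
  have hK : (0 : ℝ) < Fintype.card ι := by exact_mod_cast h.card_index_pos
  have h1 := h.card_richIndex hθ hS
  have h2 := mul_lt_mul_of_pos_right hc hK
  obtain ⟨p, hp, hh⟩ := h.posaDegree.exists_high (S := richIndex A S (θ * m)) (by linarith)
  have h3 := hh
  unfold High at h3
  have h4 := mul_pos hγ hK
  obtain ⟨q, hq⟩ := card_inter_pos (S := nb R p) (T := richIndex A S (θ * m)) (by linarith)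
  rw [Finset.mem_inter, mem_nb] at hq
  exact ⟨p, q, mainDart_of_high hh hq.1, mem_richIndex.mp hp, mem_richIndex.mp hq.2⟩

end Reduced

section Tour

variable {ι : Type} {R : SimpleGraph ι} {γ : ℝ}

lemma exists_wind {p q s : ι} (h1 : R.Adj p q) (h2 : R.Adj q s) (h3 : R.Adj p s) {E l : List ι}
    (h : SqChain R.Adj (p :: q :: (l ++ E))) (k : ℕ) :
    ∃ l', SqChain R.Adj (p :: q :: (l' ++ E)) ∧ l'.length = 3 * k + l.length ∧
      ∀ i, l'.count i = (if i ∈ ({p, q, s} : Finset ι) then k else 0) + l.count i := by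
  induction k with
  | zero => exact ⟨l, h, by simp, by simp⟩
  | succ k ih =>
    obtain ⟨l', hl, hlen, hc⟩ := ih
    refine ⟨s :: p :: q :: l', ?_, ?_, fun i => ?_⟩
    · refine ⟨by simp [h1, h3], ⟨by simp [h2, h1.symm], ⟨by simp [h2.symm, h3.symm], hl⟩⟩⟩
    · simp only [List.length_cons]; omega
    · simp only [List.count_cons, hc, beq_iff_eq]
      have a1 := h1.ne
      have a2 := h2.ne
      have a3 := h3.ne
      by_cases c1 : p = i
      · subst c1
        simp [a1.symm, a3.symm]
        omega
      by_cases c2 : q = i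
      · subst c2
        simp [a1, a2.symm]
        omega
      by_cases c3 : s = i
      · subst c3
        simp [a2, a3]
        omega
      · simp [c1, c2, c3, Ne.symm c1, Ne.symm c2, Ne.symm c3]

lemma exists_tour [Fintype ι] (hR : PosaDegree R γ) (hγ : 0 < γ) {r t : ι}
    (hrt : MainDart R γ (r, t)) (Ts : List (Finset ι × ℕ)) (hTs : ∀ T ∈ Ts, IsMainTri R γ T.1)
    {p q : ι} (hpq : MainDart R γ (p, q)) :
    ∃ l, SqChain R.Adj (p :: q :: (l ++ [r, t])) ∧
      (Ts.map fun T => 3 * T.2).sum ≤ l.length ∧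
      ∀ i, l.count i ≤ (Ts.map fun T => if i ∈ T.1 then T.2 else 0).sum +
        (Ts.length + 1) * (4 * Fintype.card ι ^ 2 + 3) := by
  induction Ts generalizing p q with
  | nil =>
    obtain ⟨l, hl, hch⟩ := MainDart.exists_walk hR hγ hpq hrt
    refine ⟨l, hch, by simp, fun i => ?_⟩
    have := List.count_le_length (a := i) (l := l)
    simp
    omega
  | cons T Ts ih =>
    obtain ⟨T, k⟩ := T
    obtain ⟨a, b, c, rfl, hbc, hac, hab⟩ := hTs (T, k) (by simp)
    obtain ⟨l₁, hl₁, hch₁⟩ := MainDart.exists_walk hR hγ hpq hab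
    obtain ⟨l₂, hch₂, hlen₂, hc₂⟩ := ih (fun T hT => hTs T (by simp [hT])) hab
    obtain ⟨l₃, hch₃, hlen₃, hc₃⟩ := exists_wind hab.adj hbc hac hch₂ k
    refine ⟨l₁ ++ a :: b :: l₃, ?_, ?_, fun i => ?_⟩
    · have := SqChain.append (l₁ := p :: q :: l₁) hch₁ hch₃
      simpa using this
    · simp only [List.map_cons, List.sum_cons, List.length_append, List.length_cons]
      omega
    · have h1 := List.count_le_length (a := i) (l := l₁)
      have h2 := List.count_le_length (a := i) (l := [a, b])
      have h3 : (l₁ ++ a :: b :: l₃).count i = l₁.count i + ([a, b].count i + l₃.count i) := by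
        rw [List.count_append, ← List.count_append (l₁ := [a, b])]; rfl
      rw [h3, hc₃]
      have h4 := hc₂ i
      simp only [List.map_cons, List.sum_cons, List.length_cons] at h2 ⊢
      rw [add_mul _ 1]
      simp only [List.length_nil] at h2
      omega

end Tour

section AlmostCover

lemma exists_long_tour {ι : Type} [Fintype ι] {R : SimpleGraph ι} {γ x : ℝ} (hx : 0 ≤ x)
    (hR : PosaDegree R γ) (hγ : 0 < γ) {p q r t : ι} (hpq : MainDart R γ (p, q))
    (hrt : MainDart R γ (r, t)) :
    ∃ l, SqChain R.Adj (p :: q :: (l ++ [r, t])) ∧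
      Fintype.card ι * x - 3 * 2 ^ Fintype.card ι ≤ l.length ∧
      ∀ i, (l.count i : ℝ) ≤ x + (2 ^ Fintype.card ι + 1) * (4 * Fintype.card ι ^ 2 + 3) := by
  obtain ⟨w, hw0, hw1⟩ := exists_fractional_tiling hR hγ
  have hcard : (Finset.univ : Finset {T // IsMainTri R γ T}).toList.length ≤ 2 ^ Fintype.card ι := by
    rw [Finset.length_toList, Finset.card_univ, ← Fintype.card_finset]
    exact Fintype.card_subtype_le _
  obtain ⟨l, hl, hlen, hc⟩ := exists_tour hR hγ hrt
    ((Finset.univ : Finset {T // IsMainTri R γ T}).toList.map fun T => (T.1, ⌊w T * x⌋₊)) (by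
      intro T hT
      rw [List.mem_map] at hT
      obtain ⟨T, _, rfl⟩ := hT
      exact T.2) hpq
  rw [List.map_map, Finset.sum_map_toList] at hlen
  refine ⟨l, hl, ?_, fun i => ?_⟩
  · simp only [Function.comp_apply] at hlen
    have h1 : (∑ T : {T // IsMainTri R γ T}, 3 * (⌊w T * x⌋₊ : ℝ)) ≤ l.length := by
      have := (Nat.cast_le (α := ℝ)).mpr hlen
      push_cast at this
      exact this
    have h2 : ∑ T : {T // IsMainTri R γ T}, (3 * (w T * x) - 3) ≤ ∑ T : {T // IsMainTri R γ T}, 3 * (⌊w T * x⌋₊ : ℝ) :=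
      Finset.sum_le_sum fun T _ => by linarith [Nat.lt_floor_add_one (w T * x)]
    have h3 : ∑ T : {T // IsMainTri R γ T}, 3 * w T = Fintype.card ι := by
      have := sum_mul_card_inter (fun T : {T // IsMainTri R γ T} => T.1) w Finset.univ
      simp only [hw1, Finset.sum_const, Finset.card_univ, nsmul_eq_mul, mul_one,
        Finset.inter_univ] at this
      rw [← this]
      exact Finset.sum_congr rfl fun T _ => by rw [T.2.card_eq]; push_cast; ring
    rw [Finset.sum_sub_distrib] at h2
    have h4 : ∑ T : {T // IsMainTri R γ T}, 3 * (w T * x) = Fintype.card ι * x := by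
      rw [← h3, Finset.sum_mul]
      exact Finset.sum_congr rfl fun T _ => by ring
    rw [h4, Finset.sum_const, nsmul_eq_mul, ← Finset.length_toList] at h2
    have h5 : ((Finset.univ : Finset {T // IsMainTri R γ T}).toList.length : ℝ) ≤ 2 ^ Fintype.card ι := by
      exact_mod_cast hcard
    linarith
  · have h0 := hc i
    rw [List.map_map, Finset.sum_map_toList, List.length_map] at h0
    simp only [Function.comp_apply] at h0
    have h1 := (Nat.cast_le (α := ℝ)).mpr h0
    push_cast at h1
    refine h1.trans (add_le_add ?_ ?_)
    · calc (∑ T : {T // IsMainTri R γ T}, if i ∈ T.1 then (⌊w T * x⌋₊ : ℝ) else 0)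
          ≤ ∑ T : {T // IsMainTri R γ T}, if i ∈ T.1 then w T * x else 0 := by
            refine Finset.sum_le_sum fun T _ => ?_
            split_ifs
            · exact Nat.floor_le (mul_nonneg (hw0 T) hx)
            · exact le_rfl
        _ = x := by rw [← Finset.sum_filter, ← Finset.sum_mul, hw1, one_mul]
    · have h5 : ((Finset.univ : Finset {T // IsMainTri R γ T}).toList.length : ℝ) ≤ 2 ^ Fintype.card ι := by
        exact_mod_cast hcard
      exact mul_le_mul_of_nonneg_right (by linarith) (by positivity)

end AlmostCover

section Walk

variable {V ι : Type} [Fintype V] [Fintype ι] {G : SimpleGraph V} {R : SimpleGraph ι}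
  {A : ι → Finset V} {γ ε δ θ : ℝ} {m : ℕ}

/-- A square walk in the reduced graph is followed by a square path, avoiding a given set of
vertices in its interior and with prescribed end sets. -/
lemma IsReducedGraph.exists_sqPath_of_walk (h : IsReducedGraph G R A γ ε δ m) (hδ0 : 0 < δ)
    (hδ1 : δ ≤ 1) (hθ : 0 < θ) (hε0 : 0 ≤ ε) (hε : 2 * ε < δ ^ 2 * θ) {p q r t : ι} {l : List ι}
    (hch : SqChain R.Adj (p :: q :: (l ++ [r, t]))) {F X₁ X₂ Y₁ Y₂ : Finset V} (hX₁ : X₁ ⊆ A p)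
    (hX₂ : X₂ ⊆ A q) (hY₁ : Y₁ ⊆ A r) (hY₂ : Y₂ ⊆ A t) (h₁ : δ ^ 2 * θ * m ≤ X₁.card)
    (h₂ : δ * θ * m ≤ X₂.card) (hl : ∀ i ∈ l, θ * m + l.count i + 4 ≤ (A i \ F).card)
    (h₃ : θ * m + l.countP (fun i => ¬ Disjoint (A i \ F) Y₁) + 4 ≤ Y₁.card)
    (h₄ : θ * m + l.countP (fun i => ¬ Disjoint (A i \ F) Y₂) + 4 ≤ Y₂.card) :
    ∃ x₁ x₂ l' y₁ y₂, SqChain G.Adj (x₁ :: x₂ :: (l' ++ [y₁, y₂])) ∧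
      (x₁ :: x₂ :: (l' ++ [y₁, y₂])).Nodup ∧ x₁ ∈ X₁ ∧ x₂ ∈ X₂ ∧ y₁ ∈ Y₁ ∧ y₂ ∈ Y₂ ∧
      l'.length = l.length ∧ ∀ v ∈ l', v ∉ F := by
  have hm : (0 : ℝ) < m := by exact_mod_cast h.size_pos
  set L : List (ι × Finset V) := l.map (fun i => (i, A i \ F)) with hL
  have hcount : ∀ Z : Finset V, ((p, X₁) :: (q, X₂) :: (L ++ [(r, Y₁), (t, Y₂)])).countP
      (fun x => ¬ Disjoint x.2 Z) ≤ l.countP (fun i => ¬ Disjoint (A i \ F) Z) + 4 := by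
    intro Z
    have h1 := List.countP_le_length (p := fun x : ι × Finset V => ¬ Disjoint x.2 Z)
      (l := [(p, X₁), (q, X₂)])
    have h2 := List.countP_le_length (p := fun x : ι × Finset V => ¬ Disjoint x.2 Z)
      (l := [(r, Y₁), (t, Y₂)])
    have h3 : (p, X₁) :: (q, X₂) :: (L ++ [(r, Y₁), (t, Y₂)]) =
      [(p, X₁), (q, X₂)] ++ (L ++ [(r, Y₁), (t, Y₂)]) := rfl
    rw [h3, List.countP_append, List.countP_append, hL, List.countP_map]
    simp only [List.length_cons, List.length_nil] at h1 h2
    simp only [Function.comp_def]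
    omega
  have hcount' : ∀ Z : Finset V, ((((p, X₁) :: (q, X₂) :: (L ++ [(r, Y₁), (t, Y₂)])).countP
      (fun x => ¬ Disjoint x.2 Z) : ℕ) : ℝ) ≤
        l.countP (fun i => ¬ Disjoint (A i \ F) Z) + 4 := by
    intro Z
    exact_mod_cast hcount Z
  obtain ⟨P, hP, hnd, hmem⟩ := exists_sqPath h.regPair hδ0 hδ1 hθ hm hε0 hε (p, X₁) (q, X₂)
    (L ++ [(r, Y₁), (t, Y₂)]) (by simpa [hL, Function.comp_def] using hch) (by
      simp only [hL, List.mem_cons, List.mem_append, List.mem_map, List.not_mem_nil, or_false]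
      rintro _ (rfl | rfl | ⟨i, _, rfl⟩ | rfl | rfl)
      exacts [hX₁, hX₂, Finset.sdiff_subset, hY₁, hY₂]) h₁ h₂ (by
      simp only [hL, List.mem_cons, List.mem_append, List.mem_map, List.not_mem_nil, or_false]
      rintro _ (⟨i, hi, rfl⟩ | rfl | rfl)
      · have h1 := hcount' (A i \ F)
        have h2 : l.countP (fun j => ¬ Disjoint (A j \ F) (A i \ F)) ≤ l.count i := by
          rw [List.count]
          refine List.countP_mono_left fun j _ hj => ?_
          by_contra hne
          simp only [beq_iff_eq] at hne
          simp only [decide_eq_true_eq] at hj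
          exact hj (Finset.disjoint_of_subset_left Finset.sdiff_subset
            (Finset.disjoint_of_subset_right Finset.sdiff_subset (h.disjoint j i hne)))
        have h3 : (l.countP (fun j => ¬ Disjoint (A j \ F) (A i \ F)) : ℝ) ≤ l.count i := by
          exact_mod_cast h2
        have h4 := hl i hi
        dsimp only
        linarith
      · have h1 := hcount' Y₁
        dsimp only
        linarith
      · have h1 := hcount' Y₂
        dsimp only
        linarith)
  rw [List.forall₂_cons_right_iff] at hmem
  obtain ⟨x₁, P, hx₁, hmem, rfl⟩ := hmem
  rw [List.forall₂_cons_right_iff] at hmem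
  obtain ⟨x₂, P, hx₂, hmem, rfl⟩ := hmem
  obtain ⟨l', P', hl', hP', rfl⟩ : ∃ l' P', List.Forall₂ (fun p q => p ∈ q.2) l' L ∧
      List.Forall₂ (fun p q => p ∈ q.2) P' [(r, Y₁), (t, Y₂)] ∧ P = l' ++ P' :=
    ⟨P.take L.length, P.drop L.length, List.forall₂_take_append _ _ _ hmem,
      List.forall₂_drop_append _ _ _ hmem, (List.take_append_drop _ _).symm⟩
  rw [List.forall₂_cons_right_iff] at hP'
  obtain ⟨y₁, P, hy₁, hP', rfl⟩ := hP'
  rw [List.forall₂_cons_right_iff] at hP'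
  obtain ⟨y₂, P, hy₂, hP', rfl⟩ := hP'
  rw [List.forall₂_nil_right_iff] at hP'
  subst hP'
  refine ⟨x₁, x₂, l', y₁, y₂, hP, hnd, hx₁, hx₂, hy₁, hy₂, ?_, fun v hv => ?_⟩
  · rw [hl'.length_eq, hL, List.length_map]
  · rw [hL, List.forall₂_map_right_iff] at hl'
    obtain ⟨i, hi, rfl⟩ := List.mem_iff_getElem.mp hv
    have h1 := (List.forall₂_iff_get.mp hl').2 i hi (hl'.length_eq ▸ hi)
    exact (Finset.mem_sdiff.mp h1).2

end Walk

/-- Almost spanning square paths with prescribed sets for the end vertices. -/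
theorem exists_almost_spanning {γ μ : ℝ} (hγ : 0 < γ) (hγ1 : γ ≤ 1) (hμ : 0 < μ) :
    ∃ n₀ : ℕ, ∀ (V : Type) [Fintype V] (G : SimpleGraph V), PosaDegree G γ →
      n₀ ≤ Fintype.card V → ∀ S S' : Finset V,
      (1 / 3 + γ) * Fintype.card V ≤ S.card → (1 / 3 + γ) * Fintype.card V ≤ S'.card →
      ∃ x₁ x₂ l y₁ y₂, SqChain G.Adj (x₁ :: x₂ :: (l ++ [y₁, y₂])) ∧
        (x₁ :: x₂ :: (l ++ [y₁, y₂])).Nodup ∧ x₁ ∈ S ∧ x₂ ∈ S ∧ y₁ ∈ S' ∧ y₂ ∈ S' ∧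
        (1 - μ) * Fintype.card V ≤ (x₁ :: x₂ :: (l ++ [y₁, y₂])).length := by
  set θ : ℝ := min γ μ / 20 with hθ_def
  have hθ : 0 < θ := by positivity
  have hθγ : θ ≤ γ / 20 := by have := min_le_left γ μ; linarith
  have hθμ : θ ≤ μ / 20 := by have := min_le_right γ μ; linarith
  set δ : ℝ := γ ^ 2 / 200 with hδ_def
  have hγ2 : γ ^ 2 ≤ 1 := pow_le_one₀ hγ.le hγ1
  have hδ : 0 < δ := by positivity
  have hδ1 : δ ≤ 1 := by linarith
  have hδ2 : δ ^ 2 ≤ 1 := pow_le_one₀ hδ.le hδ1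
  have hδθ : δ ^ 2 * θ ≤ θ := mul_le_of_le_one_left hθ.le hδ2
  have hδθ' : δ * θ ≤ θ := mul_le_of_le_one_left hθ.le hδ1
  set ε : ℝ := δ ^ 2 * θ / 4 with hε_def
  have hε : 0 < ε := by positivity
  obtain ⟨M, n₁, hM⟩ := exists_isReducedGraph hγ hγ1 hε
  set C : ℝ := ((2 ^ M + 1) * (4 * M ^ 2 + 3) + 4) / θ with hC
  refine ⟨max n₁ ⌈2 * M * C⌉₊, fun V _ G hG hn S S' hS hS' => ?_⟩
  obtain ⟨ι, _, R, A, m, hK, h⟩ := hM V G hG ((le_max_left _ _).trans hn)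
  replace h : IsReducedGraph G R A (γ / 2) ε δ m := h
  have hCm := h.le_size (by linarith) (by positivity) hK
    (Nat.ceil_le.mp ((le_max_right _ _).trans hn))
  have hKM : (Fintype.card ι : ℝ) ≤ M := by exact_mod_cast hK
  have hm : (0 : ℝ) < m := by exact_mod_cast h.size_pos
  have hC0 : ((2 : ℝ) ^ Fintype.card ι + 1) * (4 * Fintype.card ι ^ 2 + 3) + 4 ≤ θ * m := by
    rw [hC, div_le_iff₀ hθ] at hCm
    refine le_trans ?_ (hCm.trans (mul_comm _ _).le)
    have : (2 : ℝ) ^ Fintype.card ι ≤ 2 ^ M := pow_le_pow_right₀ (by norm_num) hK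
    gcongr
  set c₀ : ℝ := ((2 : ℝ) ^ Fintype.card ι + 1) * (4 * Fintype.card ι ^ 2 + 3) with hc₀
  have hc₀2 : 3 * (2 : ℝ) ^ Fintype.card ι ≤ c₀ := by
    rw [hc₀]
    have : (0 : ℝ) < 2 ^ Fintype.card ι := by positivity
    have h2 : (0 : ℝ) ≤ (Fintype.card ι : ℝ) ^ 2 := by positivity
    nlinarith
  have hc₀0 : 0 ≤ c₀ := by positivity
  obtain ⟨p, q, hpq, hp, hq⟩ := h.exists_mainDart (by positivity) (θ := 8 * θ) (by positivity) hS
    (by linarith)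
  obtain ⟨r, t, hrt, hr, ht⟩ := h.exists_mainDart (by positivity) (θ := 8 * θ) (by positivity)
    hS' (by linarith)
  set e : ℕ := ⌈2 * θ * m⌉₊ with he
  have he1 : 2 * θ * m ≤ e := Nat.le_ceil _
  have he2 : (e : ℝ) ≤ 3 * θ * m := by
    have := (Nat.ceil_lt_add_one (by positivity : 0 ≤ 2 * θ * m)).le
    linarith
  have hθm : 0 < θ * m := by positivity
  obtain ⟨E₁, hE₁, hE₁c⟩ := Finset.exists_subset_card_eq (s := S' ∩ A r) (n := e) (by
    have : (e : ℝ) ≤ (S' ∩ A r).card := by linarith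
    exact_mod_cast this)
  obtain ⟨E₂, hE₂, hE₂c⟩ := Finset.exists_subset_card_eq (s := S' ∩ A t) (n := e) (by
    have : (e : ℝ) ≤ (S' ∩ A t).card := by linarith
    exact_mod_cast this)
  have hF : ((E₁ ∪ E₂).card : ℝ) ≤ 6 * (θ * m) := by
    have := Finset.card_union_le E₁ E₂
    rw [hE₁c, hE₂c] at this
    have : ((E₁ ∪ E₂).card : ℝ) ≤ e + e := by exact_mod_cast this
    linarith
  have hsd : ∀ X : Finset V, (X.card : ℝ) - 6 * (θ * m) ≤ (X \ (E₁ ∪ E₂)).card := by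
    intro X
    have := Finset.le_card_sdiff (E₁ ∪ E₂) X
    have : (X.card : ℝ) ≤ (X \ (E₁ ∪ E₂)).card + (E₁ ∪ E₂).card := by
      have h' : X.card ≤ (X \ (E₁ ∪ E₂)).card + (E₁ ∪ E₂).card := by omega
      exact_mod_cast h'
    linarith
  obtain ⟨l, hl, hlen, hcount⟩ := exists_long_tour (x := (1 - 9 * θ) * m)
    (mul_nonneg (by linarith) hm.le) h.posaDegree (by positivity) hpq hrt
  have hzero : ∀ Y ⊆ E₁ ∪ E₂, l.countP (fun i => ¬ Disjoint (A i \ (E₁ ∪ E₂)) Y) = 0 := by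
    intro Y hY
    rw [List.countP_eq_zero]
    intro i _
    simp only [decide_eq_true_eq, not_not]
    exact Finset.disjoint_of_subset_right hY Finset.sdiff_disjoint
  have hδθm : δ ^ 2 * θ * m ≤ θ * m := mul_le_mul_of_nonneg_right hδθ hm.le
  have hδθm' : δ * θ * m ≤ θ * m := mul_le_mul_of_nonneg_right hδθ' hm.le
  obtain ⟨x₁, x₂, l', y₁, y₂, hP, hnd, hx₁, hx₂, hy₁, hy₂, hlen', -⟩ :=
    h.exists_sqPath_of_walk hδ hδ1 hθ hε.le (by linarith) hl (F := E₁ ∪ E₂)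
      (X₁ := (S ∩ A p) \ (E₁ ∪ E₂)) (X₂ := (S ∩ A q) \ (E₁ ∪ E₂)) (Y₁ := E₁) (Y₂ := E₂)
      (Finset.sdiff_subset.trans Finset.inter_subset_right)
      (Finset.sdiff_subset.trans Finset.inter_subset_right)
      (hE₁.trans Finset.inter_subset_right) (hE₂.trans Finset.inter_subset_right)
      (by linarith [hsd (S ∩ A p)]) (by linarith [hsd (S ∩ A q)])
      (fun i _ => by
        have h1 := hsd (A i)
        rw [h.card_eq] at h1
        have h2 := hcount i
        linarith)
      (by rw [hzero _ Finset.subset_union_left, hE₁c]; push_cast; linarith)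
      (by rw [hzero _ Finset.subset_union_right, hE₂c]; push_cast; linarith)
  refine ⟨x₁, x₂, l', y₁, y₂, hP, hnd, (Finset.mem_inter.mp (Finset.mem_sdiff.mp hx₁).1).1,
    (Finset.mem_inter.mp (Finset.mem_sdiff.mp hx₂).1).1, (Finset.mem_inter.mp (hE₁ hy₁)).1,
    (Finset.mem_inter.mp (hE₂ hy₂)).1, ?_⟩
  have h1 : (l.length : ℝ) ≤ (x₁ :: x₂ :: (l' ++ [y₁, y₂])).length := by
    rw [← hlen']
    simp only [List.length_cons, List.length_append]
    exact_mod_cast (by omega : l'.length ≤ l'.length + _ + 1 + 1)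
  refine le_trans ?_ h1
  have hn0 : (0 : ℝ) ≤ Fintype.card V := by positivity
  have hKm := h.card_mul_le
  have hK1 : (1 : ℝ) ≤ Fintype.card ι := by exact_mod_cast h.card_index_pos
  have h2 : (m : ℝ) ≤ Fintype.card ι * m := le_mul_of_one_le_left hm.le hK1
  have h3 := mul_le_mul_of_nonneg_left (h2.trans hKm) hθ.le
  have h4 := mul_le_mul_of_nonneg_left hKm (by positivity : 0 ≤ 9 * θ)
  have h5 := h.cover
  have h6 : (10 * θ + ε) * (Fintype.card V : ℝ) ≤ μ * Fintype.card V :=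
    mul_le_mul_of_nonneg_right (by linarith) hn0
  linarith

/-- Square paths can be continued from the ordered pair `(c, d)` in a main dart. -/
def Linkable {V ι : Type} [Fintype V] [Fintype ι] (G : SimpleGraph V) (R : SimpleGraph ι)
    (A : ι → Finset V) (γ t : ℝ) (c d : V) : Prop :=
  ∃ p q, MainDart R γ (p, q) ∧ t ≤ (nb G c ∩ nb G d ∩ A p).card ∧ t ≤ (nb G d ∩ A q).card

/-- Square paths on five vertices which can be continued on both sides. -/
def IsGadget {V ι : Type} [Fintype V] [Fintype ι] (G : SimpleGraph V) (R : SimpleGraph ι)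
    (A : ι → Finset V) (γ t : ℝ) (f : Fin 5 → V) : Prop :=
  SqChain G.Adj [f 0, f 1, f 2, f 3, f 4] ∧ [f 0, f 1, f 2, f 3, f 4].Nodup ∧
    Linkable G R A γ t (f 1) (f 0) ∧ Linkable G R A γ t (f 3) (f 4)

section Gadget

variable {V ι : Type} [Fintype V] [Fintype ι] {G : SimpleGraph V} {R : SimpleGraph ι}
  {A : ι → Finset V} {γ ε δ θ : ℝ} {m : ℕ}

lemma IsReducedGraph.card_gadgets (h : IsReducedGraph G R A γ ε δ m) (hγ : 0 < γ) (hδ0 : 0 < δ)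
    (hδ1 : δ ≤ 1) (hθ : 0 ≤ θ) (hθ1 : 2 * θ ≤ 1) (hε : 2 * ε ≤ δ ^ 2 * θ) (hε0 : 0 ≤ ε)
    (h7 : 7 ≤ θ * m) {b c u : ι} (hbu : MainDart R γ (b, u)) (hbc : R.Adj b c) (huc : R.Adj u c)
    {N X : Finset V} (hb : 2 * θ * m ≤ (N ∩ A b).card) (hc : 2 * θ * m ≤ (N ∩ A c).card)
    (hX : X ⊆ A u) (hXc : 2 * θ * m ≤ X.card) :
    ((δ ^ 2 * θ - 2 * ε) * m) ^ 5 ≤ (Finset.univ.filter fun f : Fin 5 → V =>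
      IsGadget G R A γ (δ ^ 2 * θ * m) f ∧ (f 0 ∈ N ∧ f 1 ∈ N ∧ f 3 ∈ N ∧ f 4 ∈ N) ∧
        f 2 ∈ X).card := by
  have hm : (0 : ℝ) < m := by exact_mod_cast h.size_pos
  have hub := hbu.adj
  dsimp only at hub
  have hδ2 : δ ^ 2 ≤ 1 := pow_le_one₀ hδ0.le hδ1
  have hδθ : δ ^ 2 * θ * m ≤ θ * m :=
    mul_le_mul_of_nonneg_right (mul_le_of_le_one_left hθ hδ2) hm.le
  have hδθ' : δ * θ * m ≤ θ * m :=
    mul_le_mul_of_nonneg_right (mul_le_of_le_one_left hθ hδ1) hm.le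
  have hθm : 2 * θ * m ≤ m := mul_le_of_le_one_left hm.le hθ1
  have h1 := many_good (T := (δ ^ 2 * θ - 2 * ε) * m) h.regPair hδ0 hδ1 hθ hm.le le_rfl
    (by linarith) 5 (c, N ∩ A c) (b, N ∩ A b)
    [(u, X), (c, N ∩ A c), (b, N ∩ A b), (u, A u), (c, A c)] rfl
    (by simp [SqChain, hbc, hbc.symm, huc, huc.symm, hub, hub.symm])
    (by
      intro q hq
      simp only [List.mem_cons, List.not_mem_nil, or_false] at hq
      rcases hq with rfl | rfl | rfl | rfl | rfl | rfl | rfl <;>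
        simp [hX, Finset.inter_subset_right])
    (by dsimp only; linarith) (by dsimp only; linarith)
    (by
      intro q hq
      have h2 := List.countP_le_length (p := fun x : ι × Finset V => ¬ Disjoint x.2 q.2)
        (l := (c, N ∩ A c) :: (b, N ∩ A b) ::
          [(u, X), (c, N ∩ A c), (b, N ∩ A b), (u, A u), (c, A c)])
      have h3 := (Nat.cast_le (α := ℝ)).mpr h2
      simp only [List.length_cons, List.length_nil] at h3
      push_cast at h3
      have h4 : 2 * θ * m ≤ q.2.card := by
        simp only [List.mem_cons, List.not_mem_nil, or_false] at hq
        rcases hq with rfl | rfl | rfl | rfl | rfl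
        · exact hXc
        · exact hc
        · exact hb
        · rw [h.card_eq]; exact hθm
        · rw [h.card_eq]; exact hθm
      linarith)
  refine (h1.card (mul_nonneg (by linarith) hm.le)).trans ?_
  rw [Nat.cast_le]
  refine Finset.card_le_card fun f hf => ?_
  simp only [Finset.mem_filter, Finset.mem_univ, true_and] at hf ⊢
  have hf' : Good G (δ ^ 2 * θ * m) [f 0, f 1, f 2, f 3, f 4]
      [N ∩ A c, N ∩ A b, X, N ∩ A c, N ∩ A b, A u, A c] := by
    simpa [List.ofFn_succ] using hf
  simp only [Good, List.map_cons, List.map_nil, Finset.mem_inter, mem_nb, Finset.mem_erase]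
    at hf'
  obtain ⟨-, ⟨n0, -⟩, g1, ⟨a01, n1, -⟩, g2, ⟨a12, a02, x2⟩, -, ⟨a23, a13, d30, n3, -⟩, -,
    ⟨a34, a24, d41, d40, n4, -⟩, g5, g6⟩ := hf'
  refine ⟨⟨?_, ?_, ⟨u, b, hbu.swap h.posaDegree hγ, g2.trans ?_, g1.trans ?_⟩,
    ⟨u, c, hbu.step huc hbc, g5.trans ?_, g6.trans ?_⟩⟩, ⟨n0, n1, n3, n4⟩, x2⟩
  · simp [SqChain, *]
  · simp [a01.ne, a02.ne, Ne.symm d30, Ne.symm d40, a12.ne, a13.ne, Ne.symm d41, a23.ne, a24.ne,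
      a34.ne]
  all_goals
    rw [Nat.cast_le]
    refine Finset.card_le_card fun x hx => ?_
    simp only [Finset.mem_inter, mem_nb, Finset.mem_erase] at hx ⊢
  · exact ⟨⟨hx.1, hx.2.1⟩, hX hx.2.2⟩
  · exact ⟨hx.1, hx.2.2⟩
  · exact ⟨⟨hx.2.1, hx.1⟩, by tauto⟩
  · exact ⟨hx.1, by tauto⟩

end Gadget

/-- A five-vertex square path which can take up the vertex `v`, either by inserting it or by
swapping it with the middle vertex of larger level. -/
def GadgetAbsorbs {V : Type} (G : SimpleGraph V) (lev : V → ℕ) (v : V) (f : Fin 5 → V) : Prop :=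
  (SqChain G.Adj [f 0, f 1, v, f 3, f 4] ∧ lev v < lev (f 2)) ∨
    SqChain G.Adj [f 0, f 1, v, f 2, f 3, f 4]

section Absorbers

variable {V ι : Type} [Fintype V] [Fintype ι] {G : SimpleGraph V} {R : SimpleGraph ι}
  {A : ι → Finset V} {γ ε δ θ : ℝ} {m : ℕ}

lemma IsReducedGraph.card_typical (h : IsReducedGraph G R A γ ε δ m) (hγ : 0 < γ)
    (hε : 4 * ε ≤ γ) (hε1 : ε ≤ 1) (hθ : 2 * θ ≤ δ) {u : ι} {d : ℕ}
    (hd : d + γ / 2 * Fintype.card ι ≤ (nb R u).card) :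
    (m : ℝ) / 2 ≤ ((A u).filter fun x => d < (richIndex A (nb G x) (2 * θ * m)).card).card := by
  have hm : (0 : ℝ) < m := by exact_mod_cast h.size_pos
  have hK : (0 : ℝ) < Fintype.card ι := by exact_mod_cast h.card_index_pos
  set Y := (A u).filter fun x => ¬ d < (richIndex A (nb G x) (2 * θ * m)).card with hY
  have h1 := Finset.card_filter_add_card_filter_not (s := A u)
    (fun x => d < (richIndex A (nb G x) (2 * θ * m)).card)
  rw [h.card_eq] at h1
  have h1' : (((A u).filter fun x => d < (richIndex A (nb G x) (2 * θ * m)).card).card : ℝ)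
      + Y.card = m := by exact_mod_cast h1
  have h2 : ∑ x ∈ Y, ((nb R u).filter fun w => w ∉ richIndex A (nb G x) (2 * θ * m)).card =
      ∑ w ∈ nb R u, (Y.filter fun x => w ∉ richIndex A (nb G x) (2 * θ * m)).card :=
    Finset.sum_card_bipartiteAbove_eq_sum_card_bipartiteBelow _
  have h3 : ∀ x ∈ Y, γ / 2 * Fintype.card ι ≤
      ((nb R u).filter fun w => w ∉ richIndex A (nb G x) (2 * θ * m)).card := by
    intro x hx
    rw [hY, Finset.mem_filter, not_lt] at hx
    have h4 := Finset.card_sdiff_add_card_inter (nb R u) (richIndex A (nb G x) (2 * θ * m))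
    have h5 := Finset.card_le_card
      (Finset.inter_subset_right (s₁ := nb R u) (s₂ := richIndex A (nb G x) (2 * θ * m)))
    rw [Finset.filter_notMem_eq_sdiff]
    have h6 : (nb R u).card ≤ (nb R u \ richIndex A (nb G x) (2 * θ * m)).card + d := by omega
    have h7 : ((nb R u).card : ℝ) ≤ (nb R u \ richIndex A (nb G x) (2 * θ * m)).card + d := by
      exact_mod_cast h6
    linarith
  have h4 : ∀ w ∈ nb R u,
      ((Y.filter fun x => w ∉ richIndex A (nb G x) (2 * θ * m)).card : ℝ) ≤ ε * m := by
    intro w hw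
    rw [mem_nb] at hw
    refine le_trans ?_ ((h.regPair u w hw).card_bad le_rfl le_rfl ?_)
    · rw [Nat.cast_le]
      refine Finset.card_le_card fun x hx => ?_
      rw [Finset.mem_filter, mem_richIndex, not_le] at hx
      rw [hY, Finset.mem_filter] at hx
      rw [Finset.mem_filter, h.card_eq]
      exact ⟨hx.1.1, hx.2.trans_le (mul_le_mul_of_nonneg_right hθ hm.le)⟩
    · rw [h.card_eq]
      exact mul_le_of_le_one_left hm.le hε1
  have h5 := Finset.card_nsmul_le_sum Y _ _ h3
  have h6 := Finset.sum_le_card_nsmul _ _ _ h4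
  have h7 : (∑ x ∈ Y, (((nb R u).filter fun w => w ∉ richIndex A (nb G x) (2 * θ * m)).card : ℝ)) =
      ∑ w ∈ nb R u, ((Y.filter fun x => w ∉ richIndex A (nb G x) (2 * θ * m)).card : ℝ) := by
    exact_mod_cast h2
  rw [nsmul_eq_mul] at h5 h6
  have h8 : ((nb R u).card : ℝ) ≤ Fintype.card ι := by exact_mod_cast Finset.card_le_univ _
  have h9 : 4 * ε * (m * Fintype.card ι) ≤ γ * (m * Fintype.card ι) := by gcongr
  have h10 : ((nb R u).card : ℝ) * (ε * m) ≤ γ * (m * Fintype.card ι) / 4 := by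
    by_cases hε0 : 0 ≤ ε
    · calc ((nb R u).card : ℝ) * (ε * m) ≤ Fintype.card ι * (ε * m) := by gcongr
        _ ≤ _ := by linarith
    · have : ((nb R u).card : ℝ) * (ε * m) ≤ 0 :=
        mul_nonpos_of_nonneg_of_nonpos (Nat.cast_nonneg _) (mul_nonpos_of_nonpos_of_nonneg
          (not_le.mp hε0).le hm.le)
      have : 0 ≤ γ * (m * Fintype.card ι) := by positivity
      linarith
  have h11 : (Y.card : ℝ) * (γ * Fintype.card ι) ≤ m / 2 * (γ * Fintype.card ι) := by
    linarith
  have h12 := le_of_mul_le_mul_right h11 (mul_pos hγ hK)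
  linarith

theorem IsReducedGraph.card_absorbers (h : IsReducedGraph G R A γ ε δ m) (hγ : 0 < γ)
    (hG : PosaDegree G (2 * γ)) (hδ0 : 0 < δ) (hδ1 : δ ≤ 1) (hθ : 0 ≤ θ) (hθ1 : 4 * θ ≤ 1)
    (hθδ : 2 * θ ≤ δ) (hθε : 2 * θ + ε ≤ γ) (hε : 2 * ε ≤ δ ^ 2 * θ) (hε0 : 0 ≤ ε)
    (hεγ : 4 * ε ≤ γ) (h7 : 7 ≤ θ * m) (v : V) :
    ((δ ^ 2 * θ - 2 * ε) * m) ^ 5 ≤ (Finset.univ.filter fun f : Fin 5 → V =>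
      IsGadget G R A γ (δ ^ 2 * θ * m) f ∧
        GadgetAbsorbs G (fun w => (richIndex A (nb G w) (2 * θ * m)).card) v f).card := by
  have hm : (0 : ℝ) < m := by exact_mod_cast h.size_pos
  have hK : (0 : ℝ) < Fintype.card ι := by exact_mod_cast h.card_index_pos
  have hγK := mul_pos hγ hK
  have hε1 : ε ≤ 1 := by
    have := mul_le_of_le_one_left hθ (pow_le_one₀ (n := 2) hδ0.le hδ1)
    linarith
  set D := richIndex A (nb G v) (2 * θ * m) with hD
  have hDc : (Fintype.card ι : ℝ) / 3 + γ * Fintype.card ι ≤ D.card := by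
    have h1 := hG.min_degree v
    have h2 := h.card_richIndex (θ := 2 * θ) (c := 1 / 3 + 2 * γ) (S := nb G v) (by linarith)
      (by linarith)
    have h3 : (2 * θ + ε) * Fintype.card ι ≤ γ * Fintype.card ι := by gcongr
    linarith
  have hRδ := h.posaDegree
  obtain ⟨b, hb, hbH⟩ := hRδ.exists_high (S := D) (by linarith)
  have hbH' := hbH
  unfold High at hbH'
  have hrich : ∀ {i}, i ∈ D → 2 * θ * m ≤ (nb G v ∩ A i).card := fun hi => mem_richIndex.mp hi
  by_cases hlow : (D.card : ℝ) < 2 * Fintype.card ι / 3 + γ / 2 * Fintype.card ι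
  · obtain ⟨s, hs0, hs1, hs2, hs3⟩ : ∃ s : ℝ, 0 ≤ s ∧ s ≤ (Fintype.card ι : ℝ) / 3 ∧
        s ≤ D.card - (Fintype.card ι : ℝ) / 3 ∧
        D.card + γ / 2 * Fintype.card ι ≤ Fintype.card ι / 3 + s + γ * Fintype.card ι := by
      rcases le_total ((Fintype.card ι : ℝ) / 3) (D.card - (Fintype.card ι : ℝ) / 3) with h1 | h1
      · exact ⟨_, by positivity, le_rfl, h1, by linarith⟩
      · exact ⟨_, by linarith, h1, le_rfl, by linarith⟩
    obtain ⟨c, hc, hcd⟩ := hRδ.exists_mem (S := D ∩ nb R b) hs0 hs1 (by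
      have := card_inter_ge D (nb R b)
      linarith)
    rw [Finset.mem_inter, mem_nb] at hc
    obtain ⟨u, hu, hud⟩ := hRδ.exists_mem (S := nb R b ∩ nb R c) hs0 hs1 (by
      have := card_inter_ge (nb R b) (nb R c)
      linarith)
    rw [Finset.mem_inter, mem_nb, mem_nb] at hu
    have hX := h.card_typical (θ := θ) (d := D.card) (u := u) hγ hεγ hε1 hθδ (by linarith)
    refine (h.card_gadgets hγ hδ0 hδ1 hθ (by linarith) hε hε0 h7 (mainDart_of_high hbH hu.1) hc.2
      hu.2.symm (hrich hb) (hrich hc.1) (Finset.filter_subset _ _) (le_trans ?_ hX)).trans ?_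
    · have : 4 * θ * m ≤ m := mul_le_of_le_one_left hm.le hθ1
      linarith
    · rw [Nat.cast_le]
      refine Finset.card_le_card fun f hf => ?_
      simp only [Finset.mem_filter, Finset.mem_univ, true_and, mem_nb] at hf ⊢
      obtain ⟨h1, ⟨h2, h3, h4, h5⟩, -, h6⟩ := hf
      refine ⟨h1, Or.inl ⟨?_, h6⟩⟩
      have h7 := h1.1
      simp only [SqChain, List.take, List.mem_cons, List.not_mem_nil, or_false, forall_eq_or_imp,
        forall_eq] at h7 ⊢
      simp [*, h2.symm, h3.symm]
  · obtain ⟨c, hc, hcH⟩ := hRδ.exists_high (S := D ∩ nb R b) (by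
      have := card_inter_ge D (nb R b)
      linarith)
    have hcH' := hcH
    unfold High at hcH'
    rw [Finset.mem_inter, mem_nb] at hc
    obtain ⟨u, hu⟩ : (D ∩ (nb R b ∩ nb R c)).Nonempty := card_inter_pos (by
      have := card_inter_ge (nb R b) (nb R c)
      linarith)
    rw [Finset.mem_inter, Finset.mem_inter, mem_nb, mem_nb] at hu
    refine (h.card_gadgets (X := nb G v ∩ A u) hγ hδ0 hδ1 hθ (by linarith) hε hε0 h7
      (mainDart_of_high hbH hu.2.1) hc.2
      hu.2.2.symm (hrich hb) (hrich hc.1) Finset.inter_subset_right (hrich hu.1)).trans ?_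
    rw [Nat.cast_le]
    refine Finset.card_le_card fun f hf => ?_
    simp only [Finset.mem_filter, Finset.mem_univ, true_and, mem_nb, Finset.mem_inter] at hf ⊢
    obtain ⟨h1, ⟨h2, h3, h4, h5⟩, h6, -⟩ := hf
    refine ⟨h1, Or.inr ?_⟩
    have h7 := h1.1
    simp only [SqChain, List.take, List.mem_cons, List.not_mem_nil, or_false, forall_eq_or_imp,
      forall_eq] at h7 ⊢
    simp [*, h2.symm, h3.symm]

end Absorbers

section Families

variable {V : Type}

/-- The vertices of the members of a family of tuples. -/
def famVerts (Fam : Finset (Fin 5 → V)) : Finset V :=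
  Fam.biUnion fun f => Finset.univ.image f

lemma card_famVerts (Fam : Finset (Fin 5 → V)) : (famVerts Fam).card ≤ Fam.card * 5 :=
  Finset.card_biUnion_le_card_mul _ _ _ fun f _ =>
    Finset.card_image_le.trans (by simp)

lemma mem_famVerts {Fam : Finset (Fin 5 → V)} {v : V} :
    v ∈ famVerts Fam ↔ ∃ f ∈ Fam, ∃ i, f i = v := by
  simp [famVerts]

/-- Distinct members have no vertices in common. -/
def DisjointFam (Fam : Finset (Fin 5 → V)) : Prop :=
  ∀ f ∈ Fam, ∀ g ∈ Fam, f ≠ g → ∀ i j, f i ≠ g j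

end Families

section Selection

variable {V : Type} [Fintype V]

lemma card_tuples_meeting (F : Finset V) :
    (Finset.univ.filter fun f : Fin 5 → V => ∃ i, f i ∈ F).card ≤
      5 * (F.card * Fintype.card V ^ 4) := by
  have h1 : (Finset.univ.filter fun f : Fin 5 → V => ∃ i, f i ∈ F) ⊆
      (Finset.univ : Finset (Fin 5)).biUnion fun i =>
        Fintype.piFinset (Function.update (fun _ => Finset.univ) i F) := by
    intro f hf
    simp only [Finset.mem_filter, Finset.mem_univ, true_and] at hf
    obtain ⟨i, hi⟩ := hf
    simp only [Finset.mem_biUnion, Finset.mem_univ, true_and, Fintype.mem_piFinset]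
    refine ⟨i, fun j => ?_⟩
    by_cases hij : j = i
    · subst hij; simpa using hi
    · simp [hij]
  refine (Finset.card_le_card h1).trans ((Finset.card_biUnion_le_card_mul _ _
    (F.card * Fintype.card V ^ 4) fun i _ => ?_).trans (by simp))
  rw [Fintype.card_piFinset]
  have h2 : ∀ j, (Function.update (fun _ => (Finset.univ : Finset V)) i F j).card =
      Function.update (fun _ : Fin 5 => Fintype.card V) i F.card j := by
    intro j
    by_cases hij : j = i
    · subst hij; simp
    · simp [hij]
  rw [Finset.prod_congr rfl fun j _ => h2 j, Finset.prod_update_of_mem (Finset.mem_univ i)]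
  simp [Finset.card_sdiff]

lemma exists_good_tuple [Nonempty V] {T : V → Finset (Fin 5 → V)} {c : ℝ}
    (hc : ∀ v, c * (Fintype.card V : ℝ) ^ 5 ≤ (T v).card) {F : Finset V}
    (hF : 10 * (F.card : ℝ) ≤ c * Fintype.card V) (w : V → ℝ) (hw : ∀ v, 0 ≤ w v) :
    ∃ f : Fin 5 → V, (∀ i, f i ∉ F) ∧
      c / 2 * ∑ v, w v ≤ ∑ v, if f ∈ T v then w v else 0 := by
  set n : ℝ := (Fintype.card V : ℝ) with hn
  have hn0 : 0 < n := by rw [hn]; exact_mod_cast Fintype.card_pos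
  set P : Finset (Fin 5 → V) := Finset.univ.filter fun f => ∃ i, f i ∈ F with hP
  have hPc : (P.card : ℝ) ≤ c / 2 * n ^ 5 := by
    have h1 : (P.card : ℝ) ≤ 5 * (F.card * n ^ 4) := by
      rw [hn]
      exact_mod_cast card_tuples_meeting F
    have h2 : 10 * (F.card : ℝ) * n ^ 4 ≤ c * n * n ^ 4 := by gcongr
    have h3 : c * n * n ^ 4 = c * n ^ 5 := by ring
    linarith
  have h1 : ∀ v, c / 2 * n ^ 5 ≤ ((T v \ P).card : ℝ) := by
    intro v
    have h2 := Finset.le_card_sdiff P (T v)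
    have h3 : (T v).card ≤ (T v \ P).card + P.card := by omega
    have h4 : ((T v).card : ℝ) ≤ (T v \ P).card + P.card := by exact_mod_cast h3
    linarith [hc v]
  have h2 : ∑ f ∈ Pᶜ, ∑ v, (if f ∈ T v then w v else 0) = ∑ v, (T v \ P).card * w v := by
    rw [Finset.sum_comm]
    refine Finset.sum_congr rfl fun v _ => ?_
    rw [← Finset.sum_filter, Finset.sum_const, nsmul_eq_mul]
    congr 3
    ext f
    simp [and_comm]
  have hlow : c / 2 * n ^ 5 * ∑ v, w v ≤ ∑ v, (T v \ P).card * w v := by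
    rw [Finset.mul_sum]
    exact Finset.sum_le_sum fun v _ => mul_le_mul_of_nonneg_right (h1 v) (hw v)
  have hne : (Pᶜ).Nonempty ∨ c ≤ 0 := by
    by_contra! h
    have h3 : T (Classical.arbitrary V) \ P = ∅ := by
      rw [Finset.sdiff_eq_empty_iff_subset]
      intro f _
      by_contra hf
      exact (Finset.eq_empty_iff_forall_notMem.mp h.1 f) (by simpa using hf)
    have h4 := h1 (Classical.arbitrary V)
    rw [h3, Finset.card_empty] at h4
    have h5 : 0 < c / 2 * n ^ 5 := by have := h.2; positivity
    simp at h4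
    linarith
  have hs : 0 ≤ ∑ v, w v := Finset.sum_nonneg fun v _ => hw v
  by_cases hex : (Pᶜ).Nonempty
  · obtain ⟨f, hf, hle⟩ := Finset.exists_le_of_sum_le (s := Pᶜ)
      (f := fun _ => c / 2 * ∑ v, w v) (g := fun f => ∑ v, if f ∈ T v then w v else 0) hex (by
        rw [h2, Finset.sum_const, nsmul_eq_mul]
        refine le_trans ?_ hlow
        by_cases hc0 : 0 ≤ c
        · have h3 : ((Pᶜ).card : ℝ) ≤ n ^ 5 := by
            have h4 := Finset.card_le_univ (Pᶜ)
            rw [Fintype.card_fun, Fintype.card_fin] at h4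
            rw [hn]
            exact_mod_cast h4
          have h4 := mul_le_mul_of_nonneg_right h3
            (show 0 ≤ c / 2 * ∑ v, w v by positivity)
          linarith
        · exfalso
          have h3 : c * n < 0 := mul_neg_of_neg_of_pos (not_le.mp hc0) hn0
          have h4 : (0 : ℝ) ≤ 10 * F.card := by positivity
          linarith)
    refine ⟨f, fun i hi => ?_, hle⟩
    rw [Finset.mem_compl, hP, Finset.mem_filter] at hf
    exact hf ⟨Finset.mem_univ _, i, hi⟩
  · have hc0 := hne.resolve_left hex
    have h3 : (F.card : ℝ) ≤ 0 := by
      have : c * n ≤ 0 := mul_nonpos_of_nonpos_of_nonneg hc0 hn0.le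
      linarith
    have h4 : F = ∅ := by
      rw [← Finset.card_eq_zero]
      exact_mod_cast le_antisymm h3 (Nat.cast_nonneg _)
    refine ⟨fun _ => Classical.arbitrary V, by simp [h4], ?_⟩
    refine (mul_nonpos_of_nonpos_of_nonneg (by linarith) hs).trans
      (Finset.sum_nonneg fun v _ => ?_)
    split_ifs
    · exact hw v
    · exact le_rfl

lemma exists_family_of_le [Nonempty V] {T : V → Finset (Fin 5 → V)} {c : ℝ} (hc0 : 0 < c)
    (hc : ∀ v, c * (Fintype.card V : ℝ) ^ 5 ≤ (T v).card) (k : ℕ)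
    (hk : 50 * (k : ℝ) ≤ c * Fintype.card V) :
    ∃ Fam : Finset (Fin 5 → V), Fam.card ≤ k ∧ DisjointFam Fam ∧ (∀ f ∈ Fam, ∃ v, f ∈ T v) ∧
      ∑ v, (1 / 2 : ℝ) ^ (T v ∩ Fam).card ≤ Fintype.card V * (1 - c / 4) ^ k := by
  induction k with
  | zero => exact ⟨∅, by simp, by simp [DisjointFam], by simp, by simp⟩
  | succ k ih =>
    push_cast at hk
    obtain ⟨Fam, h1, h2, h3, h4⟩ := ih (by linarith)
    have hF : 10 * ((famVerts Fam).card : ℝ) ≤ c * Fintype.card V := by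
      have h5 : ((famVerts Fam).card : ℝ) ≤ k * 5 := by
        exact_mod_cast (card_famVerts Fam).trans (Nat.mul_le_mul_right 5 h1)
      linarith
    obtain ⟨f, hf, hfs⟩ := exists_good_tuple hc hF (fun v => (1 / 2 : ℝ) ^ (T v ∩ Fam).card)
      (fun v => by positivity)
    have hpos : 0 < ∑ v, (1 / 2 : ℝ) ^ (T v ∩ Fam).card :=
      Finset.sum_pos (fun v _ => by positivity) Finset.univ_nonempty
    have hfT : ∃ v, f ∈ T v := by
      by_contra! h
      simp only [h, if_false, Finset.sum_const_zero] at hfs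
      have := mul_pos (half_pos hc0) hpos
      linarith
    have hfF : f ∉ Fam := fun h => hf 0 (mem_famVerts.mpr ⟨f, h, 0, rfl⟩)
    refine ⟨insert f Fam, (Finset.card_insert_le _ _).trans (by omega), ?_, ?_, ?_⟩
    · intro a ha b hb hab i j hij
      rw [Finset.mem_insert] at ha hb
      rcases ha with rfl | ha <;> rcases hb with rfl | hb
      · exact hab rfl
      · exact hf i (mem_famVerts.mpr ⟨b, hb, j, hij.symm⟩)
      · exact hf j (mem_famVerts.mpr ⟨a, ha, i, hij⟩)
      · exact h2 a ha b hb hab i j hij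
    · intro a ha
      rw [Finset.mem_insert] at ha
      rcases ha with rfl | ha
      · exact hfT
      · exact h3 a ha
    · have h5 : ∀ v, (1 / 2 : ℝ) ^ (T v ∩ insert f Fam).card = (1 / 2 : ℝ) ^ (T v ∩ Fam).card -
          1 / 2 * if f ∈ T v then (1 / 2 : ℝ) ^ (T v ∩ Fam).card else 0 := by
        intro v
        by_cases hv : f ∈ T v
        · rw [Finset.inter_insert_of_mem hv, Finset.card_insert_of_notMem (by simp [hfF]), if_pos hv,
            pow_succ]
          ring
        · rw [Finset.inter_insert_of_notMem hv, if_neg hv]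
          ring
      rw [Finset.sum_congr rfl fun v _ => h5 v, Finset.sum_sub_distrib, ← Finset.mul_sum]
      have h6 : c / 4 ≤ 1 := by
        have h7 : (∑ v, if f ∈ T v then (1 / 2 : ℝ) ^ (T v ∩ Fam).card else 0) ≤
            ∑ v, (1 / 2 : ℝ) ^ (T v ∩ Fam).card := by
          refine Finset.sum_le_sum fun v _ => ?_
          split_ifs
          · exact le_rfl
          · positivity
        have h8 : c / 2 * ∑ v, (1 / 2 : ℝ) ^ (T v ∩ Fam).card ≤
          1 * ∑ v, (1 / 2 : ℝ) ^ (T v ∩ Fam).card := by linarith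
        have := le_of_mul_le_mul_right h8 hpos
        linarith
      have h7 := mul_le_mul_of_nonneg_right h4 (show 0 ≤ 1 - c / 4 by linarith)
      rw [pow_succ]
      linarith

theorem exists_family [Nonempty V] {T : V → Finset (Fin 5 → V)} {c : ℝ} (hc0 : 0 < c)
    (hc : ∀ v, c * (Fintype.card V : ℝ) ^ 5 ≤ (T v).card) {N H : ℕ} (hN : 12 ≤ c * N)
    (hH : Fintype.card V ≤ 2 ^ H) (hNH : 50 * ((N : ℝ) * H) ≤ c * Fintype.card V) :
    ∃ Fam : Finset (Fin 5 → V), Fam.card ≤ N * H ∧ DisjointFam Fam ∧ (∀ f ∈ Fam, ∃ v, f ∈ T v) ∧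
      ∀ v, H ≤ (T v ∩ Fam).card := by
  obtain ⟨Fam, h1, h2, h3, h4⟩ := exists_family_of_le hc0 hc (N * H) (by push_cast; exact hNH)
  refine ⟨Fam, h1, h2, h3, fun v => ?_⟩
  by_contra! hlt
  have hc4 : c ≤ 1 := by
    have h5 := (hc v).trans (Nat.cast_le.mpr (Finset.card_le_univ _))
    rw [Fintype.card_fun, Fintype.card_fin] at h5
    push_cast at h5
    have h6 : (0 : ℝ) < (Fintype.card V : ℝ) ^ 5 := by
      have : (0 : ℝ) < Fintype.card V := by exact_mod_cast Fintype.card_pos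
      positivity
    exact le_of_mul_le_mul_right (by linarith) h6
  have h5 : (1 - c / 4) ^ N ≤ 1 / 4 := by
    have h6 : 1 - c / 4 ≤ Real.exp (-(c / 4)) := by
      have := Real.add_one_le_exp (-(c / 4))
      linarith
    have h7 : (1 - c / 4) ^ N ≤ Real.exp (-(c / 4)) ^ N :=
      pow_le_pow_left₀ (by linarith) h6 N
    have h8 : Real.exp (-(c / 4)) ^ N ≤ 1 / 4 := by
      rw [← Real.exp_nat_mul, ← Real.exp_log (show (0 : ℝ) < 1 / 4 by norm_num)]
      rw [Real.exp_le_exp, one_div, Real.log_inv]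
      have h9 : Real.log 4 ≤ 3 := by
        have := Real.log_le_sub_one_of_pos (show (0 : ℝ) < 4 by norm_num)
        linarith
      linarith
    exact h7.trans h8
  have h6 : (1 - c / 4) ^ (N * H) ≤ (1 / 4 : ℝ) ^ H := by
    rw [pow_mul]
    exact pow_le_pow_left₀ (pow_nonneg (by linarith) _) h5 H
  have h7 : (1 / 2 : ℝ) ^ (T v ∩ Fam).card ≤ Fintype.card V * (1 / 4 : ℝ) ^ H :=
    (Finset.single_le_sum (f := fun v => (1 / 2 : ℝ) ^ (T v ∩ Fam).card)
      (fun v _ => by positivity) (Finset.mem_univ v)).trans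
        (h4.trans (mul_le_mul_of_nonneg_left h6 (Nat.cast_nonneg _)))
  have h8 : (Fintype.card V : ℝ) ≤ 2 ^ H := by exact_mod_cast hH
  have h9 : (1 / 2 : ℝ) ^ (T v ∩ Fam).card ≤ (1 / 2 : ℝ) ^ H := by
    refine h7.trans ((mul_le_mul_of_nonneg_right h8 (by positivity)).trans_eq ?_)
    rw [← mul_pow]
    norm_num
  have h10 := pow_lt_pow_right_of_lt_one₀ (a := (1 / 2 : ℝ)) (by norm_num) (by norm_num) hlt
  linarith

end Selection

section Absorb

variable {V : Type} {G : SimpleGraph V} {lev : V → ℕ} {K : ℕ} {Fam : Finset (Fin 5 → V)}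

/-- All members of the family, with their middle parts given by `mid`, are square paths, and the
members in `F` have their original middle vertex. -/
def ValidMid (G : SimpleGraph V) (Fam F : Finset (Fin 5 → V)) (mid : (Fin 5 → V) → List V) :
    Prop :=
  F ⊆ Fam ∧ (∀ f ∈ F, mid f = [f 2]) ∧
    ∀ f ∈ Fam, SqChain G.Adj (f 0 :: f 1 :: (mid f ++ [f 3, f 4]))

lemma sum_update_mid {mid : (Fin 5 → V) → List V} {f : Fin 5 → V} (hf : f ∈ Fam) (l : List V) :
    ∑ g ∈ Fam, (Function.update mid f l g : Multiset V) + mid f =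
      ∑ g ∈ Fam, (mid g : Multiset V) + l := by
  rw [← Finset.add_sum_erase _ _ hf, ← Finset.add_sum_erase _ (fun g => (mid g : Multiset V)) hf,
    Finset.sum_congr rfl fun g hg => by rw [Function.update_of_ne (Finset.ne_of_mem_erase hg)]]
  simp only [Function.update_self]
  abel

lemma ValidMid.update {F : Finset (Fin 5 → V)} {mid : (Fin 5 → V) → List V}
    (h : ValidMid G Fam F mid) {f : Fin 5 → V} {l : List V}
    (hl : SqChain G.Adj (f 0 :: f 1 :: (l ++ [f 3, f 4]))) :
    ValidMid G Fam (F.erase f) (Function.update mid f l) := by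
  refine ⟨(Finset.erase_subset _ _).trans h.1, fun g hg => ?_, fun g hg => ?_⟩
  · rw [Function.update_of_ne (Finset.ne_of_mem_erase hg)]
    exact h.2.1 g (Finset.mem_of_mem_erase hg)
  · by_cases hgf : g = f
    · subst hgf; simpa using hl
    · rw [Function.update_of_ne hgf]
      exact h.2.2 g hg

lemma ValidMid.absorb_one (hlev : ∀ v, lev v ≤ K) (k : ℕ) {v : V} (hk : K < lev v + k)
    {F : Finset (Fin 5 → V)} {mid : (Fin 5 → V) → List V} (h : ValidMid G Fam F mid)
    (hit : ∀ w, k ≤ (F.filter (GadgetAbsorbs G lev w)).card) :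
    ∃ F' mid', ValidMid G Fam F' mid' ∧ F' ⊆ F ∧ F.card ≤ F'.card + k ∧
      ∑ f ∈ Fam, (mid' f : Multiset V) = ∑ f ∈ Fam, (mid f : Multiset V) + {v} := by
  induction k generalizing v F mid with
  | zero => have := hlev v; omega
  | succ k ih =>
    obtain ⟨f, hf⟩ := Finset.card_pos.mp ((Nat.succ_pos k).trans_le (hit v))
    rw [Finset.mem_filter] at hf
    obtain ⟨hfF, hfv⟩ := hf
    have hmid := h.2.1 f hfF
    have hcard := Finset.card_erase_add_one hfF
    rcases hfv with ⟨hch, hlt⟩ | hch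
    · have h1 := h.update (l := [v]) hch
      obtain ⟨F', mid', h2, h3, h4, h5⟩ := ih (v := f 2) (by omega) h1 fun w => by
        have h6 := hit w
        have h7 := Finset.pred_card_le_card_erase (a := f) (s := F.filter (GadgetAbsorbs G lev w))
        rw [← Finset.filter_erase] at h7
        omega
      refine ⟨F', mid', h2, h3.trans (Finset.erase_subset _ _), by omega, ?_⟩
      have h6 := sum_update_mid (mid := mid) (h.1 hfF) [v]
      rw [hmid] at h6
      rw [h5]
      simpa using h6
    · refine ⟨_, _, h.update (l := [v, f 2]) hch, Finset.erase_subset _ _, by omega, ?_⟩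
      have h6 := sum_update_mid (mid := mid) (h.1 hfF) [v, f 2]
      rw [hmid] at h6
      have h7 : (([v, f 2] : List V) : Multiset V) = {v} + (([f 2] : List V) : Multiset V) := rfl
      rw [h7, ← add_assoc] at h6
      exact add_right_cancel h6

theorem ValidMid.absorb (hlev : ∀ v, lev v ≤ K) (U : Finset V)
    {F : Finset (Fin 5 → V)} {mid : (Fin 5 → V) → List V} (h : ValidMid G Fam F mid)
    (hit : ∀ w, U.card * (K + 1) ≤ (F.filter (GadgetAbsorbs G lev w)).card) :
    ∃ F' mid', ValidMid G Fam F' mid' ∧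
      ∑ f ∈ Fam, (mid' f : Multiset V) = ∑ f ∈ Fam, (mid f : Multiset V) + U.val := by
  induction U using Finset.induction_on generalizing F mid with
  | empty => exact ⟨F, mid, h, by simp⟩
  | insert v U hv ih =>
    rw [Finset.card_insert_of_notMem hv, Nat.succ_mul] at hit
    obtain ⟨F', mid', h1, h2, h3, h4⟩ := h.absorb_one (v := v) hlev (K + 1) (by omega)
      fun w => (Nat.le_add_left _ _).trans (hit w)
    obtain ⟨F'', mid'', h5, h6⟩ := ih h1 fun w => by
      have h7 := hit w
      have h8 : (F.filter (GadgetAbsorbs G lev w)).card ≤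
          (F'.filter (GadgetAbsorbs G lev w)).card + (F \ F').card := by
        refine (Finset.card_le_card fun f hf => ?_).trans (Finset.card_union_le _ _)
        rw [Finset.mem_filter] at hf
        rw [Finset.mem_union, Finset.mem_filter, Finset.mem_sdiff]
        tauto
      have h9 := Finset.card_sdiff_add_card_eq_card h2
      omega
    refine ⟨F'', mid'', h5, ?_⟩
    rw [h6, h4, Finset.insert_val_of_notMem hv, ← Multiset.singleton_add, add_assoc]

end Absorb

section Glue

variable {V : Type} {G : SimpleGraph V}

lemma SqChain.glue {c d x₁ x₂ y₁ y₂ a b : V} {l : List V}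
    (h : SqChain G.Adj (x₁ :: x₂ :: (l ++ [y₁, y₂]))) (hcd : G.Adj c d) (hab : G.Adj a b)
    (h1 : G.Adj c x₁) (h2 : G.Adj d x₁) (h3 : G.Adj d x₂) (h4 : G.Adj y₁ a) (h5 : G.Adj y₂ a)
    (h6 : G.Adj y₂ b) :
    SqChain G.Adj (c :: d :: ((x₁ :: x₂ :: (l ++ [y₁, y₂])) ++ [a, b])) := by
  have hy : G.Adj y₁ y₂ := by
    have : SqChain G.Adj ((x₁ :: x₂ :: l) ++ [y₁, y₂]) := h
    exact this.of_append_right.1 _ (by simp)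
  have h7 : SqChain G.Adj ((x₁ :: x₂ :: l) ++ y₁ :: y₂ :: [a, b]) := by
    refine SqChain.append h ?_
    simp [SqChain, *]
  have h8 : (c :: d :: ((x₁ :: x₂ :: (l ++ [y₁, y₂])) ++ [a, b])) =
      [c, d] ++ x₁ :: x₂ :: (l ++ [y₁, y₂] ++ [a, b]) := rfl
  rw [h8]
  refine SqChain.append ?_ ?_
  · have := h.1 x₂ (by simp)
    simp [SqChain, *]
  · simpa using h7

end Glue

section Connect

variable {V ι : Type} [Fintype V] [Fintype ι] {G : SimpleGraph V} {R : SimpleGraph ι}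
  {A : ι → Finset V} {γ ε δ θ : ℝ} {m : ℕ}

theorem IsReducedGraph.exists_connector (h : IsReducedGraph G R A γ ε δ m) (hγ : 0 < γ)
    (hδ0 : 0 < δ) (hδ1 : δ ≤ 1) (hθ0 : 0 < θ) (hθ1 : θ ≤ 1) (hε0 : 0 ≤ ε)
    (hε : 8 * ε < δ ^ 2 * θ) {a b c d : V} (hcd : Linkable G R A γ (θ * m) c d)
    (hba : Linkable G R A γ (θ * m) b a) (hcd' : G.Adj c d) (hab : G.Adj a b) {F : Finset V}
    (hF : 2 * (F.card : ℝ) ≤ θ * m) (hK : 16 * (Fintype.card ι : ℝ) ^ 2 + 20 ≤ θ * m) :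
    ∃ l : List V, SqChain G.Adj (c :: d :: (l ++ [a, b])) ∧ l.Nodup ∧ (∀ v ∈ l, v ∉ F) ∧
      l.length ≤ 4 * Fintype.card ι ^ 2 + 5 := by
  have hm : (0 : ℝ) < m := by exact_mod_cast h.size_pos
  obtain ⟨p, q, hpq, hp, hq⟩ := hcd
  obtain ⟨t, r, htr, ht, hr⟩ := hba
  obtain ⟨l, hl, hch⟩ := hpq.exists_walk h.posaDegree hγ (htr.swap h.posaDegree hγ)
  have hsd : ∀ S : Finset V, θ * m ≤ S.card → θ * m / 2 ≤ ((S \ F).card : ℝ) := by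
    intro S hS
    have h1 := Finset.le_card_sdiff F S
    have h2 : S.card ≤ (S \ F).card + F.card := by omega
    have h3 : (S.card : ℝ) ≤ (S \ F).card + F.card := by exact_mod_cast h2
    linarith
  have hl' : (l.length : ℝ) ≤ 4 * (Fintype.card ι : ℝ) ^ 2 + 1 := by exact_mod_cast hl
  have hθm := mul_pos hθ0 hm
  have hδ2 : δ ^ 2 ≤ 1 := pow_le_one₀ hδ0.le hδ1
  have h5 : δ ^ 2 * (θ / 4) * m ≤ θ * m / 2 := by
    have := mul_le_mul_of_nonneg_right hδ2 hθm.le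
    linarith
  have h6 : δ * (θ / 4) * m ≤ θ * m / 2 := by
    have := mul_le_mul_of_nonneg_right hδ1 hθm.le
    linarith
  obtain ⟨x₁, x₂, l', y₁, y₂, hc, hnd, hx₁, hx₂, hy₁, hy₂, hlen, hlF⟩ :=
    h.exists_sqPath_of_walk (θ := θ / 4) hδ0 hδ1 (by linarith) hε0 (by linarith) hch (F := F)
    (X₁ := (nb G c ∩ nb G d ∩ A p) \ F) (X₂ := (nb G d ∩ A q) \ F)
    (Y₁ := (nb G a ∩ A r) \ F) (Y₂ := (nb G b ∩ nb G a ∩ A t) \ F)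
    (Finset.sdiff_subset.trans Finset.inter_subset_right)
    (Finset.sdiff_subset.trans Finset.inter_subset_right)
    (Finset.sdiff_subset.trans Finset.inter_subset_right)
    (Finset.sdiff_subset.trans Finset.inter_subset_right)
    (h5.trans (hsd _ hp)) (h6.trans (hsd _ hq))
    (fun i _ => by
      have h7 := hsd (A i) (by rw [h.card_eq]; exact mul_le_of_le_one_left hm.le hθ1)
      have h8 : (l.count i : ℝ) ≤ l.length := by exact_mod_cast List.count_le_length
      linarith)
    (by
      have h7 := hsd _ hr
      have h8 : (l.countP (fun i => ¬ Disjoint (A i \ F) ((nb G a ∩ A r) \ F)) : ℝ) ≤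
        l.length := by exact_mod_cast List.countP_le_length
      linarith)
    (by
      have h7 := hsd _ ht
      have h8 : (l.countP (fun i => ¬ Disjoint (A i \ F) ((nb G b ∩ nb G a ∩ A t) \ F)) : ℝ) ≤
        l.length := by exact_mod_cast List.countP_le_length
      linarith)
  simp only [Finset.mem_sdiff, Finset.mem_inter, mem_nb] at hx₁ hx₂ hy₁ hy₂
  refine ⟨_, hc.glue hcd' hab hx₁.1.1.1 hx₁.1.1.2 hx₂.1.1 hy₁.1.1.symm hy₂.1.1.2.symm
    hy₂.1.1.1.symm, hnd, ?_, by simp [hlen]; omega⟩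
  intro v hv
  simp only [List.mem_cons, List.mem_append, List.not_mem_nil, or_false] at hv
  rcases hv with rfl | rfl | hv | rfl | rfl
  · exact hx₁.2
  · exact hx₂.2
  · exact hlF v hv
  · exact hy₁.2
  · exact hy₂.2

end Connect

section Join

variable {V ι : Type} [Fintype V] [Fintype ι] {G : SimpleGraph V} {R : SimpleGraph ι}
  {A : ι → Finset V} {γ ε δ θ : ℝ} {m : ℕ}

lemma IsReducedGraph.exists_join (h : IsReducedGraph G R A γ ε δ m) (hγ : 0 < γ)
    (hδ0 : 0 < δ) (hδ1 : δ ≤ 1) (hθ0 : 0 < θ) (hθ1 : θ ≤ 1) (hε0 : 0 ≤ ε)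
    (hε : 8 * ε < δ ^ 2 * θ) (hK : 16 * (Fintype.card ι : ℝ) ^ 2 + 20 ≤ θ * m)
    {x y : V} (hyx : Linkable G R A γ (θ * m) y x) (hxy : G.Adj x y) {F : Finset V}
    (fs : List (Fin 5 → V)) (hfs : ∀ f ∈ fs, IsGadget G R A γ (θ * m) f)
    (hF : 2 * (F.card + fs.length * (4 * (Fintype.card ι : ℝ) ^ 2 + 5)) ≤ θ * m) :
    ∃ (a b : V) (C : List V), Linkable G R A γ (θ * m) b a ∧ G.Adj a b ∧ C.Nodup ∧
      (∀ v ∈ C, v ∉ F) ∧ C.length ≤ fs.length * (4 * Fintype.card ι ^ 2 + 5) ∧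
      ∀ mid : (Fin 5 → V) → List V,
        (∀ f ∈ fs, SqChain G.Adj (f 0 :: f 1 :: (mid f ++ [f 3, f 4]))) →
        ∃ P : List V, SqChain G.Adj P ∧ (∃ l, P = a :: b :: l) ∧ (∃ l, P = l ++ [x, y]) ∧
          (P : Multiset V) = C + [x, y] +
            (fs.map fun f => (([f 0, f 1, f 3, f 4] : List V) : Multiset V) + mid f).sum := by
  induction fs with
  | nil =>
    refine ⟨x, y, [], hyx, hxy, by simp, by simp, by simp, fun mid _ => ⟨[x, y], ?_, ⟨[], rfl⟩,
      ⟨[], rfl⟩, by simp⟩⟩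
    simp [SqChain, hxy]
  | cons f fs ih =>
    simp only [List.length_cons] at hF
    push_cast at hF
    have hL : (0 : ℝ) ≤ 4 * (Fintype.card ι : ℝ) ^ 2 + 5 := by positivity
    obtain ⟨a, b, C, h1, h2, h3, h4, h5, h6⟩ := ih
      (fun g hg => hfs g (List.mem_cons_of_mem _ hg)) (by linarith)
    have hf := hfs f List.mem_cons_self
    have h34 : G.Adj (f 3) (f 4) := by
      have := hf.1
      simp only [SqChain, List.take, List.mem_cons, List.not_mem_nil, or_false, forall_eq_or_imp,
        forall_eq] at this
      tauto
    have h01 : G.Adj (f 0) (f 1) := hf.1.1 _ (by simp)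
    obtain ⟨l, h7, h8, h9, h10⟩ := h.exists_connector hγ hδ0 hδ1 hθ0 hθ1 hε0 hε hf.2.2.2 h1 h34 h2
      (F := F ∪ C.toFinset) (by
        have h11 := (Finset.card_union_le F C.toFinset).trans
          (Nat.add_le_add_left ((List.toFinset_card_le C).trans h5) _)
        have h12 : ((F ∪ C.toFinset).card : ℝ) ≤
            F.card + fs.length * (4 * (Fintype.card ι : ℝ) ^ 2 + 5) := by exact_mod_cast h11
        linarith) hK
    refine ⟨f 0, f 1, l ++ C, hf.2.2.1, h01, ?_, ?_, ?_, fun mid hmid => ?_⟩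
    · refine List.Nodup.append h8 h3 fun v hv hvC => h9 v hv ?_
      simp [hvC]
    · intro v hv
      rcases List.mem_append.mp hv with hv | hv
      · exact fun hvF => h9 v hv (by simp [hvF])
      · exact h4 v hv
    · rw [List.length_append, List.length_cons, Nat.succ_mul]
      omega
    · obtain ⟨P, hP, ⟨r, rfl⟩, ⟨r', hr'⟩, hPm⟩ :=
        h6 mid fun g hg => hmid g (List.mem_cons_of_mem _ hg)
      refine ⟨f 0 :: f 1 :: (mid f ++ f 3 :: f 4 :: (l ++ a :: b :: r)), ?_, ⟨_, rfl⟩,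
        ⟨f 0 :: f 1 :: (mid f ++ f 3 :: f 4 :: (l ++ r')), by simp [hr']⟩, ?_⟩
      · have h11 : SqChain G.Adj ((f 3 :: f 4 :: l) ++ a :: b :: r) := SqChain.append h7 hP
        exact SqChain.append (l₁ := f 0 :: f 1 :: mid f) (hmid f List.mem_cons_self) h11
      · rw [List.map_cons, List.sum_cons]
        have h11 : ((f 0 :: f 1 :: (mid f ++ f 3 :: f 4 :: (l ++ a :: b :: r)) : List V) :
            Multiset V) = (([f 0, f 1, f 3, f 4] : List V) : Multiset V) + mid f + l +
              ((a :: b :: r : List V) : Multiset V) := by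
          simp only [Multiset.coe_add, Multiset.coe_eq_coe]
          rw [List.perm_iff_count]
          intro v
          simp only [List.count_cons, List.count_append, List.count_nil]
          omega
        rw [h11, hPm, ← Multiset.coe_add]
        abel

theorem IsReducedGraph.exists_frame (h : IsReducedGraph G R A γ ε δ m) (hγ : 0 < γ)
    (hδ0 : 0 < δ) (hδ1 : δ ≤ 1) (hθ0 : 0 < θ) (hθ1 : θ ≤ 1) (hε0 : 0 ≤ ε)
    (hε : 8 * ε < δ ^ 2 * θ) (hK : 16 * (Fintype.card ι : ℝ) ^ 2 + 20 ≤ θ * m)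
    {w z x y : V} (hwz : Linkable G R A γ (θ * m) w z) (hwz' : G.Adj w z)
    (hyx : Linkable G R A γ (θ * m) y x) (hxy : G.Adj x y) {F : Finset V}
    (fs : List (Fin 5 → V)) (hfs : ∀ f ∈ fs, IsGadget G R A γ (θ * m) f)
    (hF : 2 * (F.card + fs.length * (4 * (Fintype.card ι : ℝ) ^ 2 + 5)) ≤ θ * m) :
    ∃ C : List V, C.Nodup ∧ (∀ v ∈ C, v ∉ F) ∧
      C.length ≤ (fs.length + 1) * (4 * Fintype.card ι ^ 2 + 5) ∧
      ∀ mid : (Fin 5 → V) → List V,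
        (∀ f ∈ fs, SqChain G.Adj (f 0 :: f 1 :: (mid f ++ [f 3, f 4]))) →
        ∃ l : List V, SqChain G.Adj (w :: z :: (l ++ [x, y])) ∧
          ((w :: z :: (l ++ [x, y]) : List V) : Multiset V) = C + [w, z, x, y] +
            (fs.map fun f => (([f 0, f 1, f 3, f 4] : List V) : Multiset V) + mid f).sum := by
  obtain ⟨a, b, C, h1, h2, h3, h4, h5, h6⟩ :=
    h.exists_join hγ hδ0 hδ1 hθ0 hθ1 hε0 hε hK hyx hxy fs hfs hF
  obtain ⟨l, h7, h8, h9, h10⟩ := h.exists_connector hγ hδ0 hδ1 hθ0 hθ1 hε0 hε hwz h1 hwz' h2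
    (F := F ∪ C.toFinset) (by
      have h11 := (Finset.card_union_le F C.toFinset).trans
        (Nat.add_le_add_left ((List.toFinset_card_le C).trans h5) _)
      have h12 : ((F ∪ C.toFinset).card : ℝ) ≤
          F.card + fs.length * (4 * (Fintype.card ι : ℝ) ^ 2 + 5) := by exact_mod_cast h11
      linarith) hK
  refine ⟨l ++ C, ?_, ?_, ?_, fun mid hmid => ?_⟩
  · refine List.Nodup.append h8 h3 fun v hv hvC => h9 v hv ?_
    simp [hvC]
  · intro v hv
    rcases List.mem_append.mp hv with hv | hv
    · exact fun hvF => h9 v hv (by simp [hvF])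
    · exact h4 v hv
  · rw [List.length_append, Nat.succ_mul]
    omega
  · obtain ⟨P, hP, ⟨r, rfl⟩, ⟨r', hr'⟩, hPm⟩ := h6 mid hmid
    have h11 : w :: z :: (l ++ r' ++ [x, y]) = (w :: z :: l) ++ a :: b :: r := by
      simp [hr']
    refine ⟨l ++ r', ?_, ?_⟩
    · rw [h11]
      exact SqChain.append h7 hP
    · rw [h11, ← Multiset.coe_add, hPm, ← Multiset.coe_add]
      have h12 : ((w :: z :: l : List V) : Multiset V) + [x, y] = l + [w, z, x, y] := by
        simp only [Multiset.coe_add, Multiset.coe_eq_coe]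
        rw [List.perm_iff_count]
        intro v
        simp only [List.count_cons, List.count_append, List.count_nil]
        omega
      rw [add_comm (C : Multiset V) ([x, y] : List V), ← add_assoc, ← add_assoc, h12]
      abel

end Join

section FamVerts

variable {V : Type}

lemma union_val_of_disjoint {s t : Finset V} (h : Disjoint s t) : (s ∪ t).val = s.val + t.val := by
  rw [← Finset.disjUnion_eq_union s t h]
  rfl

lemma toFinset_val_of_nodup {l : List V} (h : l.Nodup) : l.toFinset.val = (l : Multiset V) := by
  rw [List.toFinset_val, List.dedup_eq_self.mpr h]

lemma sum_eq_famVerts {Fam : Finset (Fin 5 → V)} (h : DisjointFam Fam)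
    (hnd : ∀ f ∈ Fam, [f 0, f 1, f 2, f 3, f 4].Nodup) :
    ∑ f ∈ Fam, (([f 0, f 1, f 2, f 3, f 4] : List V) : Multiset V) = (famVerts Fam).val := by
  induction Fam using Finset.induction_on with
  | empty => rfl
  | insert f Fam hf ih =>
    have h1 : famVerts (insert f Fam) = [f 0, f 1, f 2, f 3, f 4].toFinset ∪ famVerts Fam := by
      ext v
      simp [mem_famVerts, Fin.exists_fin_succ, eq_comm, or_assoc]
    have h2 : Disjoint [f 0, f 1, f 2, f 3, f 4].toFinset (famVerts Fam) := by
      rw [Finset.disjoint_left]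
      intro v hv hv'
      obtain ⟨g, hg, j, rfl⟩ := mem_famVerts.mp hv'
      have hne : f ≠ g := fun h => hf (h ▸ hg)
      have h3 := fun i => h f (Finset.mem_insert_self _ _) g (Finset.mem_insert_of_mem hg) hne i j
      simp only [List.mem_toFinset, List.mem_cons, List.not_mem_nil, or_false] at hv
      rcases hv with hv | hv | hv | hv | hv <;> exact h3 _ hv.symm
    rw [Finset.sum_insert hf, h1, union_val_of_disjoint h2,
      toFinset_val_of_nodup (hnd f (Finset.mem_insert_self _ _)), ih]
    · exact fun a ha b hb => h a (Finset.mem_insert_of_mem ha) b (Finset.mem_insert_of_mem hb)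
    · exact fun g hg => hnd g (Finset.mem_insert_of_mem hg)

end FamVerts

section Absorbing

variable {V ι : Type} [Fintype V] [Fintype ι] {G : SimpleGraph V} {R : SimpleGraph ι}
  {A : ι → Finset V} {γ ε δ θ : ℝ} {m : ℕ}

lemma PosaDegree.exists_high_pair (hG : PosaDegree G γ) (hγ : 0 ≤ γ) [Nonempty V] {F : Finset V}
    (hF : 4 * (F.card : ℝ) ≤ Fintype.card V) :
    ∃ a b, a ∉ F ∧ b ∉ F ∧ G.Adj a b ∧ High G γ a ∧ High G γ b := by
  have hn : (0 : ℝ) < Fintype.card V := by exact_mod_cast Fintype.card_pos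
  have hsd : ∀ S : Finset V, 2 * (Fintype.card V : ℝ) / 3 ≤ S.card →
      (Fintype.card V : ℝ) / 3 < ((S \ F).card : ℝ) := by
    intro S hS
    have h1 := Finset.le_card_sdiff F S
    have h2 : S.card ≤ (S \ F).card + F.card := by omega
    have h3 : (S.card : ℝ) ≤ (S \ F).card + F.card := by exact_mod_cast h2
    linarith
  obtain ⟨a, ha, haH⟩ := hG.exists_high (hsd Finset.univ (by rw [Finset.card_univ]; linarith))
  obtain ⟨b, hb, hbH⟩ := hG.exists_high (hsd (nb G a) (by
    have := haH
    unfold High at this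
    have := mul_nonneg hγ hn.le
    linarith))
  simp only [Finset.mem_sdiff, mem_nb] at ha hb
  exact ⟨a, b, ha.2, hb.2, hb.1, haH, hbH⟩

lemma IsReducedGraph.linkable_of_high (h : IsReducedGraph G R A γ ε δ m) (hγ : 0 < γ)
    (hθ : 0 ≤ θ) (hθε : θ + ε < γ) {a b : V} (ha : High G (2 * γ) a) (hb : High G (2 * γ) b) :
    Linkable G R A γ (θ * m) a b := by
  have h1 := card_inter_ge (nb G a) (nb G b)
  unfold High at ha hb
  obtain ⟨p, q, hpq, h2, h3⟩ := h.exists_mainDart (c := 1 / 3 + γ) (S := nb G a ∩ nb G b) hγ hθ (by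
    have := mul_nonneg hγ.le (Nat.cast_nonneg (α := ℝ) (Fintype.card V))
    linarith) (by linarith)
  exact ⟨p, q, hpq, h2, h3.trans (Nat.cast_le.mpr (Finset.card_le_card
    (Finset.inter_subset_inter_right Finset.inter_subset_right)))⟩

end Absorbing

/-- The square path from the pair `(a, b)` to the pair `(c, d)` on the vertex set `W` can take up
any set of at most `t` further vertices. -/
def IsAbsorber {V : Type} (G : SimpleGraph V) (a b c d : V) (W : Finset V) (t : ℝ) : Prop :=
  ∀ U : Finset V, Disjoint U W → (U.card : ℝ) ≤ t →
    ∃ l : List V, SqChain G.Adj (a :: b :: (l ++ [c, d])) ∧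
      ((a :: b :: (l ++ [c, d]) : List V) : Multiset V) = (W ∪ U).val

section Absorbing

variable {V ι : Type} [Fintype V] [Fintype ι] {G : SimpleGraph V} {R : SimpleGraph ι}
  {A : ι → Finset V} {γ ε δ θ : ℝ} {m : ℕ}

theorem IsReducedGraph.exists_absorber (h : IsReducedGraph G R A γ ε δ m) (hγ : 0 < γ)
    (hG : PosaDegree G (2 * γ)) (hδ0 : 0 < δ) (hδ1 : δ ≤ 1) (hθ0 : 0 < θ) (hθ1 : 4 * θ ≤ 1)
    (hθδ : 2 * θ ≤ δ) (hθε : 2 * θ + ε ≤ γ) (hε0 : 0 ≤ ε) (hε : 8 * ε < δ ^ 2 * (δ ^ 2 * θ))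
    (hεγ : 4 * ε ≤ γ) (hK : 16 * (Fintype.card ι : ℝ) ^ 2 + 20 ≤ δ ^ 2 * θ * m) {c : ℝ}
    (hc0 : 0 < c) (hc : c * (Fintype.card V : ℝ) ^ 5 ≤ ((δ ^ 2 * θ - 2 * ε) * m) ^ 5) {N H : ℕ}
    (hN : 12 ≤ c * N) (hH : Fintype.card V ≤ 2 ^ H)
    (hNH : 50 * ((N : ℝ) * H) ≤ c * Fintype.card V)
    (hNH' : 2 * (5 * ((N : ℝ) * H) + 4 + N * H * (4 * (Fintype.card ι : ℝ) ^ 2 + 5)) ≤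
      δ ^ 2 * θ * m) :
    ∃ (a b x y : V) (W : Finset V),
      (W.card : ℝ) ≤ δ ^ 2 * θ * m ∧ {a, b, x, y} ⊆ W ∧ G.Adj a b ∧ G.Adj x y ∧
      High G (2 * γ) a ∧ High G (2 * γ) b ∧ High G (2 * γ) x ∧ High G (2 * γ) y ∧
      IsAbsorber G a b x y W (H / (Fintype.card ι + 1)) := by
  have hm : (0 : ℝ) < m := by exact_mod_cast h.size_pos
  have hK1 : (1 : ℝ) ≤ Fintype.card ι := by exact_mod_cast h.card_index_pos
  have hmn : (m : ℝ) ≤ Fintype.card V :=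
    (le_mul_of_one_le_left hm.le hK1).trans h.card_mul_le
  have hδ2 : δ ^ 2 ≤ 1 := pow_le_one₀ hδ0.le hδ1
  have hδθ : δ ^ 2 * θ ≤ θ := mul_le_of_le_one_left hθ0.le hδ2
  have hδθm : δ ^ 2 * θ * m ≤ θ * m := mul_le_mul_of_nonneg_right hδθ hm.le
  have hδδ : δ ^ 2 * (δ ^ 2 * θ) ≤ δ ^ 2 * θ := mul_le_of_le_one_left (by positivity) hδ2
  have hδθ0 : 0 < δ ^ 2 * θ := by positivity
  have hn : 0 < Fintype.card V := by exact_mod_cast hm.trans_le hmn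
  have : Nonempty V := Fintype.card_pos_iff.mp hn
  have hsq : (0 : ℝ) ≤ (Fintype.card ι : ℝ) ^ 2 := by positivity
  have hNH0 : (0 : ℝ) ≤ N * H := by positivity
  have hNHL : 0 ≤ (N : ℝ) * H * (4 * (Fintype.card ι : ℝ) ^ 2 + 5) := by positivity
  set lev : V → ℕ := fun w => (richIndex A (nb G w) (2 * θ * m)).card with hlev
  obtain ⟨Fam, hF1, hF2, hF3, hF4⟩ := exists_family hc0
    (fun v => hc.trans (h.card_absorbers hγ hG hδ0 hδ1 hθ0.le hθ1 hθδ hθε (by linarith) hε0 hεγ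
      (by linarith) v)) hN hH hNH
  have hgad : ∀ f ∈ Fam, IsGadget G R A γ (δ ^ 2 * θ * m) f := by
    intro f hf
    obtain ⟨v, hv⟩ := hF3 f hf
    rw [Finset.mem_filter] at hv
    exact hv.2.1
  have hFam : (Fam.card : ℝ) ≤ N * H := by exact_mod_cast hF1
  have hfv : ((famVerts Fam).card : ℝ) ≤ 5 * (N * H) := by
    have : ((famVerts Fam).card : ℝ) ≤ Fam.card * 5 := by exact_mod_cast card_famVerts Fam
    linarith
  have hsmall : δ ^ 2 * θ * m ≤ Fintype.card V / 4 := by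
    have : 4 * θ * m ≤ m := mul_le_of_le_one_left hm.le hθ1
    linarith
  obtain ⟨a, b, ha, hb, hab, haH, hbH⟩ := hG.exists_high_pair (by linarith) (F := famVerts Fam)
    (by linarith)
  obtain ⟨x, y, hx, hy, hxy, hxH, hyH⟩ := hG.exists_high_pair (by linarith)
    (F := famVerts Fam ∪ {a, b}) (by
      have h1 : ((famVerts Fam ∪ {a, b}).card : ℝ) ≤ (famVerts Fam).card + 2 := by
        exact_mod_cast (Finset.card_union_le _ _).trans (Nat.add_le_add_left Finset.card_le_two _)
      linarith)
  simp only [Finset.mem_union, Finset.mem_insert, Finset.mem_singleton, not_or] at hx hy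
  have hend : [a, b, x, y].Nodup := by
    simp [hab.ne, hxy.ne, Ne.symm hx.2.1, Ne.symm hx.2.2, Ne.symm hy.2.1, Ne.symm hy.2.2]
  set F := famVerts Fam ∪ [a, b, x, y].toFinset with hF
  have hFd : Disjoint (famVerts Fam) [a, b, x, y].toFinset := by
    rw [Finset.disjoint_left]
    intro v hv hv'
    simp only [List.mem_toFinset, List.mem_cons, List.not_mem_nil, or_false] at hv'
    rcases hv' with rfl | rfl | rfl | rfl
    · exact ha hv
    · exact hb hv
    · exact hx.1 hv
    · exact hy.1 hv
  have hFc : (F.card : ℝ) ≤ (famVerts Fam).card + 4 := by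
    exact_mod_cast (Finset.card_union_le _ _).trans
      (Nat.add_le_add_left (List.toFinset_card_le _) _)
  have hFamL : (Fam.card : ℝ) * (4 * (Fintype.card ι : ℝ) ^ 2 + 5) ≤
      N * H * (4 * (Fintype.card ι : ℝ) ^ 2 + 5) :=
    mul_le_mul_of_nonneg_right hFam (by positivity)
  have hlink : ∀ {u w : V}, High G (2 * γ) u → High G (2 * γ) w →
      Linkable G R A γ (δ ^ 2 * θ * m) u w :=
    fun hu hw => h.linkable_of_high hγ hδθ0.le (by linarith) hu hw
  obtain ⟨C, hC1, hC2, hC3, hC4⟩ := h.exists_frame hγ hδ0 hδ1 hδθ0 (by linarith) hε0 hε hK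
    (hlink haH hbH) hab (hlink hyH hxH) hxy (F := F) Fam.toList
    (fun f hf => hgad f (Finset.mem_toList.mp hf)) (by
      rw [Finset.length_toList]
      linarith)
  have hCd : Disjoint F C.toFinset := by
    rw [Finset.disjoint_left]
    exact fun v hv hv' => hC2 v (List.mem_toFinset.mp hv') hv
  refine ⟨a, b, x, y, F ∪ C.toFinset, ?_, ?_, hab, hxy, haH, hbH, hxH, hyH, ?_⟩
  · rw [Finset.length_toList] at hC3
    have h1 : ((F ∪ C.toFinset).card : ℝ) ≤
        F.card + (Fam.card + 1) * (4 * (Fintype.card ι : ℝ) ^ 2 + 5) := by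
      exact_mod_cast (Finset.card_union_le _ _).trans
        (Nat.add_le_add_left ((List.toFinset_card_le C).trans hC3) _)
    linarith
  · intro v hv
    rw [Finset.mem_union, hF, Finset.mem_union]
    exact Or.inl (Or.inr (by simpa using hv))
  · intro U hU hUc
    have hmid : ValidMid G Fam Fam fun f => [f 2] :=
      ⟨subset_rfl, fun _ _ => rfl, fun f hf => (hgad f hf).1⟩
    obtain ⟨F', mid', h1, h2⟩ := hmid.absorb (lev := lev) (K := Fintype.card ι)
      (fun v => Finset.card_le_univ _) U (fun w => by
        refine le_trans ?_ ((hF4 w).trans (Finset.card_le_card fun f hf => ?_))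
        · rw [le_div_iff₀ (by positivity)] at hUc
          exact_mod_cast hUc
        · rw [Finset.mem_inter, Finset.mem_filter] at hf
          exact Finset.mem_filter.mpr ⟨hf.2, hf.1.2.2⟩)
    obtain ⟨l, h3, h4⟩ := hC4 mid' fun f hf => h1.2.2 f (Finset.mem_toList.mp hf)
    refine ⟨l, h3, ?_⟩
    rw [h4, union_val_of_disjoint hU.symm, union_val_of_disjoint hCd, hF,
      union_val_of_disjoint hFd, toFinset_val_of_nodup hC1, toFinset_val_of_nodup hend,
      ← sum_eq_famVerts hF2 fun f hf => (hgad f hf).2.1, Finset.sum_map_toList,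
      Finset.sum_add_distrib, h2]
    have h5 : ∑ f ∈ Fam, (([f 0, f 1, f 2, f 3, f 4] : List V) : Multiset V) =
        ∑ f ∈ Fam, (([f 0, f 1, f 3, f 4] : List V) : Multiset V) +
          ∑ f ∈ Fam, (([f 2] : List V) : Multiset V) := by
      rw [← Finset.sum_add_distrib]
      refine Finset.sum_congr rfl fun f _ => ?_
      simp only [Multiset.coe_add, Multiset.coe_eq_coe]
      rw [List.perm_iff_count]
      intro v
      simp only [List.count_cons, List.count_append, List.count_nil]
      omega
    rw [h5]
    abel

end Absorbing

lemma IsAbsorber.mono {V : Type} {G : SimpleGraph V} {a b c d : V} {W : Finset V} {s t : ℝ}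
    (h : IsAbsorber G a b c d W t) (hst : s ≤ t) : IsAbsorber G a b c d W s :=
  fun U hU hUc => h U hU (hUc.trans hst)

lemma sq_le_four_mul_two_pow (H : ℕ) : H ^ 2 ≤ 4 * 2 ^ H := by
  have h1 : H / 2 + 1 ≤ 2 ^ (H / 2) := Nat.lt_two_pow_self
  have h2 : (2 : ℕ) ^ (2 * (H / 2)) ≤ 2 ^ H := Nat.pow_le_pow_right (by norm_num) (by omega)
  have h3 : H ≤ 2 * (H / 2 + 1) := by omega
  calc H ^ 2 ≤ (2 * (H / 2 + 1)) ^ 2 := Nat.pow_le_pow_left h3 2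
    _ = 4 * (H / 2 + 1) ^ 2 := by ring
    _ ≤ 4 * (2 ^ (H / 2)) ^ 2 := by gcongr
    _ = 4 * 2 ^ (2 * (H / 2)) := by rw [mul_comm 2 (H / 2), pow_mul]
    _ ≤ _ := by gcongr

lemma le_two_pow_floor {κ : ℝ} {n : ℕ} (h1 : 2 ≤ κ * n) (h2 : 16 ≤ κ ^ 2 * n) :
    n ≤ 2 ^ ⌊κ * n⌋₊ := by
  have h3 := Nat.lt_floor_add_one (κ * n)
  have h4 : κ * n / 2 ≤ ⌊κ * n⌋₊ := by linarith
  have h5 : (κ * n / 2) ^ 2 ≤ (⌊κ * n⌋₊ : ℝ) ^ 2 := pow_le_pow_left₀ (by linarith) h4 2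
  have h6 : (⌊κ * n⌋₊ : ℝ) ^ 2 ≤ 4 * 2 ^ ⌊κ * n⌋₊ := by
    exact_mod_cast sq_le_four_mul_two_pow ⌊κ * n⌋₊
  have h7 : 16 * (n : ℝ) ≤ κ ^ 2 * n * n := mul_le_mul_of_nonneg_right h2 (Nat.cast_nonneg n)
  have h8 : (n : ℝ) ≤ 2 ^ ⌊κ * n⌋₊ := by
    have : (κ * n / 2) ^ 2 = κ ^ 2 * n * n / 4 := by ring
    linarith
  exact_mod_cast h8

theorem exists_absorber {γ : ℝ} (hγ : 0 < γ) (hγ1 : γ ≤ 1) :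
    ∃ μ > 0, ∃ n₀ : ℕ, ∀ (V : Type) [Fintype V] (G : SimpleGraph V), PosaDegree G γ →
      n₀ ≤ Fintype.card V → ∃ (a b x y : V) (W : Finset V),
        (W.card : ℝ) ≤ γ / 2 * Fintype.card V ∧ {a, b, x, y} ⊆ W ∧ G.Adj a b ∧ G.Adj x y ∧
        (1 / 3 + 2 * γ) * Fintype.card V ≤ (nb G a ∩ nb G b).card ∧
        (1 / 3 + 2 * γ) * Fintype.card V ≤ (nb G x ∩ nb G y).card ∧
        IsAbsorber G a b x y W (μ * Fintype.card V) := by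
  set δ : ℝ := γ ^ 2 / 200 with hδ
  have hγ2 : γ ^ 2 ≤ γ := by rw [pow_two]; exact mul_le_of_le_one_left hγ.le hγ1
  have hδ0 : 0 < δ := by positivity
  have hδγ : δ ≤ γ / 200 := by linarith
  have hδ1 : δ ≤ 1 := by linarith
  set P : ℝ := δ ^ 2 * (δ / 4) with hP
  have hP0 : 0 < P := by positivity
  have hδ2 : δ ^ 2 ≤ 1 := pow_le_one₀ hδ0.le hδ1
  have hPδ : P ≤ δ / 4 := mul_le_of_le_one_left (by linarith) hδ2
  set ε : ℝ := δ ^ 2 * P / 16 with hεd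
  have hε0 : 0 < ε := by positivity
  have hεP : ε ≤ P / 16 := by
    have := mul_le_of_le_one_left hP0.le hδ2
    linarith
  obtain ⟨M₀, n₁, hM⟩ := exists_isReducedGraph hγ hγ1 hε0
  set M : ℝ := (M₀ : ℝ) + 1 with hMd
  have hM1 : 1 ≤ M := by
    have : (0 : ℝ) ≤ M₀ := Nat.cast_nonneg _
    linarith
  have hM0 : 0 < M := by linarith
  set c : ℝ := ((P - 2 * ε) / (2 * M)) ^ 5 with hcd
  have hPε : 0 < P - 2 * ε := by linarith
  have hc0 : 0 < c := by positivity
  obtain ⟨N, hN⟩ := exists_nat_ge (12 / c)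
  have hN' : 12 ≤ c * N := by rwa [div_le_iff₀ hc0, mul_comm] at hN
  have hN0 : (0 : ℝ) < N := (by positivity : 0 < 12 / c).trans_le hN
  set L : ℝ := 4 * M ^ 2 + 5 with hL
  have hL0 : 0 < L := by positivity
  set κ : ℝ := min (c / (50 * N)) (P / (8 * M * (N * (5 + L)))) with hκ
  have hκ0 : 0 < κ := lt_min (by positivity) (by positivity)
  have hκ1 : 50 * (N * κ) ≤ c := by
    have := min_le_left (c / (50 * N)) (P / (8 * M * (N * (5 + L))))
    rw [← hκ, le_div_iff₀ (by positivity)] at this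
    linarith
  have hκ2 : 8 * M * (N * (5 + L)) * κ ≤ P := by
    have := min_le_right (c / (50 * N)) (P / (8 * M * (N * (5 + L))))
    rw [← hκ, le_div_iff₀ (by positivity)] at this
    linarith
  obtain ⟨n₂, hn₂⟩ := exists_nat_ge ((16 * M ^ 2 + 20) * (2 * M) / P + 2 / κ + 16 / κ ^ 2)
  refine ⟨κ / (2 * M), by positivity, max n₁ n₂, fun V _ G hG hn => ?_⟩
  obtain ⟨ι, _, R, A, m, hιM, h⟩ := hM V G hG (le_of_max_le_left hn)
  replace h : IsReducedGraph G R A (γ / 2) ε δ m := h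
  set n := Fintype.card V with hnd
  have hnn : ((16 * M ^ 2 + 20) * (2 * M) / P + 2 / κ + 16 / κ ^ 2) ≤ (n : ℝ) :=
    hn₂.trans (by exact_mod_cast le_of_max_le_right hn)
  have e1 : 0 ≤ (16 * M ^ 2 + 20) * (2 * M) / P := by positivity
  have e2 : 0 ≤ 2 / κ := by positivity
  have e3 : 0 ≤ 16 / κ ^ 2 := by positivity
  have h1 : (16 * M ^ 2 + 20) * (2 * M) ≤ P * n := by
    have : (16 * M ^ 2 + 20) * (2 * M) / P ≤ n := by linarith
    rwa [div_le_iff₀ hP0, mul_comm (n : ℝ)] at this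
  have h2 : 2 ≤ κ * n := by
    have : 2 / κ ≤ n := by linarith
    rwa [div_le_iff₀ hκ0, mul_comm (n : ℝ)] at this
  have h3 : 16 ≤ κ ^ 2 * n := by
    have : 16 / κ ^ 2 ≤ n := by linarith
    rwa [div_le_iff₀ (by positivity), mul_comm (n : ℝ)] at this
  have hn0 : (0 : ℝ) ≤ n := Nat.cast_nonneg n
  have hm : (n : ℝ) / (2 * M) ≤ m := by
    refine h.le_size (M := M₀ + 1) (by linarith) (by positivity) (by omega) ?_
    push_cast
    rw [← hMd, ← hnd]
    exact (mul_div_cancel₀ _ (by positivity)).le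
  have hmn : (m : ℝ) ≤ n := by
    refine le_trans (le_mul_of_one_le_left (Nat.cast_nonneg m) ?_) h.card_mul_le
    exact_mod_cast h.card_index_pos
  have hPm : P * n / (2 * M) ≤ P * m := by
    rw [mul_div_assoc]
    exact mul_le_mul_of_nonneg_left hm hP0.le
  have h4 : 16 * M ^ 2 + 20 ≤ P * n / (2 * M) := by
    rwa [le_div_iff₀ (by positivity)]
  have hιM' : (Fintype.card ι : ℝ) ≤ M := by
    have : (Fintype.card ι : ℝ) ≤ M₀ := by exact_mod_cast hιM
    linarith
  have hιM2 : (Fintype.card ι : ℝ) ^ 2 ≤ M ^ 2 := pow_le_pow_left₀ (Nat.cast_nonneg _) hιM' 2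
  set H := ⌊κ * n⌋₊ with hHd
  have hH1 : (H : ℝ) ≤ κ * n := Nat.floor_le (by positivity)
  have hH2 : κ * n / 2 ≤ H := by
    have := Nat.lt_floor_add_one (κ * n)
    linarith
  have hNH : (N : ℝ) * H ≤ N * (κ * n) := mul_le_mul_of_nonneg_left hH1 hN0.le
  obtain ⟨a, b, x, y, W, hW, hW', hab, hxy, ha, hb, hx, hy, habs⟩ :=
    h.exists_absorber (θ := δ / 4) (c := c) (N := N) (H := H) (by positivity)
      (by rwa [mul_div_cancel₀ γ two_ne_zero]) hδ0 hδ1 (by linarith) (by linarith) (by linarith)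
      (by linarith) hε0.le (by rw [← hP, hεd]; have : 0 < δ ^ 2 * P := by positivity
                               linarith) (by linarith) (by rw [← hP]; linarith) hc0
      (by
        rw [hcd, ← mul_pow, ← hP, ← hnd]
        refine pow_le_pow_left₀ (by positivity) ?_ 5
        rw [div_mul_eq_mul_div, mul_div_assoc]
        exact mul_le_mul_of_nonneg_left hm hPε.le)
      hN' (le_two_pow_floor h2 h3)
      (by
        have := mul_le_mul_of_nonneg_right hκ1 hn0
        rw [← hnd]
        linarith)
      (by
        rw [← hP]
        have e4 : (N : ℝ) * H * (4 * (Fintype.card ι : ℝ) ^ 2 + 5) ≤ N * (κ * n) * L := by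
          gcongr
          linarith
        have e5 : 2 * (N * (5 + L)) * κ * n ≤ P * n / (4 * M) := by
          rw [le_div_iff₀ (by positivity)]
          have := mul_le_mul_of_nonneg_right hκ2 hn0
          linarith
        have e6 : P * n / (4 * M) = P * n / (2 * M) / 2 := by
          rw [div_div]; ring_nf
        have e7 : 0 ≤ M ^ 2 := by positivity
        linarith)
  have hcommon : ∀ {u w : V}, High G (2 * (γ / 2)) u → High G (2 * (γ / 2)) w →
      (1 / 3 + 2 * γ) * n ≤ (nb G u ∩ nb G w).card := by
    intro u w hu hw
    have := card_inter_ge (nb G u) (nb G w)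
    unfold High at hu hw
    rw [← hnd] at *
    linarith
  refine ⟨a, b, x, y, W, hW.trans ?_, hW', hab, hxy, hcommon ha hb, hcommon hx hy, habs.mono ?_⟩
  · rw [← hP]
    have e4 : P * m ≤ γ / 2 * m := mul_le_mul_of_nonneg_right (by linarith) (Nat.cast_nonneg m)
    exact e4.trans (mul_le_mul_of_nonneg_left hmn (by positivity))
  · rw [div_mul_eq_mul_div, div_le_div_iff₀ (by positivity) (by positivity)]
    have hι1 : (Fintype.card ι : ℝ) + 1 ≤ M := by
      have : (Fintype.card ι : ℝ) ≤ M₀ := by exact_mod_cast hιM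
      linarith
    calc κ * n * (Fintype.card ι + 1) ≤ κ * n * M := by gcongr
      _ ≤ 2 * H * M := mul_le_mul_of_nonneg_right (by linarith) hM0.le
      _ = _ := by ring

section Map

variable {V V' : Type}

lemma SqChain.map {r : V → V → Prop} {r' : V' → V' → Prop} {f : V' → V}
    (hf : ∀ x y, r' x y → r (f x) (f y)) {l : List V'} (h : SqChain r' l) :
    SqChain r (l.map f) := by
  induction l with
  | nil => trivial
  | cons a l ih =>
    refine ⟨fun x hx => ?_, ih h.2⟩
    rw [← List.map_take, List.mem_map] at hx
    obtain ⟨y, hy, rfl⟩ := hx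
    exact hf _ _ (h.1 y hy)

lemma SqChain.getElem {r : V → V → Prop} {l : List V} (h : SqChain r l) {i : ℕ} :
    (∀ hi : i + 1 < l.length, r l[i] l[i + 1]) ∧ ∀ hi : i + 2 < l.length, r l[i] l[i + 2] := by
  induction l generalizing i with
  | nil => simp
  | cons a l ih =>
    cases i with
    | zero =>
      refine ⟨fun hi => h.1 _ ?_, fun hi => h.1 _ ?_⟩
      · simp only [List.length_cons] at hi
        exact List.mem_take_iff_getElem.mpr ⟨0, by omega, rfl⟩
      · simp only [List.length_cons] at hi
        exact List.mem_take_iff_getElem.mpr ⟨1, by omega, rfl⟩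
    | succ i =>
      obtain ⟨h1, h2⟩ := ih h.2 (i := i)
      refine ⟨fun hi => ?_, fun hi => ?_⟩
      · simp only [List.length_cons] at hi
        exact h1 (by omega)
      · simp only [List.length_cons] at hi
        exact h2 (by omega)

end Map

section Cycle

variable {V : Type} [Fintype V] {G : SimpleGraph V} {γ : ℝ}

lemma PosaDegree.comap_compl (h : PosaDegree G γ) (hγ : 0 ≤ γ) {W : Finset V}
    (hW : (W.card : ℝ) ≤ γ / 2 * Fintype.card V) :
    PosaDegree (G.comap (Subtype.val : {v // v ∉ W} → V)) (γ / 2) := by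
  have hc : (Fintype.card {v // v ∉ W} : ℝ) + W.card = Fintype.card V := by
    have h1 := Fintype.card_subtype_compl (fun v => v ∈ W)
    rw [Fintype.card_coe] at h1
    have h2 := Finset.card_le_univ W
    have h3 : Fintype.card {v // v ∉ W} + W.card = Fintype.card V := by omega
    exact_mod_cast h3
  have hw0 : (0 : ℝ) ≤ W.card := Nat.cast_nonneg _
  intro s hs0 hs1
  refine le_trans ?_ (h s hs0 (by linarith))
  rw [Nat.cast_le, ← Finset.card_map (Function.Embedding.subtype _)]
  refine Finset.card_le_card fun v hv => ?_
  simp only [Finset.mem_map, Finset.mem_filter, Finset.mem_univ, true_and] at hv ⊢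
  obtain ⟨w, hw, rfl⟩ := hv
  have h1 : (nb G w).card ≤ (nb (G.comap (Subtype.val : {v // v ∉ W} → V)) w).card + W.card := by
    rw [← Finset.card_map (Function.Embedding.subtype _)]
    refine (Finset.card_le_card fun x hx => ?_).trans (Finset.card_union_le _ _)
    rw [mem_nb] at hx
    by_cases hxW : x ∈ W
    · exact Finset.mem_union_right _ hxW
    · refine Finset.mem_union_left _ (Finset.mem_map.mpr ⟨⟨x, hxW⟩, ?_, rfl⟩)
      simpa using hx
  have h2 : ((nb G w).card : ℝ) ≤
      (nb (G.comap (Subtype.val : {v // v ∉ W} → V)) w).card + W.card := by exact_mod_cast h1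
  have h3 : 0 ≤ γ * W.card := mul_nonneg hγ hw0
  have h4 : (Fintype.card {v // v ∉ W} : ℝ) = Fintype.card V - W.card := by linarith
  rw [h4] at hw
  change ((nb G w).card : ℝ) < _
  linarith

theorem exists_cycle {γ : ℝ} (hγ : 0 < γ) (hγ1 : γ ≤ 1) :
    ∃ n₀ : ℕ, ∀ (V : Type) [Fintype V] (G : SimpleGraph V), PosaDegree G γ →
      n₀ ≤ Fintype.card V → ∃ (a b : V) (l : List V), SqChain G.Adj (a :: b :: (l ++ [a, b])) ∧
        (a :: b :: l).Nodup ∧ (a :: b :: l).length = Fintype.card V := by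
  obtain ⟨μ, hμ, n₁, h1⟩ := exists_absorber hγ hγ1
  obtain ⟨n₂, h2⟩ := exists_almost_spanning (γ := γ / 2) (half_pos hγ) (by linarith) hμ
  refine ⟨max n₁ (2 * n₂), fun V _ G hG hn => ?_⟩
  obtain ⟨a, b, x, y, W, hW, habxy, hab, hxy, hab2, hxy2, habs⟩ := h1 V G hG (le_of_max_le_left hn)
  have hc : (Fintype.card {v // v ∉ W} : ℝ) + W.card = Fintype.card V := by
    have h1 := Fintype.card_subtype_compl (fun v => v ∈ W)
    rw [Fintype.card_coe] at h1
    have h2 := Finset.card_le_univ W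
    have h3 : Fintype.card {v // v ∉ W} + W.card = Fintype.card V := by omega
    exact_mod_cast h3
  have hn0 : (0 : ℝ) ≤ Fintype.card V := Nat.cast_nonneg _
  have hw0 : (0 : ℝ) ≤ W.card := Nat.cast_nonneg _
  have hγn : γ / 2 * Fintype.card V ≤ 1 / 2 * Fintype.card V :=
    mul_le_mul_of_nonneg_right (by linarith) hn0
  have hS : ∀ S : Finset V, (1 / 3 + 2 * γ) * Fintype.card V ≤ S.card →
      (1 / 3 + γ / 2) * Fintype.card {v // v ∉ W} ≤ (S.subtype fun v => v ∉ W).card := by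
    intro S hS
    rw [Finset.card_subtype, Finset.filter_notMem_eq_sdiff]
    have h3 := Finset.le_card_sdiff W S
    have h4 : S.card ≤ (S \ W).card + W.card := by omega
    have h5 : (S.card : ℝ) ≤ (S \ W).card + W.card := by exact_mod_cast h4
    have h6 : 0 ≤ γ * W.card := mul_nonneg hγ.le hw0
    have h7 : 0 ≤ γ * Fintype.card V := mul_nonneg hγ.le hn0
    have h8 : (Fintype.card {v // v ∉ W} : ℝ) = Fintype.card V - W.card := by linarith
    rw [h8]
    linarith
  obtain ⟨x₁, x₂, q, y₁, y₂, h3, h4, h5, h6, h7, h8, h9⟩ := h2 {v // v ∉ W}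
    (G.comap Subtype.val) (hG.comap_compl hγ.le hW) (by
      have h3 : (2 * n₂ : ℝ) ≤ Fintype.card V := by exact_mod_cast le_of_max_le_right hn
      have h4 : (n₂ : ℝ) ≤ Fintype.card {v // v ∉ W} := by linarith
      exact_mod_cast h4) _ _ (hS _ hxy2) (hS _ hab2)
  simp only [Finset.mem_subtype, Finset.mem_inter, mem_nb] at h5 h6 h7 h8
  have h10 : SqChain G.Adj ((x₁ :: x₂ :: (q ++ [y₁, y₂])).map Subtype.val) :=
    h3.map (f := Subtype.val) fun _ _ h => h
  simp only [List.map_cons, List.map_append, List.map_nil] at h10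
  have h11 := h10.glue hxy hab h5.1 h5.2 h6.2 h7.1.symm h8.1.symm h8.2.symm
  set Q : List V := (x₁ :: x₂ :: (q ++ [y₁, y₂])).map Subtype.val with hQ
  have hQnd : Q.Nodup := h4.map Subtype.val_injective
  have hQW : Disjoint W Q.toFinset := by
    rw [Finset.disjoint_left]
    intro v hv hv'
    rw [List.mem_toFinset, hQ, List.mem_map] at hv'
    obtain ⟨w, -, rfl⟩ := hv'
    exact w.2 hv
  have hQlen : (1 - μ) * Fintype.card {v // v ∉ W} ≤ Q.length := by
    rw [hQ, List.length_map]; exact h9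
  set U : Finset V := (W ∪ Q.toFinset)ᶜ with hU
  have hUc : U.card + (W.card + Q.length) = Fintype.card V := by
    rw [hU, ← List.toFinset_card_of_nodup hQnd, ← Finset.card_union_of_disjoint hQW,
      Finset.card_compl_add_card]
  obtain ⟨l, h12, h13⟩ := habs U (by
    rw [hU]
    exact (disjoint_compl_left).mono_right Finset.subset_union_left) (by
    have h14 : (U.card : ℝ) + (W.card + Q.length) = Fintype.card V := by exact_mod_cast hUc
    have h15 : 0 ≤ μ * W.card := mul_nonneg hμ.le hw0
    have h16 : (Fintype.card {v // v ∉ W} : ℝ) = Fintype.card V - W.card := by linarith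
    rw [h16] at hQlen
    linarith)
  refine ⟨a, b, l ++ [x, y] ++ Q, ?_, ?_, ?_⟩
  · have h14 := SqChain.append (l₁ := a :: b :: l) (a := x) (b := y) h12 h11
    simpa [hQ] using h14
  · have h14 : (a :: b :: (l ++ [x, y])).Nodup := by
      rw [← Multiset.coe_nodup, h13]
      exact Finset.nodup _
    refine List.Nodup.append (l₁ := a :: b :: (l ++ [x, y])) h14 hQnd fun v hv hv' => ?_
    rw [← Multiset.mem_coe, h13, Finset.mem_val, hU, Finset.mem_union, Finset.mem_compl,
      Finset.mem_union, List.mem_toFinset] at hv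
    rcases hv with hv | hv
    · exact (Finset.disjoint_left.mp hQW) hv (List.mem_toFinset.mpr hv')
    · exact hv (Or.inr hv')
  · have h14 := congrArg Multiset.card h13
    rw [Multiset.coe_card, Finset.card_val, Finset.card_union_of_disjoint (by
      rw [hU]
      exact (disjoint_compl_right).mono_left Finset.subset_union_left)] at h14
    simp only [List.length_cons, List.length_append] at h14 ⊢
    omega

end Cycle

section Sorted

lemma SimpleGraph.ncard_neighborSet_eq_card_nb {V : Type} [Fintype V] (G : SimpleGraph V) (v : V) :
    (G.neighborSet v).ncard = (nb G v).card := by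
  rw [← Set.ncard_coe_finset]
  congr 1
  ext x
  simp

lemma Fin.card_filter_lt_of_monotone {n : ℕ} {d : Fin n → ℕ} {σ : Equiv.Perm (Fin n)}
    (hσ : Monotone (d ∘ σ)) {t : ℝ} (i : Fin n) (hi : t ≤ d (σ i)) :
    #{v | (d v : ℝ) < t} ≤ (i : ℕ) := by
  rw [← Fin.card_Iio, ← Finset.card_map (s := Finset.Iio i) σ.toEmbedding]
  refine Finset.card_le_card fun v hv => ?_
  rw [Finset.mem_filter] at hv
  rw [Finset.mem_map]
  refine ⟨σ.symm v, ?_, by simp⟩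
  rw [Finset.mem_Iio]
  by_contra h
  have h1 : d (σ i) ≤ d v := by simpa using hσ (not_lt.mp h)
  have h2 : (d (σ i) : ℝ) ≤ d v := by exact_mod_cast h1
  linarith [hv.2]

lemma posaDegree_of_sorted {η γ : ℝ} (hγ : γ ≤ η / 2) {n : ℕ} (hn : 2 ≤ η * n) (hn3 : 3 ≤ n)
    {G : SimpleGraph (Fin n)}
    (hG : ∀ σ : Equiv.Perm (Fin n),
      (∀ i j : Fin n, i ≤ j → (G.neighborSet (σ i)).ncard ≤ (G.neighborSet (σ j)).ncard) →
      ∀ i : Fin n, 3 * ((i : ℕ) + 1) ≤ n →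
        ((G.neighborSet (σ i)).ncard : ℝ) ≥ (n : ℝ) / 3 + ((i : ℕ) + 1) + η * n) :
    PosaDegree G γ := by
  simp only [SimpleGraph.ncard_neighborSet_eq_card_nb] at hG
  have hσ := Tuple.monotone_sort fun v => (nb G v).card
  have hd := hG (Tuple.sort fun v => (nb G v).card) fun i j hij => hσ hij
  have hγn : γ * n ≤ η / 2 * n := mul_le_mul_of_nonneg_right hγ (Nat.cast_nonneg n)
  intro s hs0 hs1
  rw [Fintype.card_fin] at hs1 ⊢
  set k := min ⌊s⌋₊ (n / 3 - 1) with hk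
  have hk1 : 3 * (k + 1) ≤ n := by omega
  have hks : (k : ℝ) ≤ s := le_trans (by exact_mod_cast min_le_left _ _) (Nat.floor_le hs0)
  have hsk : s < k + 2 := by
    rcases min_choice ⌊s⌋₊ (n / 3 - 1) with h | h
    · rw [hk, h]
      linarith [Nat.lt_floor_add_one s]
    · have h1 : n < 3 * (k + 2) := by omega
      have h2 : (n : ℝ) < 3 * (k + 2) := by exact_mod_cast h1
      linarith
  have h1 := hd ⟨k, by omega⟩ hk1
  refine le_trans ?_ hks
  exact_mod_cast Fin.card_filter_lt_of_monotone (d := fun v => (nb G v).card) hσ ⟨k, by omega⟩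
    (by simp only [ge_iff_le] at h1 ⊢; linarith)

end Sorted

section Cyclic

variable {V : Type} [Fintype V]

lemma exists_zmod_cycle {r : V → V → Prop} {a b : V} {l : List V}
    (h : SqChain r (a :: b :: (l ++ [a, b]))) (hnd : (a :: b :: l).Nodup) {n : ℕ}
    (hlen : (a :: b :: l).length = n) (hn : n = Fintype.card V) :
    ∃ f : ZMod n → V, Function.Bijective f ∧ ∀ i, r (f i) (f (i + 1)) ∧ r (f i) (f (i + 2)) := by
  have : NeZero n := ⟨by rw [← hlen]; simp⟩
  set C := a :: b :: l with hC
  have hlt (i : ZMod n) : i.val < C.length := (ZMod.val_lt i).trans_eq hlen.symm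
  have hD : a :: b :: (l ++ [a, b]) = C ++ [a, b] := rfl
  rw [hD] at h
  have hlen2 : 2 ≤ n := by rw [← hlen, hC]; simp
  have key : ∀ (i : ZMod n) (c : ℕ) (_ : c ≤ 2) (hi : i.val + c < (C ++ [a, b]).length),
      (C ++ [a, b])[i.val + c] = C[(i + (c : ZMod n)).val]'(hlt _) := by
    intro i c hc hi
    have h1 : (i + (c : ZMod n)).val = (i.val + c) % n := by
      rw [← ZMod.val_natCast, Nat.cast_add, ZMod.natCast_zmod_val]
    simp only [h1]
    have h2 := ZMod.val_lt i
    by_cases h3 : i.val + c < n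
    · simp only [Nat.mod_eq_of_lt h3]
      rw [List.getElem_append_left]
    · rw [List.getElem_append_right (by omega)]
      have h4 : (i.val + c) % n = (i.val + c - n) % n := by
        conv_lhs => rw [← Nat.sub_add_cancel (not_lt.mp h3), Nat.add_mod_right]
      have h5 : i.val + c - n = 0 ∨ i.val + c - n = 1 := by omega
      rcases h5 with h5 | h5
      · simp only [h4, hlen, h5, Nat.zero_mod]; rfl
      · simp only [h4, hlen, h5, Nat.mod_eq_of_lt hlen2]; rfl
  refine ⟨fun i => C[i.val]'(hlt i), ?_, fun i => ?_⟩
  · rw [Fintype.bijective_iff_injective_and_card, ZMod.card]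
    refine ⟨fun i j hij => ?_, hn⟩
    exact ZMod.val_injective n (hnd.getElem_inj_iff.mp hij)
  · have h2 := ZMod.val_lt i
    have hl : (C ++ [a, b]).length = n + 2 := by rw [List.length_append, hlen]; rfl
    obtain ⟨h3, h4⟩ := h.getElem (i := i.val)
    have e0 := key i 0 (by omega) (by omega)
    have e1 := key i 1 (by omega) (by omega)
    have e2 := key i 2 (by omega) (by omega)
    simp only [Nat.cast_zero, Nat.cast_one, Nat.cast_ofNat, add_zero] at e0 e1 e2
    refine ⟨?_, ?_⟩ <;> beta_reduce
    · rw [← e0, ← e1]; exact h3 (by omega)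
    · rw [← e0, ← e2]; exact h4 (by omega)

end Cyclic

end

/-- main theorem: for every `η > 0` there is `n₀` such that any
graph `G` on `n ≥ n₀` vertices whose degree sequence `d₁ ≤ … ≤ dₙ` satisfies
`dᵢ ≥ n/3 + i + ηn` for all `i ≤ n/3` contains the square of a Hamilton cycle,
i.e. a cyclic ordering `v₁,…,vₙ` of the vertices with `vᵢvⱼ ∈ E(G)` whenever
`|i − j| ∈ {1,2}` modulo `n`. -/
theorem stmt19 (η : ℝ) (hη : 0 < η) :
    ∃ n₀ : ℕ, ∀ n : ℕ, n₀ ≤ n →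
    ∀ G : SimpleGraph (Fin n),
      (∀ σ : Equiv.Perm (Fin n),
        (∀ i j : Fin n, i ≤ j →
          (G.neighborSet (σ i)).ncard ≤ (G.neighborSet (σ j)).ncard) →
        ∀ i : Fin n, 3 * ((i : ℕ) + 1) ≤ n →
          ((G.neighborSet (σ i)).ncard : ℝ) ≥
            (n : ℝ) / 3 + ((i : ℕ) + 1) + η * n) →
      ∃ f : ZMod n → Fin n, Function.Bijective f ∧
        ∀ i : ZMod n, G.Adj (f i) (f (i + 1)) ∧ G.Adj (f i) (f (i + 2)) := by
  obtain ⟨n₁, h1⟩ := exists_cycle (γ := min (η / 2) 1) (by positivity) (min_le_right _ _)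
  refine ⟨max n₁ (max 3 ⌈2 / η⌉₊), fun n hn G hG => ?_⟩
  rw [max_le_iff, max_le_iff, Nat.ceil_le, div_le_iff₀ hη, mul_comm] at hn
  obtain ⟨a, b, l, h2, h3, h4⟩ := h1 (Fin n) G
    (posaDegree_of_sorted (min_le_left _ _) hn.2.2 hn.2.1 hG) (by rw [Fintype.card_fin]; exact hn.1)
  exact exists_zmod_cycle h2 h3 (h4.trans (Fintype.card_fin n)) (Fintype.card_fin n).symm
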